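/- Assume the cycle weights satisfy either α_j → α with the summability conditions of Theorem 2.1, or α_j = γ log j with γ > 0, and suppose ρ > ρ_c, so that ν = 1 − ρ_c/ρ > 0. Then for every m ≥ 1 and every product of closed intervals A = [a_1,b_1] × … × [a_m,b_m] ⊂ (0,1)^m, the limit as |Λ|, N → ∞ (with ρ = N/|Λ| fixed) of the Gibbs probability that (ℓ^{(1)}/(νN), …, ℓ^{(m)}/(νN)) ∈ A equals the limit as n → ∞ of the nonspatial probability Prob_n that (ℓ^{(1)}/n, …, ℓ^{(m)}/n) ∈ A. -/

import Mathlib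

open MeasureTheory Filter Topology ENNReal FourierTransform

noncomputable section
open scoped Classical

/-! ### Permutation combinatorics -/

/-- `r_j(π)`: the number of cycles of length `j` in `π ∈ S_N`
(fixed points count as cycles of length 1). -/
def cycCount {N : ℕ} (π : Equiv.Perm (Fin N)) (j : ℕ) : ℕ :=
  if j = 1 then N - π.cycleType.sum else Multiset.count j π.cycleType

/-- The cycle weight `exp(-∑_{j≥1} α_j r_j(π))` of a permutation `π ∈ S_N`. -/
def permWeight (α : ℕ → ℝ) {N : ℕ} (π : Equiv.Perm (Fin N)) : ℝ :=
  Real.exp (-∑ j ∈ Finset.Icc 1 N, α j * (cycCount π j : ℝ))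

/-! ### The spatial model -/

/-- `h_n = (n!)⁻¹ ∑_{π ∈ S_n} e^{-∑_{j≥1} α_j r_j(π)}`, with `h_0 = 1`. -/
def hcoef (α : ℕ → ℝ) (n : ℕ) : ℝ :=
  (n.factorial : ℝ)⁻¹ * ∑ π : Equiv.Perm (Fin n), permWeight α π

/-- Euclidean space `ℝ^d`. -/
abbrev Eu (d : ℕ) := EuclideanSpace ℝ (Fin d)

/-- The lattice point `Lz ∈ ℝ^d`, for `z ∈ ℤ^d`. -/
def latPt (d : ℕ) (L : ℝ) (z : Fin d → ℤ) : Eu d :=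
  (WithLp.equiv 2 (Fin d → ℝ)).symm (fun i => L * (z i))

/-- The dual lattice point `z/L ∈ Λ* = L⁻¹ℤ^d`, for `z ∈ ℤ^d`. -/
def dualPt (d : ℕ) (L : ℝ) (z : Fin d → ℤ) : Eu d :=
  (WithLp.equiv 2 (Fin d → ℝ)).symm (fun i => (z i) / L)

/-- The cube `Λ ⊆ ℝ^d` of side `L`. -/
def cube (d : ℕ) (L : ℝ) : Set (Eu d) := {x | ∀ i, x i ∈ Set.Ico (0:ℝ) L}

/-- The periodization `e^{-ξ_Λ(x)} = ∑_{z∈ℤ^d} e^{-ξ(x-Lz)}` (values in `[0,∞]`),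
where `f = e^{-ξ}`. -/
def fper (d : ℕ) (f : Eu d → ℝ) (L : ℝ) (x : Eu d) : ℝ≥0∞ :=
  ∑' z : Fin d → ℤ, ENNReal.ofReal (f (x - latPt d L z))

/-- The (unnormalized) Gibbs weight of a permutation `π ∈ S_N`:
`e^{-∑_j α_j r_j(π)} ∫_{Λ^N} ∏_i e^{-ξ_Λ(x_i - x_{π(i)})} dx`. -/
def gibbsW (d : ℕ) (f : Eu d → ℝ) (α : ℕ → ℝ) (L : ℝ) (N : ℕ)
    (π : Equiv.Perm (Fin N)) : ℝ≥0∞ :=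
  ENNReal.ofReal (permWeight α π) *
    ∫⁻ x in Set.univ.pi (fun _ : Fin N => cube d L), ∏ i, fper d f L (x i - x (π i))

/-- The expectation, under the Gibbs measure on `Λ^N × S_N`, of a function of the
permutation alone. -/
def gibbsE (d : ℕ) (f : Eu d → ℝ) (α : ℕ → ℝ) (L : ℝ) (N : ℕ)
    (g : Equiv.Perm (Fin N) → ℝ) : ℝ :=
  (∑ π : Equiv.Perm (Fin N), (gibbsW d f α L N π).toReal * g π) /
    (∑ π : Equiv.Perm (Fin N), (gibbsW d f α L N π).toReal)

/-- The critical density `ρ_c = ∑_{j≥1} e^{-α_j} ∫_{ℝ^d} e^{-jε(k)} dk`. -/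
def rhoC (d : ℕ) (ε : Eu d → ℝ) (α : ℕ → ℝ) : ℝ :=
  ∑' j : ℕ, Real.exp (-α (j+1)) * ∫ k : Eu d, Real.exp (-(((j:ℝ)+1) * ε k))


/-- The multiset of cycle lengths of `π`, with multiplicity (fixed points included). -/
def cycleLens {N : ℕ} (π : Equiv.Perm (Fin N)) : Multiset ℕ :=
  π.cycleType + Multiset.replicate (N - π.cycleType.sum) 1

/-- `ℓ^{(i+1)}(π)`: the `(i+1)`-th largest cycle length of `π` (`i` is 0-indexed). -/
def ellD {N : ℕ} (π : Equiv.Perm (Fin N)) (i : ℕ) : ℕ :=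
  (((cycleLens π).sort (· ≤ ·)).reverse).getD i 0

open scoped Classical in
/-- The probability, under the Gibbs measure on `Λ^N × S_N`, of an event depending on
the permutation alone. -/
def gibbsP (d : ℕ) (f : Eu d → ℝ) (α : ℕ → ℝ) (L : ℝ) (N : ℕ)
    (A : Set (Equiv.Perm (Fin N))) : ℝ :=
  (∑ π : Equiv.Perm (Fin N), if π ∈ A then (gibbsW d f α L N π).toReal else 0) /
    (∑ π : Equiv.Perm (Fin N), (gibbsW d f α L N π).toReal)

/-! ### Cycle index generating functions -/

/-- The power series `∑_{j ≥ 1} c_j s^j / j`. -/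
def logSer (c : ℕ → ℝ) : PowerSeries ℝ := PowerSeries.mk fun j => c j / j

/-- The coefficient of `s^n` in `exp (∑_{j ≥ 1} c_j s^j / j)`. -/
def cycGen (c : ℕ → ℝ) (n : ℕ) : ℝ :=
  ∑ k ∈ Finset.range (n + 1), PowerSeries.coeff n (logSer c ^ k) / k.factorial

lemma coeff_logSer (c : ℕ → ℝ) (j : ℕ) : PowerSeries.coeff j (logSer c) = c j / j := by
  simp [logSer]

lemma coeff_pow_eq_zero {Q : PowerSeries ℝ} {D : ℕ}
    (h : ∀ j < D, PowerSeries.coeff j Q = 0) {n k : ℕ} (hn : n < k * D) :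
    PowerSeries.coeff n (Q ^ k) = 0 := by
  apply PowerSeries.coeff_of_lt_order
  have h1 : (D : ℕ∞) ≤ Q.order := PowerSeries.nat_le_order _ _ h
  have h2 : ((k * D : ℕ) : ℕ∞) ≤ k • Q.order := by
    rw [nsmul_eq_mul]; push_cast; gcongr
  exact lt_of_lt_of_le (by exact_mod_cast hn) (h2.trans (PowerSeries.le_order_pow Q k))

lemma coeff_logSer_pow_eq_zero (c : ℕ → ℝ) {n k : ℕ} (hn : n < k) :
    PowerSeries.coeff n (logSer c ^ k) = 0 := by
  refine coeff_pow_eq_zero (D := 1) (fun j hj => ?_) (by omega)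
  obtain rfl : j = 0 := by omega
  simp [coeff_logSer]

lemma cycGen_eq_sum (c : ℕ → ℝ) {n K : ℕ}
    (hK : ∀ k, K ≤ k → PowerSeries.coeff n (logSer c ^ k) = 0) :
    cycGen c n = ∑ k ∈ Finset.range K, PowerSeries.coeff n (logSer c ^ k) / k.factorial := by
  have h1 : ∀ M, n + 1 ≤ M → K ≤ M → cycGen c n =
      ∑ k ∈ Finset.range M, PowerSeries.coeff n (logSer c ^ k) / k.factorial := by
    intro M hM _
    refine Finset.sum_subset (Finset.range_mono hM) fun k _ hk => ?_
    rw [coeff_logSer_pow_eq_zero c (by simpa using hk), zero_div]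
  rw [h1 (max (n + 1) K) (le_max_left _ _) (le_max_right _ _)]
  symm
  refine Finset.sum_subset (Finset.range_mono (le_max_right _ _)) fun k _ hk => ?_
  rw [hK k (by simpa using hk), zero_div]

@[simp] lemma cycGen_zero (c : ℕ → ℝ) : cycGen c 0 = 1 := by
  simp [cycGen]

lemma succ_mul_cycGen_succ (c : ℕ → ℝ) (n : ℕ) :
    ((n : ℝ) + 1) * cycGen c (n + 1) =
      ∑ p ∈ Finset.HasAntidiagonal.antidiagonal n, c (p.1 + 1) * cycGen c p.2 := by
  have h1 : ∀ p ∈ Finset.HasAntidiagonal.antidiagonal n, c (p.1 + 1) * cycGen c p.2 =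
      ∑ k ∈ Finset.range (n + 1),
        c (p.1 + 1) * PowerSeries.coeff p.2 (logSer c ^ k) / k.factorial := by
    intro p hp
    rw [cycGen_eq_sum c (K := n + 1) fun k hk => coeff_logSer_pow_eq_zero c ?_, Finset.mul_sum]
    · simp only [mul_div_assoc]
    · have := Finset.HasAntidiagonal.mem_antidiagonal.1 hp
      omega
  rw [Finset.sum_congr rfl h1, Finset.sum_comm, cycGen, Finset.sum_range_succ', mul_add,
    Finset.mul_sum]
  simp only [pow_zero, PowerSeries.coeff_one, Nat.succ_ne_zero, if_false, zero_div, mul_zero,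
    add_zero]
  refine Finset.sum_congr rfl fun k _ => ?_
  have h2 := PowerSeries.coeff_derivative (logSer c ^ (k + 1)) n
  rw [PowerSeries.derivative_pow] at h2
  have h3 : ∀ j, PowerSeries.coeff j (PowerSeries.derivative ℝ (logSer c)) = c (j + 1) := by
    intro j
    rw [PowerSeries.coeff_derivative, coeff_logSer]
    push_cast
    field_simp
  have h4 : PowerSeries.coeff n
      (((k + 1 : ℕ) : PowerSeries ℝ) * logSer c ^ (k + 1 - 1) *
        PowerSeries.derivative ℝ (logSer c)) =
      ((k : ℝ) + 1) * ∑ p ∈ Finset.HasAntidiagonal.antidiagonal n,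
        c (p.1 + 1) * PowerSeries.coeff p.2 (logSer c ^ k) := by
    rw [mul_assoc, ← nsmul_eq_mul, map_nsmul, mul_comm, PowerSeries.coeff_mul, nsmul_eq_mul]
    simp only [h3, Nat.add_sub_cancel]
    push_cast
    rfl
  rw [h4] at h2
  rw [← Finset.sum_div, mul_div_assoc', mul_comm ((n : ℝ) + 1), ← h2, Nat.factorial_succ]
  push_cast
  have : (k.factorial : ℝ) ≠ 0 := by positivity
  field_simp

lemma eq_cycGen_of_recursion {c a : ℕ → ℝ} (h0 : a 0 = 1)
    (h : ∀ n : ℕ, ((n : ℝ) + 1) * a (n + 1) =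
      ∑ p ∈ Finset.HasAntidiagonal.antidiagonal n, c (p.1 + 1) * a p.2) : a = cycGen c := by
  funext n
  induction n using Nat.strong_induction_on with
  | _ n ih =>
    rcases n with _ | n
    · simp [h0]
    · have h1 : ((n : ℝ) + 1) * a (n + 1) = ((n : ℝ) + 1) * cycGen c (n + 1) := by
        rw [h, succ_mul_cycGen_succ]
        refine Finset.sum_congr rfl fun p hp => ?_
        rw [ih p.2 (by have := Finset.HasAntidiagonal.mem_antidiagonal.1 hp; omega)]
      exact mul_left_cancel₀ (by positivity) h1

/-- `exp (∑_{j ≥ 1} c_j s^j / j)` as a power series. -/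
def cycSer (c : ℕ → ℝ) : PowerSeries ℝ := PowerSeries.mk (cycGen c)

lemma coeff_cycSer (c : ℕ → ℝ) (n : ℕ) : PowerSeries.coeff n (cycSer c) = cycGen c n := by
  simp [cycSer]

lemma derivative_cycSer (c : ℕ → ℝ) : PowerSeries.derivative ℝ (cycSer c) =
    PowerSeries.mk (fun j => c (j + 1)) * cycSer c := by
  ext n
  rw [PowerSeries.coeff_derivative, PowerSeries.coeff_mul, coeff_cycSer, mul_comm,
    succ_mul_cycGen_succ]
  simp [coeff_cycSer]

lemma cycSer_add (c e : ℕ → ℝ) : cycSer (c + e) = cycSer c * cycSer e := by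
  have h : (fun n => PowerSeries.coeff n (cycSer c * cycSer e)) = cycGen (c + e) := by
    refine eq_cycGen_of_recursion ?_ fun n => ?_
    · simp [PowerSeries.coeff_mul, coeff_cycSer]
    · have h1 := PowerSeries.coeff_derivative (cycSer c * cycSer e) n
      rw [mul_comm _ (_ + 1)] at h1
      rw [← h1]
      have h2 : PowerSeries.derivative ℝ (cycSer c * cycSer e) =
          PowerSeries.mk (fun j => (c + e) (j + 1)) * (cycSer c * cycSer e) := by
        have h3 : (PowerSeries.mk (fun j => (c + e) (j + 1)) : PowerSeries ℝ) =
            PowerSeries.mk (fun j => c (j + 1)) + PowerSeries.mk (fun j => e (j + 1)) := by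
          ext; simp
        rw [Derivation.leibniz, derivative_cycSer, derivative_cycSer, h3]
        simp only [smul_eq_mul]
        ring
      rw [h2, PowerSeries.coeff_mul]
      simp
  ext n
  rw [coeff_cycSer, ← h]

lemma cycGen_add (c e : ℕ → ℝ) (n : ℕ) :
    cycGen (c + e) n = ∑ p ∈ Finset.HasAntidiagonal.antidiagonal n, cycGen c p.1 * cycGen e p.2 := by
  rw [← coeff_cycSer, cycSer_add, PowerSeries.coeff_mul]
  simp [coeff_cycSer]

lemma cycGen_mul_pow (c : ℕ → ℝ) (s : ℝ) (n : ℕ) :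
    cycGen (fun j => c j * s ^ j) n = cycGen c n * s ^ n := by
  refine (congrFun (eq_cycGen_of_recursion (a := fun n => cycGen c n * s ^ n) (by simp)
    fun n => ?_) n).symm
  rw [← mul_assoc, succ_mul_cycGen_succ, Finset.sum_mul]
  refine Finset.sum_congr rfl fun p hp => ?_
  rw [← Finset.HasAntidiagonal.mem_antidiagonal.1 hp]
  ring

lemma cycGen_nonneg {c : ℕ → ℝ} (hc : ∀ j, 1 ≤ j → 0 ≤ c j) (n : ℕ) : 0 ≤ cycGen c n := by
  induction n using Nat.strong_induction_on with
  | _ n ih =>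
    rcases n with _ | n
    · simp
    · have h : 0 ≤ ((n : ℝ) + 1) * cycGen c (n + 1) := by
        rw [succ_mul_cycGen_succ]
        refine Finset.sum_nonneg fun p hp => mul_nonneg (hc _ (by omega)) (ih _ ?_)
        have := Finset.HasAntidiagonal.mem_antidiagonal.1 hp
        omega
      exact nonneg_of_mul_nonneg_right h (by positivity)

lemma cycGen_mono {c e : ℕ → ℝ} (hc : ∀ j, 1 ≤ j → 0 ≤ c j) (hce : ∀ j, 1 ≤ j → c j ≤ e j)
    (n : ℕ) : cycGen c n ≤ cycGen e n := by
  have h : e = c + (e - c) := by abel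
  rw [h, cycGen_add]
  have h2 : ∀ j, 1 ≤ j → 0 ≤ (e - c) j := fun j hj => sub_nonneg.2 (hce j hj)
  calc cycGen c n = cycGen c n * cycGen (e - c) 0 := by simp
    _ ≤ _ := Finset.single_le_sum (f := fun p : ℕ × ℕ => cycGen c p.1 * cycGen (e - c) p.2)
      (fun p _ => mul_nonneg (cycGen_nonneg hc _) (cycGen_nonneg h2 _))
      (a := (n, 0)) (by simp)

lemma cycGen_congr {c e : ℕ → ℝ} (h : ∀ j, 1 ≤ j → c j = e j) (n : ℕ) :
    cycGen c n = cycGen e n := by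
  have : logSer c = logSer e := by
    ext j
    rw [coeff_logSer, coeff_logSer]
    rcases j with _ | j
    · simp
    · rw [h _ (by omega)]
  simp [cycGen, this]

lemma cycGen_le_sum {c : ℕ → ℝ} (hc : ∀ j, 1 ≤ j → 0 ≤ c j) {n : ℕ} (hn : 1 ≤ n) :
    cycGen c n ≤ ∑ p ∈ Finset.HasAntidiagonal.antidiagonal n, c p.1 / p.1 * cycGen c p.2 := by
  obtain ⟨n, rfl⟩ : ∃ k, n = k + 1 := ⟨n - 1, by omega⟩
  rw [Finset.Nat.sum_antidiagonal_succ]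
  simp only [Nat.cast_zero, _root_.div_zero, zero_mul, zero_add]
  have h : cycGen c (n + 1) =
      ∑ p ∈ Finset.HasAntidiagonal.antidiagonal n, c (p.1 + 1) / ((n : ℝ) + 1) * cycGen c p.2 := by
    have := succ_mul_cycGen_succ c n
    have h0 : (n : ℝ) + 1 ≠ 0 := by positivity
    rw [← mul_right_inj' h0, this, Finset.mul_sum]
    refine Finset.sum_congr rfl fun p _ => ?_
    field_simp
  rw [h]
  refine Finset.sum_le_sum fun p hp => ?_
  have hp' := Finset.HasAntidiagonal.mem_antidiagonal.1 hp
  have : (p.1 : ℝ) ≤ n := by exact_mod_cast (by omega : p.1 ≤ n)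
  refine mul_le_mul_of_nonneg_right ?_ (cycGen_nonneg hc _)
  refine div_le_div_of_nonneg_left (hc _ (by omega)) (by positivity) ?_
  push_cast
  linarith

/-- The loss in the partition function when cycle weights are lowered is at most the expected
number of cycles removed. -/
lemma cycGen_sub_le {c e : ℕ → ℝ} (he : ∀ j, 1 ≤ j → 0 ≤ e j) (hec : ∀ j, 1 ≤ j → e j ≤ c j)
    (n : ℕ) : cycGen c n - cycGen e n ≤
      ∑ p ∈ Finset.HasAntidiagonal.antidiagonal n, (c p.1 - e p.1) / p.1 * cycGen c p.2 := by
  set u := c - e with hu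
  have hu0 : ∀ j, 1 ≤ j → 0 ≤ u j := fun j hj => sub_nonneg.2 (hec j hj)
  have hc : c = u + e := by simp [hu]
  have h1 : ∀ i, PowerSeries.coeff i (cycSer u - 1) ≤
      PowerSeries.coeff i (logSer u * cycSer u) := by
    intro i
    rcases i with _ | i
    · simp [PowerSeries.coeff_mul, coeff_logSer, cycSer]
    · rw [map_sub, coeff_cycSer, PowerSeries.coeff_mul]
      simpa [PowerSeries.coeff_one, coeff_logSer, coeff_cycSer] using
        cycGen_le_sum hu0 (n := i + 1) (by omega)
  have h2 : cycGen c n - cycGen e n =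
      PowerSeries.coeff n ((cycSer u - 1) * cycSer e) := by
    rw [sub_mul, one_mul, ← cycSer_add, ← hc, map_sub, coeff_cycSer, coeff_cycSer]
  have h3 : ∑ p ∈ Finset.HasAntidiagonal.antidiagonal n, (c p.1 - e p.1) / p.1 * cycGen c p.2 =
      PowerSeries.coeff n ((logSer u * cycSer u) * cycSer e) := by
    rw [mul_assoc, ← cycSer_add, ← hc, PowerSeries.coeff_mul]
    simp [coeff_logSer, coeff_cycSer, hu]
  rw [h2, h3, PowerSeries.coeff_mul, PowerSeries.coeff_mul]
  refine Finset.sum_le_sum fun p _ => mul_le_mul_of_nonneg_right (h1 _) ?_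
  rw [coeff_cycSer]
  exact cycGen_nonneg he _

lemma summable_coeff_logSer_pow {c : ℕ → ℝ} (hs : Summable fun j => |c j| / j) (k : ℕ) :
    Summable (fun n => ‖PowerSeries.coeff n (logSer c ^ k)‖) ∧
      ∑' n, PowerSeries.coeff n (logSer c ^ k) = (∑' j, c j / (j : ℝ)) ^ k ∧
      ∑' n, ‖PowerSeries.coeff n (logSer c ^ k)‖ ≤ (∑' j, |c j| / (j : ℝ)) ^ k := by
  have hl : Summable fun n => ‖PowerSeries.coeff n (logSer c)‖ := by
    simpa [coeff_logSer, abs_div] using hs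
  induction k with
  | zero =>
    have h : ∀ n, n ∉ ({0} : Finset ℕ) → ‖PowerSeries.coeff n (logSer c ^ 0)‖ = 0 := by
      intro n hn
      have : n ≠ 0 := by simpa using hn
      simp [PowerSeries.coeff_one, this]
    refine ⟨summable_of_ne_finset_zero h, ?_, ?_⟩
    · rw [tsum_eq_single 0]
      · simp
      · intro n hn; simp [PowerSeries.coeff_one, hn]
    · rw [tsum_eq_single 0]
      · simp
      · intro n hn; simp [PowerSeries.coeff_one, hn]
  | succ k ih =>
    obtain ⟨i1, i2, i3⟩ := ih
    have e : ∀ n, PowerSeries.coeff n (logSer c ^ (k + 1)) =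
        ∑ p ∈ Finset.HasAntidiagonal.antidiagonal n,
          PowerSeries.coeff p.1 (logSer c ^ k) * PowerSeries.coeff p.2 (logSer c) := by
      intro n; rw [pow_succ, PowerSeries.coeff_mul]
    have s1 : Summable (fun n => ‖PowerSeries.coeff n (logSer c ^ (k + 1))‖) := by
      have h := summable_norm_sum_mul_antidiagonal_of_summable_norm i1 hl
      exact h.congr fun n => by rw [e]
    refine ⟨s1, ?_, ?_⟩
    · have h := tsum_mul_tsum_eq_tsum_sum_antidiagonal_of_summable_norm i1 hl
      rw [tsum_congr e, ← h, i2, pow_succ]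
      simp [coeff_logSer]
    · have s2 : Summable fun n => ∑ p ∈ Finset.HasAntidiagonal.antidiagonal n,
          ‖PowerSeries.coeff p.1 (logSer c ^ k)‖ * ‖PowerSeries.coeff p.2 (logSer c)‖ := by
        refine (summable_norm_sum_mul_antidiagonal_of_summable_norm
          (f := fun n => ‖PowerSeries.coeff n (logSer c ^ k)‖)
          (g := fun n => ‖PowerSeries.coeff n (logSer c)‖)
          (by simpa using i1) (by simpa using hl)).of_norm
      calc ∑' n, ‖PowerSeries.coeff n (logSer c ^ (k + 1))‖
          ≤ ∑' n, ∑ p ∈ Finset.HasAntidiagonal.antidiagonal n,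
            ‖PowerSeries.coeff p.1 (logSer c ^ k)‖ * ‖PowerSeries.coeff p.2 (logSer c)‖ := by
            refine s1.tsum_le_tsum (fun n => ?_) s2
            rw [e]
            refine (norm_sum_le _ _).trans (Finset.sum_le_sum fun p _ => ?_)
            rw [norm_mul]
        _ = (∑' n, ‖PowerSeries.coeff n (logSer c ^ k)‖) *
              ∑' n, ‖PowerSeries.coeff n (logSer c)‖ := by
            rw [tsum_mul_tsum_eq_tsum_sum_antidiagonal_of_summable_norm]
            · simpa using i1
            · simpa using hl
        _ ≤ (∑' j, |c j| / (j : ℝ)) ^ k * ∑' j, |c j| / (j : ℝ) := by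
            refine mul_le_mul i3 (le_of_eq ?_) (tsum_nonneg fun _ => norm_nonneg _) ?_
            · simp [coeff_logSer]
            · exact pow_nonneg (tsum_nonneg fun _ => by positivity) _
        _ = _ := (pow_succ _ _).symm

/-- Absolutely summable exponents give absolutely summable coefficients, with the expected sum. -/
lemma hasSum_cycGen {c : ℕ → ℝ} (hs : Summable fun j => |c j| / j) :
    HasSum (cycGen c) (Real.exp (∑' j, c j / (j : ℝ))) ∧ Summable fun n => |cycGen c n| := by
  set F : ℕ × ℕ → ℝ := fun p => PowerSeries.coeff p.2 (logSer c ^ p.1) / p.1.factorial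
  have hk := summable_coeff_logSer_pow hs
  have hF : Summable F := by
    refine Summable.of_norm ?_
    rw [summable_prod_of_nonneg (fun _ => norm_nonneg _)]
    refine ⟨fun k => ?_, ?_⟩
    · simp only [F, norm_div]
      exact (hk k).1.div_const _
    · refine Summable.of_nonneg_of_le (fun k => tsum_nonneg fun _ => norm_nonneg _) (fun k => ?_)
        (Real.summable_pow_div_factorial (∑' j, |c j| / (j : ℝ)))
      simp only [F, norm_div]
      rw [tsum_div_const, Real.norm_natCast]
      gcongr
      exact (hk k).2.2
  have e1 : ∀ n, ∑' k, F (k, n) = cycGen c n := by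
    intro n
    rw [tsum_eq_sum (s := Finset.range (n + 1))]
    · rfl
    · intro k hkn
      simp only [F]
      rw [coeff_logSer_pow_eq_zero c (by simpa using hkn), zero_div]
  have e2 : ∑' p, F p = Real.exp (∑' j, c j / (j : ℝ)) := by
    rw [hF.tsum_prod, Real.exp_eq_exp_ℝ, NormedSpace.exp_eq_tsum_div]
    refine tsum_congr fun k => ?_
    simp only [F]
    rw [tsum_div_const, (hk k).2.1]
  have hF2 : Summable fun p : ℕ × ℕ => F (p.2, p.1) := hF.prod_symm
  constructor
  · have h3 := hF2.hasSum.prod_fiberwise fun n => (hF2.prod_factor n).hasSum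
    have e3 : ∑' p : ℕ × ℕ, F (p.2, p.1) = ∑' p, F p := (Equiv.prodComm ℕ ℕ).tsum_eq F
    rw [e3, e2] at h3
    simpa [e1] using h3
  · refine Summable.of_nonneg_of_le (fun _ => abs_nonneg _) (fun n => ?_) hF2.norm.prod
    rw [← e1]
    exact norm_tsum_le_tsum_norm (hF2.norm.prod_factor n)

lemma one_div_le_cycGen {c : ℕ → ℝ} (hc : ∀ j, 1 ≤ j → 0 ≤ c j) {n : ℕ} (hn : 1 ≤ n) :
    c n / n ≤ cycGen c n := by
  obtain ⟨n, rfl⟩ : ∃ k, n = k + 1 := ⟨n - 1, by omega⟩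
  have h := succ_mul_cycGen_succ c n
  have h2 : c (n + 1) * cycGen c 0 ≤ ((n : ℝ) + 1) * cycGen c (n + 1) := by
    rw [h]
    exact Finset.single_le_sum (f := fun p : ℕ × ℕ => c (p.1 + 1) * cycGen c p.2)
      (fun p _ => mul_nonneg (hc _ (by omega)) (cycGen_nonneg hc _)) (a := (n, 0)) (by simp)
  rw [div_le_iff₀ (by positivity)]
  push_cast
  simpa [mul_comm] using h2

/-- Bounded cycle weights give a partition function of at most polynomial growth. -/
lemma cycGen_le_pow {c : ℕ → ℝ} {B : ℕ} (hB : 1 ≤ B) (hc : ∀ j, 1 ≤ j → 0 ≤ c j)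
    (hcB : ∀ j, 1 ≤ j → c j ≤ B) (n : ℕ) : cycGen c n ≤ ((n : ℝ) + 1) ^ B := by
  have key : ∀ n, ∑ i ∈ Finset.range (n + 1), cycGen c i ≤ ((n : ℝ) + 1) ^ B := by
    intro n
    induction n with
    | zero => simp
    | succ n ih =>
      rw [Finset.sum_range_succ]
      have h0 : (0 : ℝ) < (n : ℝ) + 1 := by positivity
      have h1 : ((n : ℝ) + 1) * cycGen c (n + 1) ≤
          B * ∑ i ∈ Finset.range (n + 1), cycGen c i := by
        rw [succ_mul_cycGen_succ, Finset.Nat.sum_antidiagonal_eq_sum_range_succ_mk,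
          ← Finset.sum_range_reflect, Finset.mul_sum]
        refine Finset.sum_le_sum fun i hi => ?_
        have hi' : i < n + 1 := by simpa using hi
        have : n - (n + 1 - 1 - i) = i := by omega
        simp only [this]
        exact mul_le_mul_of_nonneg_right (hcB _ (by omega)) (cycGen_nonneg hc _)
      have h2 : (1 : ℝ) + B * (1 / ((n : ℝ) + 1)) ≤ (1 + 1 / ((n : ℝ) + 1)) ^ B := by
        refine one_add_mul_le_pow ?_ B
        have : 0 ≤ 1 / ((n : ℝ) + 1) := by positivity
        linarith
      set S := ∑ i ∈ Finset.range (n + 1), cycGen c i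
      have h3 : cycGen c (n + 1) ≤ B * S / ((n : ℝ) + 1) := by
        rw [le_div_iff₀ h0]; linarith
      have h4 : 0 ≤ S := Finset.sum_nonneg fun i _ => cycGen_nonneg hc _
      calc S + cycGen c (n + 1) ≤ S * (1 + B * (1 / ((n : ℝ) + 1))) := by
            rw [mul_add, mul_one]
            have : S * (B * (1 / ((n : ℝ) + 1))) = B * S / ((n : ℝ) + 1) := by field_simp
            linarith
        _ ≤ ((n : ℝ) + 1) ^ B * (1 + 1 / ((n : ℝ) + 1)) ^ B := by gcongr
        _ = _ := by
            rw [← mul_pow]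
            push_cast
            congr 1
            field_simp
  refine le_trans ?_ (key n)
  exact Finset.single_le_sum (fun i _ => cycGen_nonneg hc i) (by simp)

/-! ### Sums over permutations -/

/-- The multisets of positive integers with sum `N`. -/
def partsOf (N : ℕ) : Finset (Multiset ℕ) :=
  (Finset.univ : Finset (Nat.Partition N)).image Nat.Partition.parts

lemma mem_partsOf {N : ℕ} {m : Multiset ℕ} :
    m ∈ partsOf N ↔ (∀ i ∈ m, 0 < i) ∧ m.sum = N := by
  simp only [partsOf, Finset.mem_image, Finset.mem_univ, true_and]
  constructor
  · rintro ⟨p, rfl⟩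
    exact ⟨fun i hi => p.parts_pos hi, p.parts_sum⟩
  · rintro ⟨h1, h2⟩
    exact ⟨⟨m, fun {i} hi => h1 i hi, h2⟩, rfl⟩

/-- The order of the centralizer of a permutation with cycle lengths `m`. -/
def centralizerCard (m : Multiset ℕ) : ℕ := m.prod * ∏ n ∈ m.toFinset, (m.count n).factorial

lemma centralizerCard_pos {m : Multiset ℕ} (hm : ∀ i ∈ m, 0 < i) : 0 < centralizerCard m :=
  Nat.mul_pos (Multiset.prod_pos hm) (Finset.prod_pos fun _ _ => Nat.factorial_pos _)

lemma centralizerCard_cons (j : ℕ) (m : Multiset ℕ) :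
    centralizerCard (j ::ₘ m) = j * (m.count j + 1) * centralizerCard m := by
  have h1 : ∏ n ∈ (j ::ₘ m).toFinset, ((j ::ₘ m).count n).factorial =
      (m.count j + 1) * ∏ n ∈ m.toFinset, (m.count n).factorial := by
    have e1 : ∏ n ∈ m.toFinset, (m.count n).factorial =
        ∏ n ∈ (j ::ₘ m).toFinset, (m.count n).factorial := by
      refine Finset.prod_subset (by simp [Multiset.toFinset_cons]) fun n _ hn => ?_
      rw [Multiset.count_eq_zero_of_notMem (by simpa using hn)]; rfl
    rw [e1, ← Finset.mul_prod_erase _ _ (a := j) (by simp),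
      ← Finset.mul_prod_erase _ (fun n => (m.count n).factorial) (a := j) (by simp),
      Multiset.count_cons_self, Nat.factorial_succ]
    rw [← mul_assoc]
    congr 1
    refine Finset.prod_congr rfl fun n hn => ?_
    rw [Multiset.count_cons_of_ne (Finset.ne_of_mem_erase hn)]
  rw [centralizerCard, h1, Multiset.prod_cons, centralizerCard]
  ring

lemma cycleLens_pos {N : ℕ} (π : Equiv.Perm (Fin N)) : ∀ i ∈ cycleLens π, 0 < i := by
  intro i hi
  rcases Multiset.mem_add.1 hi with h | h
  · exact lt_trans Nat.zero_lt_one (Equiv.Perm.one_lt_of_mem_cycleType h)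
  · rw [Multiset.eq_of_mem_replicate h]; exact Nat.one_pos

lemma cycleType_sum_le {N : ℕ} (π : Equiv.Perm (Fin N)) : π.cycleType.sum ≤ N := by
  have := π.sum_cycleType_le
  simpa using this

lemma cycleLens_sum {N : ℕ} (π : Equiv.Perm (Fin N)) : (cycleLens π).sum = N := by
  have := cycleType_sum_le π
  simp [cycleLens]
  omega

lemma cycleLens_mem_partsOf {N : ℕ} (π : Equiv.Perm (Fin N)) : cycleLens π ∈ partsOf N :=
  mem_partsOf.2 ⟨cycleLens_pos π, cycleLens_sum π⟩

lemma card_cycleLens_eq {N : ℕ} {m : Multiset ℕ} (hm : m ∈ partsOf N) :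
    (Finset.univ.filter fun π : Equiv.Perm (Fin N) => cycleLens π = m).card *
      centralizerCard m = N.factorial := by
  obtain ⟨hpos, hsum⟩ := mem_partsOf.1 hm
  set m2 := m.filter (fun i => 2 ≤ i) with hm2
  have hsplit : m = m2 + Multiset.replicate (m.count 1) 1 := by
    have h := (Multiset.filter_add_not (fun i => 2 ≤ i) m).symm
    have h' : m.filter (fun i => ¬2 ≤ i) = Multiset.replicate (m.count 1) 1 := by
      rw [← Multiset.filter_eq']
      refine Multiset.filter_congr fun x hx => ?_
      have := hpos x hx
      omega
    rwa [h'] at h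
  have hs2 : m2.sum + m.count 1 = N := by
    have := congrArg Multiset.sum hsplit
    rw [hsum, Multiset.sum_add, Multiset.sum_replicate] at this
    simpa using this.symm
  have hm2' : ∀ a ∈ m2, 2 ≤ a := fun a ha => (Multiset.mem_filter.1 ha).2
  have hiff : ∀ π : Equiv.Perm (Fin N), cycleLens π = m ↔ π.cycleType = m2 := by
    intro π
    constructor
    · intro h
      rw [hm2, ← h, cycleLens, Multiset.filter_add]
      rw [Multiset.filter_eq_self.2 fun a ha => Equiv.Perm.two_le_of_mem_cycleType ha,
        Multiset.filter_eq_nil.2 fun a ha => by rw [Multiset.eq_of_mem_replicate ha]; omega]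
      simp
    · intro h
      have hN : N - m2.sum = m.count 1 := by omega
      rw [cycleLens, h, hN, ← hsplit]
  have hcard := Equiv.Perm.card_of_cycleType_mul_eq (Fin N) m2
  rw [Fintype.card_fin, if_pos ⟨by omega, hm2'⟩] at hcard
  rw [← hcard]
  have e1 : (Finset.univ.filter fun π : Equiv.Perm (Fin N) => cycleLens π = m) =
      Finset.univ.filter fun π : Equiv.Perm (Fin N) => π.cycleType = m2 :=
    Finset.filter_congr fun π _ => hiff π
  have e2 : centralizerCard m =
      (N - m2.sum).factorial * m2.prod * ∏ n ∈ m2.toFinset, (m2.count n).factorial := by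
    have hN : N - m2.sum = m.count 1 := by omega
    have hp : m.prod = m2.prod := by
      conv_lhs => rw [hsplit]
      simp
    have hq : ∏ n ∈ m.toFinset, (m.count n).factorial =
        (m.count 1).factorial * ∏ n ∈ m2.toFinset, (m2.count n).factorial := by
      have h1 : ∏ n ∈ m.toFinset, (m.count n).factorial =
          ∏ n ∈ insert 1 m2.toFinset, (m.count n).factorial := by
        refine Finset.prod_subset (fun n hn => ?_) fun n _ hn => ?_
        · have hn' : n ∈ m := by simpa using hn
          by_cases h : n = 1
          · simp [h]
          · have := hpos n hn'
            simp [hm2, hn']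
            omega
        · rw [Multiset.count_eq_zero_of_notMem (by simpa using hn)]; rfl
      rw [h1, Finset.prod_insert]
      · congr 1
        refine Finset.prod_congr rfl fun n hn => ?_
        have hn' : n ∈ m2 := by simpa using hn
        rw [hm2, Multiset.count_filter_of_pos (hm2' n hn')]
      · simp [hm2]
    rw [centralizerCard, hN, hp, hq]
    ring
  rw [e1, e2]

/-- The total weight of the multisets of cycle lengths with sum `N`. -/
def partSum (c : ℕ → ℝ) (N : ℕ) : ℝ :=
  ∑ m ∈ partsOf N, (m.map c).prod / centralizerCard m

lemma sum_perm_eq_partSum (c : ℕ → ℝ) (N : ℕ) :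
    ∑ π : Equiv.Perm (Fin N), ((cycleLens π).map c).prod = N.factorial * partSum c N := by
  rw [partSum, Finset.mul_sum,
    ← Finset.sum_fiberwise_of_maps_to (t := partsOf N) (g := cycleLens)
      fun π _ => cycleLens_mem_partsOf π]
  refine Finset.sum_congr rfl fun m hm => ?_
  have h := card_cycleLens_eq hm
  have hz : (centralizerCard m : ℝ) ≠ 0 := by
    exact_mod_cast (centralizerCard_pos (mem_partsOf.1 hm).1).ne'
  rw [Finset.sum_congr rfl (g := fun _ => (m.map c).prod)
    (fun π hπ => by rw [(Finset.mem_filter.1 hπ).2]), Finset.sum_const, nsmul_eq_mul, ← h]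
  push_cast
  field_simp

lemma partSum_succ (c : ℕ → ℝ) (n : ℕ) :
    ((n : ℝ) + 1) * partSum c (n + 1) =
      ∑ p ∈ Finset.HasAntidiagonal.antidiagonal n, c (p.1 + 1) * partSum c p.2 := by
  set w : Multiset ℕ → ℝ := fun m => (m.map c).prod / centralizerCard m with hw
  have hL : ((n : ℝ) + 1) * partSum c (n + 1) =
      ∑ x ∈ (partsOf (n + 1)).sigma (fun m => m.toFinset), c x.2 * w (x.1.erase x.2) := by
    rw [Finset.sum_sigma, partSum, Finset.mul_sum]
    refine Finset.sum_congr rfl fun m hm => ?_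
    obtain ⟨hpos, hsum⟩ := mem_partsOf.1 hm
    have h1 : ((n : ℝ) + 1) = ∑ j ∈ m.toFinset, (m.count j : ℝ) * j := by
      have := Finset.sum_multiset_count m
      rw [hsum] at this
      have h2 := congrArg (fun k : ℕ => (k : ℝ)) this
      push_cast at h2
      simpa [smul_eq_mul] using h2
    rw [h1, Finset.sum_mul]
    refine Finset.sum_congr rfl fun j hj => ?_
    have hj' : j ∈ m := by simpa using hj
    have hm' : j ::ₘ m.erase j = m := Multiset.cons_erase hj'
    have hz : (centralizerCard (m.erase j) : ℝ) ≠ 0 := by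
      exact_mod_cast (centralizerCard_pos fun i hi => hpos i (Multiset.mem_of_mem_erase hi)).ne'
    have hj0 : (j : ℝ) ≠ 0 := by exact_mod_cast (hpos j hj').ne'
    have hc : m.count j = (m.erase j).count j + 1 := by
      conv_lhs => rw [← hm']
      simp
    have e1 : (m.map c).prod = c j * ((m.erase j).map c).prod := by
      conv_lhs => rw [← hm']
      simp
    have e2 : (centralizerCard m : ℝ) =
        j * ((m.erase j).count j + 1) * centralizerCard (m.erase j) := by
      conv_lhs => rw [← hm']
      rw [centralizerCard_cons]
      push_cast
      ring
    rw [e1, e2, hc, hw]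
    have : ((m.erase j).count j : ℝ) + 1 ≠ 0 := by positivity
    push_cast
    field_simp
  have hR : ∑ p ∈ Finset.HasAntidiagonal.antidiagonal n, c (p.1 + 1) * partSum c p.2 =
      ∑ x ∈ (Finset.HasAntidiagonal.antidiagonal n).sigma (fun p => partsOf p.2),
        c (x.1.1 + 1) * w x.2 := by
    rw [Finset.sum_sigma]
    refine Finset.sum_congr rfl fun p _ => ?_
    rw [partSum, Finset.mul_sum]
  rw [hL, hR]
  refine Finset.sum_bij' (fun x _ => ⟨(x.2 - 1, n + 1 - x.2), x.1.erase x.2⟩)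
    (fun y _ => ⟨(y.1.1 + 1) ::ₘ y.2, y.1.1 + 1⟩) ?_ ?_ ?_ ?_ ?_
  · rintro ⟨m, j⟩ hx
    simp only [Finset.mem_sigma, Multiset.mem_toFinset] at hx
    obtain ⟨hm, hj⟩ := hx
    obtain ⟨hpos, hsum⟩ := mem_partsOf.1 hm
    have hs : j + (m.erase j).sum = n + 1 := by
      rw [← Multiset.sum_cons, Multiset.cons_erase hj, hsum]
    have := hpos j hj
    simp only [Finset.mem_sigma, Finset.HasAntidiagonal.mem_antidiagonal, mem_partsOf]
    exact ⟨by omega, fun i hi => hpos i (Multiset.mem_of_mem_erase hi), by omega⟩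
  · rintro ⟨⟨i, k⟩, q⟩ hy
    simp only [Finset.mem_sigma, Finset.HasAntidiagonal.mem_antidiagonal, mem_partsOf] at hy
    obtain ⟨h1, h2, h3⟩ := hy
    simp only [Finset.mem_sigma, mem_partsOf, Multiset.mem_toFinset, Multiset.mem_cons,
      Multiset.sum_cons, true_or, and_true]
    refine ⟨?_, by omega⟩
    rintro a (rfl | ha)
    · omega
    · exact h2 a ha
  · rintro ⟨m, j⟩ hx
    simp only [Finset.mem_sigma, Multiset.mem_toFinset] at hx
    obtain ⟨hm, hj⟩ := hx
    have := (mem_partsOf.1 hm).1 j hj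
    have e : j - 1 + 1 = j := by omega
    simp only [e, Multiset.cons_erase hj]
  · rintro ⟨⟨i, k⟩, q⟩ hy
    simp only [Finset.mem_sigma, Finset.HasAntidiagonal.mem_antidiagonal] at hy
    have e : n + 1 - (i + 1) = k := by omega
    simp only [Nat.add_sub_cancel, Multiset.erase_cons_head, e]
  · rintro ⟨m, j⟩ hx
    simp only [Finset.mem_sigma, Multiset.mem_toFinset] at hx
    obtain ⟨hm, hj⟩ := hx
    have := (mem_partsOf.1 hm).1 j hj
    have e : j - 1 + 1 = j := by omega
    simp only [e]

/-- The exponential formula: total cycle weight of the symmetric group. -/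
lemma sum_perm_cycleLens (c : ℕ → ℝ) (N : ℕ) :
    ∑ π : Equiv.Perm (Fin N), ((cycleLens π).map c).prod = N.factorial * cycGen c N := by
  have h : partSum c = cycGen c := by
    refine eq_cycGen_of_recursion ?_ (partSum_succ c)
    have : partsOf 0 = {0} := by
      ext m
      rw [mem_partsOf, Finset.mem_singleton]
      constructor
      · rintro ⟨h1, h2⟩
        rw [Multiset.eq_zero_iff_forall_notMem]
        intro i hi
        have := Multiset.single_le_sum (fun x _ => Nat.zero_le x) i hi
        have := h1 i hi
        omega
      · rintro rfl; simp
    simp [partSum, this, centralizerCard]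
  rw [sum_perm_eq_partSum, h]

lemma permWeight_eq (α : ℕ → ℝ) {N : ℕ} (π : Equiv.Perm (Fin N)) :
    permWeight α π = ((cycleLens π).map fun j => Real.exp (-α j)).prod := by
  have h1 : ∀ j, cycCount π j = if j = 0 then cycCount π 0 else (cycleLens π).count j := by
    intro j
    by_cases h0 : j = 0
    · simp [h0]
    rw [if_neg h0, cycCount, cycleLens, Multiset.count_add, Multiset.count_replicate]
    by_cases h : j = 1
    · subst h
      rw [if_pos rfl, if_pos rfl, Multiset.count_eq_zero_of_notMem, zero_add]
      intro h
      exact absurd (Equiv.Perm.one_lt_of_mem_cycleType h) (lt_irrefl _)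
    · rw [if_neg h, if_neg (fun h' => h h'.symm), add_zero]
  have h2 : ((cycleLens π).map fun j => Real.exp (-α j)).prod =
      Real.exp ((cycleLens π).map fun j => -α j).sum := by
    induction cycleLens π using Multiset.induction_on with
    | empty => simp
    | cons a s ih => simp [ih, Real.exp_add]
  rw [permWeight, h2, Finset.sum_multiset_map_count, ← Finset.sum_neg_distrib]
  congr 1
  symm
  refine (Finset.sum_subset (s₂ := Finset.Icc 1 N) (fun j hj => ?_) fun j _ hj => ?_).trans ?_
  · have hj' : j ∈ cycleLens π := by simpa using hj
    have := Multiset.single_le_sum (fun x _ => Nat.zero_le x) j hj'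
    rw [cycleLens_sum] at this
    exact Finset.mem_Icc.2 ⟨cycleLens_pos π j hj', this⟩
  · rw [Multiset.count_eq_zero_of_notMem (by simpa using hj), zero_smul]
  · refine Finset.sum_congr rfl fun j hj => ?_
    have : j ≠ 0 := by have := (Finset.mem_Icc.1 hj).1; omega
    rw [h1 j, if_neg this, nsmul_eq_mul]
    ring

lemma hcoef_eq (α : ℕ → ℝ) (n : ℕ) : hcoef α n = cycGen (fun j => Real.exp (-α j)) n := by
  rw [hcoef]
  simp only [permWeight_eq]
  rw [sum_perm_cycleLens, ← mul_assoc, inv_mul_cancel₀ (by positivity), one_mul]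

/-! ### Events for the ordered cycle lengths -/

lemma list_getD_iff_countP {P : ℕ → Prop} [DecidablePred P] (hP : ∀ x y, x ≤ y → P x → P y) (h0 : ¬P 0)
    (l : List ℕ) (hl : l.Pairwise (· ≥ ·)) (i : ℕ) :
    P (l.getD i 0) ↔ i < l.countP (fun x => decide (P x)) := by
  induction l generalizing i with
  | nil => simpa using h0
  | cons a l ih =>
    rw [List.pairwise_cons] at hl
    by_cases ha : P a
    · rw [List.countP_cons_of_pos (by simpa using ha)]
      rcases i with _ | i
      · simpa using ha
      · rw [List.getD_cons_succ, ih hl.2]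
        omega
    · have hn : ∀ x ∈ l, ¬P x := fun x hx h => ha (hP _ _ (hl.1 x hx) h)
      have hc : (a :: l).countP (fun x => decide (P x)) = 0 := by
        rw [List.countP_eq_zero]
        intro x hx
        rcases List.mem_cons.1 hx with rfl | hx
        · simpa using ha
        · simpa using hn x hx
      rw [hc]
      refine iff_of_false ?_ (Nat.not_lt_zero _)
      rcases i with _ | i
      · simpa using ha
      · rw [List.getD_cons_succ, ih hl.2]
        rw [List.countP_eq_zero.2 fun x hx => by simpa using hn x hx]
        exact Nat.not_lt_zero _

lemma ellD_iff_countP {P : ℕ → Prop} [DecidablePred P] (hP : ∀ x y, x ≤ y → P x → P y) (h0 : ¬P 0)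
    {N : ℕ} (π : Equiv.Perm (Fin N)) (i : ℕ) :
    P (ellD π i) ↔ i < (cycleLens π).countP P := by
  have h := list_getD_iff_countP hP h0 ((cycleLens π).sort (· ≤ ·)).reverse
    (by
      rw [List.pairwise_reverse]
      exact Multiset.pairwise_sort _ _) i
  rw [ellD, h]
  have : (cycleLens π).countP P = (((cycleLens π).sort (· ≤ ·) : List ℕ) : Multiset ℕ).countP P := by
    rw [Multiset.sort_eq]
  rw [this, Multiset.coe_countP, List.countP_reverse]

/-- The multiplicative functional `∏_i σ(i,0)^{1[a_i ≤ x]} σ(i,1)^{1[b_i < x]}`. -/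
def stepV {m : ℕ} (a b : Fin m → ℝ) (σ : Fin m × Bool → ℝ) (x : ℝ) : ℝ :=
  ∏ i : Fin m × Bool, if (if i.2 then b i.1 < x else a i.1 ≤ x) then σ i else 1

lemma exists_eq_sum_pow (K : ℕ) (φ : ℕ → ℝ) :
    ∃ coef : Fin (K + 1) → ℝ, ∀ x ≤ K, φ x = ∑ s, coef s * (((s : ℕ) : ℝ) + 1)⁻¹ ^ x := by
  set u : Fin (K + 1) → ℝ := fun s => (((s : ℕ) : ℝ) + 1)⁻¹ with hu
  have hinj : Function.Injective u := by
    intro s s' h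
    have : ((s : ℕ) : ℝ) + 1 = ((s' : ℕ) : ℝ) + 1 := inv_injective h
    exact Fin.ext (by exact_mod_cast (add_right_cancel this))
  have hdet : (Matrix.vandermonde u).det ≠ 0 := Matrix.det_vandermonde_ne_zero_iff.2 hinj
  have hunit : IsUnit (Matrix.vandermonde u).det := isUnit_iff_ne_zero.2 hdet
  refine ⟨Matrix.vecMul (fun x : Fin (K + 1) => φ x) (Matrix.vandermonde u)⁻¹, fun x hx => ?_⟩
  have h1 : Matrix.vecMul (Matrix.vecMul (fun x : Fin (K + 1) => φ x) (Matrix.vandermonde u)⁻¹)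
      (Matrix.vandermonde u) = fun x : Fin (K + 1) => φ x := by
    rw [Matrix.vecMul_vecMul, Matrix.nonsing_inv_mul _ hunit, Matrix.vecMul_one]
  have h2 := congrFun h1 ⟨x, by omega⟩
  rw [← h2, Matrix.vecMul, dotProduct]
  rfl

lemma prod_pow_countP {ι : Type*} [Fintype ι] (P : ι → ℕ → Prop)
    [∀ i, DecidablePred (P i)] (u : ι → ℝ) (s : Multiset ℕ) :
    ∏ i, u i ^ s.countP (P i) = (s.map fun j => ∏ i, if P i j then u i else 1).prod := by
  induction s using Multiset.induction_on with
  | empty => simp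
  | cons a s ih =>
    rw [Multiset.map_cons, Multiset.prod_cons, ← ih, ← Finset.prod_mul_distrib]
    refine Finset.prod_congr rfl fun i _ => ?_
    by_cases h : P i a
    · rw [Multiset.countP_cons_of_pos _ h, if_pos h, pow_succ, mul_comm]
    · rw [Multiset.countP_cons_of_neg _ h, if_neg h, one_mul]

lemma countP_mul_le (s : Multiset ℕ) (P : ℕ → Prop) [DecidablePred P] (y : ℝ) (hP : ∀ j, P j → y ≤ j) :
    (s.countP P : ℝ) * y ≤ s.sum := by
  induction s using Multiset.induction_on with
  | empty => simp
  | cons a s ih =>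
    rw [Multiset.sum_cons, Nat.cast_add]
    by_cases h : P a
    · rw [Multiset.countP_cons_of_pos _ h]
      rw [Nat.cast_add, Nat.cast_one]
      have := hP a h
      linarith
    · rw [Multiset.countP_cons_of_neg _ h]
      have : (0 : ℝ) ≤ a := Nat.cast_nonneg a
      linarith

/-- The nodes `1/(s+1)` attached to a multi-index. -/
def node {ι : Type*} {K : ℕ} (σ : ι → Fin (K + 1)) (i : ι) : ℝ := (((σ i : ℕ) : ℝ) + 1)⁻¹

lemma exists_event_expansion {m : ℕ} (a b : Fin m → ℝ) {δ : ℝ} (hδ : 0 < δ)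
    (ha : ∀ i, δ ≤ a i) (hab : ∀ i, a i ≤ b i) (K : ℕ) :
    ∃ coef : (Fin m × Bool → Fin (K + 1)) → ℝ, ∀ (N : ℕ) (t : ℝ), 0 < t → (N : ℝ) ≤ K * (δ * t) →
      ∀ π : Equiv.Perm (Fin N),
        (if ∀ i : Fin m, (ellD π (i : ℕ) : ℝ) / t ∈ Set.Icc (a i) (b i) then (1 : ℝ) else 0) =
          ∑ σ, coef σ * ((cycleLens π).map fun j : ℕ => stepV a b (node σ) (j / t)).prod := by
  set φ : Fin m × Bool → ℕ → ℝ := fun i x =>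
    if (if i.2 then x ≤ (i.1 : ℕ) else (i.1 : ℕ) < x) then 1 else 0 with hφ
  choose c hc using fun i => exists_eq_sum_pow K (φ i)
  refine ⟨fun σ => ∏ i, c i (σ i), fun N t ht hN π => ?_⟩
  set P : Fin m × Bool → ℕ → Prop := fun i j =>
    if i.2 then b i.1 < (j : ℝ) / t else a i.1 ≤ (j : ℝ) / t with hPdef
  have hbpos : ∀ i, 0 < b i := fun i => hδ.trans_le ((ha i).trans (hab i))
  have hmono : ∀ i x y, x ≤ y → P i x → P i y := by
    rintro ⟨i, _ | _⟩ x y hxy h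
    · simp only [hPdef, Bool.false_eq_true, if_false] at h ⊢
      refine h.trans ?_
      gcongr
    · simp only [hPdef, if_true] at h ⊢
      refine h.trans_le ?_
      gcongr
  have h0 : ∀ i, ¬P i 0 := by
    rintro ⟨i, _ | _⟩ h
    · simp only [hPdef, Bool.false_eq_true, if_false, Nat.cast_zero, _root_.zero_div] at h
      exact absurd (hδ.trans_le (ha i)) (not_lt.2 h)
    · simp only [hPdef, if_true, Nat.cast_zero, _root_.zero_div] at h
      exact absurd (hbpos i) (not_lt.2 h.le)
  have hcount : ∀ i, (cycleLens π).countP (P i) ≤ K := by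
    intro i
    have h1 : ∀ j, P i j → δ * t ≤ j := by
      intro j hj
      rw [← le_div_iff₀ ht]
      rcases i with ⟨i, _ | _⟩
      · simp only [hPdef, Bool.false_eq_true, if_false] at hj
        exact (ha i).trans hj
      · simp only [hPdef, if_true] at hj
        exact (ha i).trans ((hab i).trans hj.le)
    have h2 := countP_mul_le (cycleLens π) (P i) (δ * t) h1
    rw [cycleLens_sum] at h2
    have h3 : ((cycleLens π).countP (P i) : ℝ) * (δ * t) ≤ K * (δ * t) := h2.trans hN
    exact_mod_cast le_of_mul_le_mul_right h3 (by positivity)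
  have hind : (if ∀ i : Fin m, (ellD π (i : ℕ) : ℝ) / t ∈ Set.Icc (a i) (b i)
      then (1 : ℝ) else 0) = ∏ i, φ i ((cycleLens π).countP (P i)) := by
    simp only [hφ, Finset.prod_ite_zero, Finset.prod_const_one]
    refine if_congr ?_ rfl rfl
    simp only [Finset.mem_univ, true_implies, Prod.forall, Bool.forall_bool, Bool.false_eq_true,
      if_false, if_true]
    refine forall_congr' fun i => ?_
    rw [Set.mem_Icc]
    refine and_congr ?_ ?_
    · rw [← ellD_iff_countP (hmono (i, false)) (h0 _)]
      simp [hPdef]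
    · rw [← not_lt, ← not_lt, ← ellD_iff_countP (hmono (i, true)) (h0 _)]
      simp [hPdef]
  rw [hind]
  have : ∀ i, φ i ((cycleLens π).countP (P i)) =
      ∑ s, c i s * (((s : ℕ) : ℝ) + 1)⁻¹ ^ (cycleLens π).countP (P i) :=
    fun i => hc i _ (hcount i)
  simp only [this, Finset.prod_univ_sum, Fintype.piFinset_univ]
  refine Finset.sum_congr rfl fun σ _ => ?_
  rw [Finset.prod_mul_distrib, prod_pow_countP P (fun i => (((σ i : ℕ) : ℝ) + 1)⁻¹)]
  rfl

lemma node_mem {ι : Type*} {K : ℕ} (σ : ι → Fin (K + 1)) (i : ι) :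
    0 ≤ node σ i ∧ node σ i ≤ 1 := by
  refine ⟨by unfold node; positivity, inv_le_one_of_one_le₀ ?_⟩
  have : (0 : ℝ) ≤ ((σ i : ℕ) : ℝ) := Nat.cast_nonneg _
  linarith

lemma stepV_nonneg {m : ℕ} {a b : Fin m → ℝ} {σ : Fin m × Bool → ℝ} (h : ∀ i, 0 ≤ σ i) (x : ℝ) :
    0 ≤ stepV a b σ x :=
  Finset.prod_nonneg fun i _ => by
    split_ifs <;> simp [h i]

lemma stepV_le_one {m : ℕ} {a b : Fin m → ℝ} {σ : Fin m × Bool → ℝ} (h : ∀ i, 0 ≤ σ i)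
    (h1 : ∀ i, σ i ≤ 1) (x : ℝ) : stepV a b σ x ≤ 1 :=
  Finset.prod_le_one (fun i _ => by split_ifs <;> simp [h i])
    fun i _ => by split_ifs <;> simp [h1 i]

lemma stepV_eq_one {m : ℕ} {a b : Fin m → ℝ} {σ : Fin m × Bool → ℝ} {δ : ℝ} (ha : ∀ i, δ ≤ a i)
    (hab : ∀ i, a i ≤ b i) {x : ℝ} (hx : x < δ) : stepV a b σ x = 1 := by
  refine Finset.prod_eq_one fun i _ => if_neg ?_
  split_ifs
  · exact not_lt.2 (hx.le.trans ((ha _).trans (hab _)))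
  · exact not_le.2 (hx.trans_le (ha _))

lemma sum_event_eq {m : ℕ} {a b : Fin m → ℝ} {K : ℕ} {coef : (Fin m × Bool → Fin (K + 1)) → ℝ}
    {N : ℕ} {t : ℝ}
    (h : ∀ π : Equiv.Perm (Fin N),
        (if ∀ i : Fin m, (ellD π (i : ℕ) : ℝ) / t ∈ Set.Icc (a i) (b i) then (1 : ℝ) else 0) =
          ∑ σ, coef σ * ((cycleLens π).map fun j : ℕ => stepV a b (node σ) (j / t)).prod)
    (c : ℕ → ℝ) :
    (∑ π : Equiv.Perm (Fin N),
      if ∀ i : Fin m, (ellD π (i : ℕ) : ℝ) / t ∈ Set.Icc (a i) (b i) then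
        ((cycleLens π).map c).prod else 0) =
      N.factorial * ∑ σ, coef σ * cycGen (fun j : ℕ => c j * stepV a b (node σ) (j / t)) N := by
  have h1 : ∀ π : Equiv.Perm (Fin N),
      (if ∀ i : Fin m, (ellD π (i : ℕ) : ℝ) / t ∈ Set.Icc (a i) (b i) then
        ((cycleLens π).map c).prod else 0) =
      ∑ σ, coef σ * ((cycleLens π).map fun j : ℕ => c j * stepV a b (node σ) (j / t)).prod := by
    intro π
    rw [← mul_boole, h π, Finset.mul_sum]
    refine Finset.sum_congr rfl fun σ _ => ?_
    rw [Multiset.prod_map_mul]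
    ring
  simp only [h1]
  rw [Finset.sum_comm, Finset.mul_sum]
  refine Finset.sum_congr rfl fun σ _ => ?_
  rw [← Finset.mul_sum, sum_perm_cycleLens]
  ring

lemma sum_event_le {m : ℕ} {a b : Fin m → ℝ} (i₀ : Fin m) (hi₀ : (i₀ : ℕ) = 0) (ha : 0 < a i₀)
    {N : ℕ} {t : ℝ} {c : ℕ → ℝ} (hc : ∀ j, 0 ≤ c j) :
    (∑ π : Equiv.Perm (Fin N),
      if ∀ i : Fin m, (ellD π (i : ℕ) : ℝ) / t ∈ Set.Icc (a i) (b i) then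
        ((cycleLens π).map c).prod else 0) ≤
      N.factorial * (cycGen c N -
        cycGen (fun j : ℕ => c j * if (j : ℝ) / t ∈ Set.Icc (a i₀) (b i₀) then 0 else 1) N) := by
  rw [mul_sub, ← sum_perm_cycleLens, ← sum_perm_cycleLens, ← Finset.sum_sub_distrib]
  refine Finset.sum_le_sum fun π _ => ?_
  have hp : 0 ≤ ((cycleLens π).map c).prod := Multiset.prod_nonneg fun x hx => by
    obtain ⟨j, _, rfl⟩ := Multiset.mem_map.1 hx
    exact hc j
  rw [Multiset.prod_map_mul]
  split_ifs with h
  · have h1 := h i₀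
    rw [hi₀] at h1
    have hmem : ellD π 0 ∈ cycleLens π := by
      have h2 : 0 < ((cycleLens π).countP fun j => 0 < j) := by
        rw [← ellD_iff_countP (P := fun j => 0 < j) (fun x y hxy hx => hx.trans_le hxy)
          (lt_irrefl _)]
        by_contra h3
        have h4 : ellD π 0 = 0 := by omega
        rw [h4] at h1
        simp only [Nat.cast_zero, _root_.zero_div] at h1
        exact absurd ha (not_lt.2 h1.1)
      have h3 : 0 < ((cycleLens π).sort (· ≤ ·)).reverse.length := by
        rw [List.length_reverse, Multiset.length_sort]
        exact h2.trans_le (Multiset.countP_le_card _ _)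
      have h4 : ellD π 0 = ((cycleLens π).sort (· ≤ ·)).reverse[0] := by
        rw [ellD, List.getD_eq_getElem _ _ h3]
      have h5 := List.getElem_mem h3
      rw [← h4, List.mem_reverse, Multiset.mem_sort] at h5
      exact h5
    have hz : ((cycleLens π).map fun j : ℕ =>
        if (j : ℝ) / t ∈ Set.Icc (a i₀) (b i₀) then (0 : ℝ) else 1).prod = 0 :=
      Multiset.prod_eq_zero (Multiset.mem_map.2 ⟨_, hmem, if_pos h1⟩)
    rw [hz]
    simp
  · rw [sub_nonneg]
    refine mul_le_of_le_one_right hp ?_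
    have h1 := Multiset.prod_map_le_prod_map₀ (s := cycleLens π) (fun j : ℕ =>
      if (j : ℝ) / t ∈ Set.Icc (a i₀) (b i₀) then (0 : ℝ) else 1) (fun _ => 1)
      (fun j _ => by split_ifs <;> simp) (fun j _ => by split_ifs <;> simp)
    simpa using h1

/-! ### Asymptotics of the nonspatial partition function -/

lemma cycGen_const_succ (θ : ℝ) (n : ℕ) :
    ((n : ℝ) + 1) * cycGen (fun _ => θ) (n + 1) = (n + θ) * cycGen (fun _ => θ) n := by
  rcases n with _ | n
  · have := succ_mul_cycGen_succ (fun _ => θ) 0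
    simpa using this
  · have h1 := succ_mul_cycGen_succ (fun _ => θ) (n + 1)
    have h2 := succ_mul_cycGen_succ (fun _ => θ) n
    rw [Finset.Nat.sum_antidiagonal_succ] at h1
    push_cast at h1 ⊢
    rw [h1, ← h2]
    ring

lemma cycGen_const_pos {θ : ℝ} (hθ : 0 < θ) (n : ℕ) : 0 < cycGen (fun _ => θ) n := by
  induction n with
  | zero => simp
  | succ n ih =>
    have h := cycGen_const_succ θ n
    have : 0 < ((n : ℝ) + 1) * cycGen (fun _ => θ) (n + 1) := by rw [h]; positivity
    exact pos_of_mul_pos_right this (by positivity)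

lemma cycGen_const_eq (θ : ℝ) (n : ℕ) :
    cycGen (fun _ => θ) n * n.factorial = ∏ j ∈ Finset.range n, (θ + j) := by
  induction n with
  | zero => simp
  | succ n ih =>
    rw [Finset.prod_range_succ, ← ih, Nat.factorial_succ]
    push_cast
    have h := cycGen_const_succ θ n
    linear_combination (n.factorial : ℝ) * h

lemma tendsto_cycGen_const {θ : ℝ} (hθ : 0 < θ) :
    Tendsto (fun n : ℕ => cycGen (fun _ => θ) n / (n : ℝ) ^ (θ - 1)) atTop
      (𝓝 (Real.Gamma θ)⁻¹) := by
  have h1 : Tendsto (fun n : ℕ => ((n : ℝ) / (n + θ)) * (Real.GammaSeq θ n)⁻¹) atTop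
      (𝓝 (1 * (Real.Gamma θ)⁻¹)) := by
    refine (tendsto_natCast_div_add_atTop θ).mul
      ((Real.GammaSeq_tendsto_Gamma θ).inv₀ (Real.Gamma_pos_of_pos hθ).ne')
  rw [one_mul] at h1
  refine h1.congr' ?_
  filter_upwards [eventually_gt_atTop 0] with n hn
  have hn' : (0 : ℝ) < n := by exact_mod_cast hn
  have hp := cycGen_const_pos hθ n
  have hf : (0 : ℝ) < n.factorial := by positivity
  rw [Real.GammaSeq, Finset.prod_range_succ, ← cycGen_const_eq, Real.rpow_sub_one hn'.ne']
  have : (0 : ℝ) < (n : ℝ) ^ θ := by positivity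
  have : (0 : ℝ) < n + θ := by positivity
  field_simp
  ring

lemma cycGen_const_le {θ : ℝ} (hθ : 0 < θ) {m n : ℕ} (hmn : m ≤ n) :
    cycGen (fun _ => θ) m ≤
      (if 1 ≤ θ then 1 else ((n - m : ℕ) + 1 : ℝ) / θ) * cycGen (fun _ => θ) n := by
  split_ifs with h1
  · rw [one_mul]
    refine monotone_nat_of_le_succ (fun k => ?_) hmn
    have h := cycGen_const_succ θ k
    have hp := cycGen_const_pos hθ k
    have : ((k : ℝ) + 1) * cycGen (fun _ => θ) k ≤ ((k : ℝ) + 1) * cycGen (fun _ => θ) (k + 1) := by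
      rw [h]; gcongr
    exact le_of_mul_le_mul_left this (by positivity)
  · push Not at h1
    have hmono : Monotone fun k : ℕ => (k : ℝ) * cycGen (fun _ => θ) k := by
      refine monotone_nat_of_le_succ fun k => ?_
      push_cast
      rw [cycGen_const_succ]
      have hp := cycGen_const_pos hθ k
      gcongr
      linarith
    have hpn := cycGen_const_pos hθ n
    have hpm := cycGen_const_pos hθ m
    rw [div_mul_eq_mul_div, le_div_iff₀ hθ]
    rcases m with _ | m
    · rcases n with _ | n
      · simpa using h1.le
      · have h2 := hmono (Nat.le_add_left 1 n)
        have h3 := cycGen_const_succ θ 0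
        simp only [Nat.cast_zero, zero_add, one_mul, cycGen_zero, mul_one] at h3
        simp only [Nat.cast_one, one_mul, h3] at h2
        simp only [cycGen_zero, one_mul, Nat.sub_zero]
        nlinarith
    · have h2 : ((m + 1 : ℕ) : ℝ) * cycGen (fun _ => θ) (m + 1) ≤ n * cycGen (fun _ => θ) n :=
        hmono hmn
      have h4 : (n : ℝ) ≤ ((n - (m + 1) : ℕ) + 1) * ((m + 1 : ℕ) : ℝ) := by
        have : n ≤ (n - (m + 1) + 1) * (m + 1) := by
          obtain ⟨k, rfl⟩ := Nat.exists_eq_add_of_le hmn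
          rw [Nat.add_sub_cancel_left]
          nlinarith
        exact_mod_cast this
      have h5 : ((m + 1 : ℕ) : ℝ) * cycGen (fun _ => θ) (m + 1) ≤
          ((m + 1 : ℕ) : ℝ) * (((n - (m + 1) : ℕ) + 1) * cycGen (fun _ => θ) n) := by
        refine h2.trans ?_
        rw [← mul_assoc, mul_comm ((m + 1 : ℕ) : ℝ)]
        gcongr
      have h6 := le_of_mul_le_mul_left h5 (by positivity)
      refine le_trans ?_ h6
      exact mul_le_of_le_one_right hpm.le h1.le

lemma summable_mul_cycGen {e : ℕ → ℝ} (hs : Summable fun j => |e j|) :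
    Summable fun k : ℕ => (k : ℝ) * |cycGen e k| := by
  have hs' : Summable fun j : ℕ => |e j| / j := by
    refine Summable.of_nonneg_of_le (fun j => by positivity) (fun j => ?_) hs
    rcases j with _ | j
    · simp
    · refine div_le_self (abs_nonneg _) ?_
      push_cast
      linarith [Nat.cast_nonneg (α := ℝ) j]
  have hg := (hasSum_cycGen hs').2
  have hs1 : Summable fun j => |e (j + 1)| := (summable_nat_add_iff 1).2 hs
  have hc := (summable_norm_sum_mul_antidiagonal_of_summable_norm (f := fun j => |e (j + 1)|)
    (g := fun k => |cycGen e k|) (by simpa using hs1) (by simpa using hg)).of_norm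
  rw [← summable_nat_add_iff 1]
  refine Summable.of_nonneg_of_le (fun k => by positivity) (fun k => ?_) hc
  push_cast
  rw [← abs_of_pos (show (0 : ℝ) < (k : ℝ) + 1 by positivity), ← abs_mul, succ_mul_cycGen_succ]
  refine (Finset.abs_sum_le_sum_abs _ _).trans (le_of_eq ?_)
  simp [abs_mul]

lemma tendsto_cycGen_const_shift {θ : ℝ} (hθ : 0 < θ) (k : ℕ) :
    Tendsto (fun n : ℕ => cycGen (fun _ => θ) (n - k) / cycGen (fun _ => θ) n) atTop (𝓝 1) := by
  have hstep : Tendsto (fun n : ℕ => cycGen (fun _ => θ) n / cycGen (fun _ => θ) (n + 1)) atTop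
      (𝓝 1) := by
    have h1 : Tendsto (fun n : ℕ => ((n : ℝ) + 1) / (n + θ)) atTop (𝓝 1) := by
      have h2 := (tendsto_natCast_div_add_atTop θ).add
        ((tendsto_const_nhds (x := (1 : ℝ))).div_atTop
          (tendsto_atTop_add_const_right _ θ tendsto_natCast_atTop_atTop))
      simp only [add_zero] at h2
      refine h2.congr fun n => ?_
      rw [add_div]
    refine h1.congr fun n => ?_
    have hp := cycGen_const_pos hθ (n + 1)
    have : (0 : ℝ) < n + θ := by positivity
    rw [div_eq_div_iff this.ne' hp.ne', cycGen_const_succ]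
    ring
  induction k with
  | zero =>
    refine tendsto_const_nhds.congr fun n => ?_
    rw [Nat.sub_zero, div_self (cycGen_const_pos hθ n).ne']
  | succ k ih =>
    rw [← tendsto_add_atTop_iff_nat (k + 1)]
    have h1 := (tendsto_add_atTop_iff_nat (k + 1)).2 ih
    have h2 := hstep.mul h1
    rw [mul_one] at h2
    refine h2.congr fun n => ?_
    have e1 : n + (k + 1) - k = n + 1 := by omega
    have e2 : n + (k + 1) - (k + 1) = n := by omega
    rw [e1, e2, div_mul_div_cancel₀ (cycGen_const_pos hθ (n + 1)).ne']

/-- If the weights `b_j` tend to `θ > 0` fast enough then `h_n ∼ C n^{θ-1}`. -/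
lemma exists_tendsto_cycGen {b : ℕ → ℝ} {θ : ℝ} (hθ : 0 < θ)
    (hs : Summable fun j : ℕ => |b j - θ| / j) (hs1 : θ < 1 → Summable fun j : ℕ => |b j - θ|) :
    ∃ C : ℝ, 0 < C ∧ Tendsto (fun n : ℕ => cycGen b n / (n : ℝ) ^ (θ - 1)) atTop (𝓝 C) := by
  set e : ℕ → ℝ := fun j => b j - θ with he
  obtain ⟨hg, hga⟩ := hasSum_cycGen (c := e) hs
  set p := cycGen fun _ => θ with hp
  have hb : b = e + fun _ => θ := by ext; simp [he]
  have hpos : ∀ n, 0 < p n := cycGen_const_pos hθ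
  have hrepr : ∀ n, cycGen b n / p n =
      ∑' k, if k ≤ n then cycGen e k * (p (n - k) / p n) else 0 := by
    intro n
    rw [tsum_eq_sum (s := Finset.range (n + 1)) fun k hk => if_neg (by simpa using hk), hb,
      cycGen_add, Finset.Nat.sum_antidiagonal_eq_sum_range_succ_mk, Finset.sum_div]
    refine Finset.sum_congr rfl fun k hk => ?_
    rw [if_pos (by simpa [Nat.lt_succ_iff] using hk), mul_div_assoc]
  set bound : ℕ → ℝ := fun k => |cycGen e k| * (if 1 ≤ θ then 1 else ((k : ℝ) + 1) / θ)
  have hbound : Summable bound := by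
    by_cases h : 1 ≤ θ
    · simpa [bound, h] using hga
    · have h3 := summable_mul_cycGen (hs1 (not_le.1 h))
      have h4 := (h3.add hga).div_const θ
      refine h4.congr fun k => ?_
      simp only [bound, if_neg h]
      ring
  have hlim : Tendsto (fun n => cycGen b n / p n) atTop (𝓝 (∑' k, cycGen e k)) := by
    simp only [hrepr]
    refine tendsto_tsum_of_dominated_convergence hbound (fun k => ?_) (Eventually.of_forall ?_)
    · have := (tendsto_cycGen_const_shift hθ k).const_mul (cycGen e k)
      rw [mul_one] at this
      refine this.congr' ?_
      filter_upwards [eventually_ge_atTop k] with n hn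
      rw [if_pos hn]
    · intro n k
      split_ifs with h
      · have h5 := cycGen_const_le hθ (Nat.sub_le n k)
        rw [norm_mul, Real.norm_eq_abs, Real.norm_eq_abs,
          abs_of_pos (div_pos (hpos _) (hpos n))]
        simp only [bound]
        refine mul_le_mul_of_nonneg_left ?_ (abs_nonneg _)
        rw [div_le_iff₀ (hpos n)]
        rwa [Nat.sub_sub_self h] at h5
      · rw [norm_zero]
        simp only [bound]
        split_ifs <;> positivity
  rw [hg.tsum_eq] at hlim
  refine ⟨Real.exp (∑' j, e j / (j : ℝ)) * (Real.Gamma θ)⁻¹,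
    mul_pos (Real.exp_pos _) (inv_pos.2 (Real.Gamma_pos_of_pos hθ)), ?_⟩
  refine (hlim.mul (tendsto_cycGen_const hθ)).congr fun n => ?_
  rw [div_mul_div_cancel₀ (hpos n).ne']

/-! ### Scaling limits of convolutions -/

/-- Pairs `(t, r)` with `t → ∞` and `r / t → x`. -/
def nearF (x : ℝ) : Filter (ℝ × ℕ) :=
  comap Prod.fst atTop ⊓ comap (fun p : ℝ × ℕ => (p.2 : ℝ) / p.1) (𝓝 x)

instance (x : ℝ) : (nearF x).IsCountablyGenerated := by
  unfold nearF; infer_instance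

lemma tendsto_nearF {ι : Type*} {l : Filter ι} {u : ι → ℝ × ℕ} {x : ℝ} :
    Tendsto u l (nearF x) ↔
      Tendsto (fun i => (u i).1) l atTop ∧ Tendsto (fun i => ((u i).2 : ℝ) / (u i).1) l (𝓝 x) := by
  rw [nearF, tendsto_inf, tendsto_comap_iff, tendsto_comap_iff]
  rfl

lemma tendsto_fst_nearF (x : ℝ) : Tendsto (fun p : ℝ × ℕ => p.1) (nearF x) atTop :=
  (tendsto_nearF.1 tendsto_id).1

lemma tendsto_div_nearF (x : ℝ) :
    Tendsto (fun p : ℝ × ℕ => (p.2 : ℝ) / p.1) (nearF x) (𝓝 x) :=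
  (tendsto_nearF.1 tendsto_id).2

lemma tendsto_snd_nearF {x : ℝ} (hx : 0 < x) :
    Tendsto (fun p : ℝ × ℕ => p.2) (nearF x) atTop := by
  have h := (tendsto_div_nearF x).pos_mul_atTop hx (tendsto_fst_nearF x)
  refine tendsto_natCast_atTop_iff.1 (h.congr' ?_)
  filter_upwards [(tendsto_fst_nearF x).eventually_gt_atTop 0] with p hp
  exact div_mul_cancel₀ _ hp.ne'

lemma sum_range_eq_integral {F : ℕ → ℝ} {n : ℕ} (hF : ∀ i, n ≤ i → F i = 0) {t R : ℝ} (ht : 0 < t)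
    (hn : (n : ℝ) ≤ R * t) :
    ∑ i ∈ Finset.range n, F i = ∫ z in Set.Ioc 0 R, t * F ⌊t * z⌋₊ := by
  have hcell : ∀ k : ℕ, ∀ z ∈ Set.Ioo ((k : ℝ) / t) ((k + 1 : ℕ) / t), ⌊t * z⌋₊ = k := by
    intro k z hz
    have h1 : (k : ℝ) < t * z := by
      have := hz.1; rwa [div_lt_iff₀ ht, mul_comm] at this
    have h2 : t * z < (k : ℝ) + 1 := by
      have := hz.2; rw [lt_div_iff₀ ht, mul_comm] at this; push_cast at this; exact this
    rw [Nat.floor_eq_iff ((Nat.cast_nonneg k).trans h1.le)]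
    exact ⟨h1.le, h2⟩
  have hle : ∀ k : ℕ, (k : ℝ) / t ≤ (k + 1 : ℕ) / t := fun k => by
    gcongr
    exact k.le_succ
  have hEq : ∀ k : ℕ, Set.EqOn (fun z => t * F ⌊t * z⌋₊) (fun _ => t * F k)
      (Set.Ioo ((k : ℝ) / t) ((k + 1 : ℕ) / t)) := fun k z hz => by
    simp only [hcell k z hz]
  have hI : ∀ k : ℕ, IntervalIntegrable (fun z => t * F ⌊t * z⌋₊) volume
      ((k : ℝ) / t) ((k + 1 : ℕ) / t) := by
    intro k
    rw [intervalIntegrable_iff_integrableOn_Ioo_of_le (hle k)]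
    exact IntegrableOn.congr_fun (integrableOn_const (by simp)) (hEq k).symm measurableSet_Ioo
  have hintg : ∀ k : ℕ, ∫ z in ((k : ℝ) / t)..((k + 1 : ℕ) / t), t * F ⌊t * z⌋₊ = F k := by
    intro k
    rw [intervalIntegral.integral_of_le (hle k), integral_Ioc_eq_integral_Ioo,
      setIntegral_congr_fun measurableSet_Ioo (hEq k), setIntegral_const, smul_eq_mul,
      Real.volume_real_Ioo_of_le (hle k)]
    push_cast
    field_simp
    ring
  have hsum := intervalIntegral.sum_integral_adjacent_intervals
    (f := fun z => t * F ⌊t * z⌋₊) (μ := volume) (a := fun k : ℕ => (k : ℝ) / t) (n := n)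
    fun k _ => hI k
  simp only [hintg] at hsum
  have hnt : (n : ℝ) / t ≤ R := by rwa [div_le_iff₀ ht]
  rw [hsum, Nat.cast_zero, _root_.zero_div, intervalIntegral.integral_of_le (by positivity)]
  symm
  refine setIntegral_eq_of_subset_of_forall_sdiff_eq_zero measurableSet_Ioc
    (Set.Ioc_subset_Ioc_right hnt) fun z hz => ?_
  have hz0 : 0 < z := hz.1.1
  have hz1 : (n : ℝ) / t < z := by
    by_contra h
    exact hz.2 ⟨hz0, not_lt.1 h⟩
  rw [div_lt_iff₀ ht, mul_comm] at hz1
  rw [hF _ (Nat.le_floor hz1.le), mul_zero]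

/-- The arrays `A t r` have scaling limit `a` at order `t^β`, with an integrable bound. -/
structure ScalingLimit (R β : ℝ) (A : ℝ → ℕ → ℝ) (a D : ℝ → ℝ) : Prop where
  tendsto : ∀ x ∈ Set.Ioc 0 R,
    Tendsto (fun p : ℝ × ℕ => A p.1 p.2 / p.1 ^ β) (nearF x) (𝓝 (a x))
  bound : ∀ t : ℝ, 1 ≤ t → ∀ z ∈ Set.Ioc 0 R, |A t ⌊t * z⌋₊| / t ^ β ≤ D z
  integrable : IntegrableOn D (Set.Ioc 0 R)

lemma tendsto_floor_nearF {ι : Type*} {l : Filter ι} {u : ι → ℝ} (hu : Tendsto u l atTop) {z : ℝ}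
    (hz : 0 ≤ z) : Tendsto (fun i => (u i, ⌊u i * z⌋₊)) l (nearF z) := by
  refine tendsto_nearF.2 ⟨hu, ?_⟩
  have h := (tendsto_nat_floor_mul_div_atTop (R := ℝ) hz).comp hu
  refine h.congr fun i => ?_
  simp only [Function.comp, mul_comm]

lemma ScalingLimit.conv {R β : ℝ} {A Q : ℝ → ℕ → ℝ} {a D q : ℝ → ℝ} {S : Set ℝ} {M : ℝ}
    (hA : ScalingLimit R β A a D) (hS : S.Finite) (hM : 0 ≤ M)
    (hQ : ∀ y, 0 < y → y ∉ S → Tendsto (fun p : ℝ × ℕ => p.1 * Q p.1 p.2) (nearF y) (𝓝 (q y)))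
    (hQM : ∀ t : ℝ, 1 ≤ t → ∀ j, |t * Q t j| ≤ M) :
    ∃ a', ScalingLimit (R - 1) β
      (fun t r => ∑ p ∈ Finset.HasAntidiagonal.antidiagonal r, Q t p.1 * A t p.2) a'
      (fun _ => ∫ z in Set.Ioc 0 R, M * D z) := by
  set G : ℝ × ℕ → ℝ → ℝ := fun p z => p.1 *
    (if ⌊p.1 * z⌋₊ ≤ p.2 then Q p.1 (p.2 - ⌊p.1 * z⌋₊) * A p.1 ⌊p.1 * z⌋₊ / p.1 ^ β else 0) with hG
  have hrepr : ∀ t : ℝ, 1 ≤ t → ∀ r : ℕ, (r : ℝ) + 1 ≤ R * t →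
      (∑ p ∈ Finset.HasAntidiagonal.antidiagonal r, Q t p.1 * A t p.2) / t ^ β =
        ∫ z in Set.Ioc 0 R, G (t, r) z := by
    intro t ht r hr
    have h := sum_range_eq_integral (n := r + 1) (t := t) (R := R)
      (F := fun i => if i ≤ r then Q t (r - i) * A t i / t ^ β else 0)
      (fun i hi => if_neg (by omega)) (by linarith) (by push_cast; exact hr)
    rw [hG]
    rw [← h, ← Finset.Nat.sum_antidiagonal_swap, Finset.Nat.sum_antidiagonal_eq_sum_range_succ_mk,
      Finset.sum_div]
    refine Finset.sum_congr rfl fun i hi => ?_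
    rw [if_pos (by simpa [Nat.lt_succ_iff] using hi)]
    rfl
  have hmeas : ∀ p, Measurable (G p) := by
    intro p
    have hm : Measurable fun z : ℝ => ⌊p.1 * z⌋₊ :=
      Nat.measurable_floor.comp (measurable_const.mul measurable_id)
    exact measurable_const.mul ((measurable_from_nat (f := fun i : ℕ =>
      if i ≤ p.2 then Q p.1 (p.2 - i) * A p.1 i / p.1 ^ β else 0)).comp hm)
  have hbd : ∀ p : ℝ × ℕ, 1 ≤ p.1 → ∀ z ∈ Set.Ioc 0 R, ‖G p z‖ ≤ M * D z := by
    rintro ⟨t, r⟩ ht z hz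
    have hD := hA.bound t ht z hz
    have htβ : 0 < t ^ β := Real.rpow_pos_of_pos (by simp at ht; linarith) _
    have hD0 : 0 ≤ D z := le_trans (by positivity) hD
    simp only [hG]
    split_ifs with h
    · rw [mul_div_assoc, ← mul_assoc, norm_mul, Real.norm_eq_abs, Real.norm_eq_abs, abs_div,
        abs_of_pos htβ]
      exact mul_le_mul (hQM t ht _) hD (by positivity) hM
    · rw [mul_zero, norm_zero]
      positivity
  have hDi : IntegrableOn (fun z => M * D z) (Set.Ioc 0 R) := hA.integrable.const_mul M
  refine ⟨fun x => ∫ z in Set.Ioc 0 R, if z < x then q (x - z) * a z else 0, ?_, ?_, ?_⟩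
  · intro x hx
    have hlim : Tendsto (fun p => ∫ z in Set.Ioc 0 R, G p z) (nearF x)
        (𝓝 (∫ z in Set.Ioc 0 R, if z < x then q (x - z) * a z else 0)) := by
      refine tendsto_integral_filter_of_dominated_convergence (fun z => M * D z)
        (Eventually.of_forall fun p => (hmeas p).aestronglyMeasurable) ?_ hDi ?_
      · filter_upwards [(tendsto_fst_nearF x).eventually_ge_atTop 1] with p hp
        filter_upwards [ae_restrict_mem measurableSet_Ioc] with z hz using hbd p hp z hz
      · have hnull : ∀ᵐ z : ℝ, z ∉ (insert x ((fun y => x - y) '' S)) := by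
          have hfin : (insert x ((fun y => x - y) '' S)).Finite := (hS.image _).insert _
          exact compl_mem_ae_iff.2 (hfin.measure_zero volume)
        filter_upwards [ae_restrict_mem measurableSet_Ioc, ae_restrict_of_ae hnull] with z hz hzn
        have hzx : z ≠ x := fun h => hzn (Set.mem_insert_iff.2 (Or.inl h))
        have hzS : x - z ∉ S := fun h =>
          hzn (Set.mem_insert_iff.2 (Or.inr ⟨x - z, h, sub_sub_cancel x z⟩))
        have hfl : Tendsto (fun p : ℝ × ℕ => (p.1, ⌊p.1 * z⌋₊)) (nearF x) (nearF z) :=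
          tendsto_floor_nearF (tendsto_fst_nearF x) hz.1.le
        have hfd := (tendsto_nearF.1 hfl).2
        simp only at hfd
        rcases lt_or_gt_of_ne hzx with hlt | hgt
        · rw [if_pos hlt]
          have hle : ∀ᶠ p : ℝ × ℕ in nearF x, ⌊p.1 * z⌋₊ ≤ p.2 := by
            filter_upwards [(hfd.eventually_lt (tendsto_div_nearF x) hlt),
              (tendsto_fst_nearF x).eventually_gt_atTop 0] with p hp hp0
            rw [div_lt_div_iff_of_pos_right hp0] at hp
            exact_mod_cast hp.le
          have hsub : Tendsto (fun p : ℝ × ℕ => (p.1, p.2 - ⌊p.1 * z⌋₊)) (nearF x)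
              (nearF (x - z)) := by
            refine tendsto_nearF.2 ⟨tendsto_fst_nearF x, ?_⟩
            refine ((tendsto_div_nearF x).sub hfd).congr' ?_
            filter_upwards [hle] with p hp
            rw [Nat.cast_sub hp, sub_div]
          have h1 := (hQ (x - z) (by linarith) hzS).comp hsub
          have h2 := (hA.tendsto z hz).comp hfl
          refine (h1.mul h2).congr' ?_
          filter_upwards [hle] with p hp
          simp only [hG, Function.comp, if_pos hp]
          ring
        · rw [if_neg (not_lt.2 hgt.le)]
          refine tendsto_const_nhds.congr' ?_
          filter_upwards [((tendsto_div_nearF x).eventually_lt hfd hgt),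
              (tendsto_fst_nearF x).eventually_gt_atTop 0] with p hp hp0
          rw [div_lt_div_iff_of_pos_right hp0] at hp
          have : ¬⌊p.1 * z⌋₊ ≤ p.2 := not_le.2 (by exact_mod_cast hp)
          simp only [hG, if_neg this, mul_zero]
    refine hlim.congr' ?_
    have hev : ∀ᶠ p : ℝ × ℕ in nearF x, (p.2 : ℝ) / p.1 + p.1⁻¹ < R := by
      refine ((tendsto_div_nearF x).add
        (tendsto_inv_atTop_zero.comp (tendsto_fst_nearF x))).eventually_lt_const ?_
      have := hx.2
      linarith
    filter_upwards [hev, (tendsto_fst_nearF x).eventually_ge_atTop 1] with p hp hp1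
    have hp0 : 0 < p.1 := by linarith
    rw [hrepr p.1 hp1 p.2]
    rw [← one_div, ← add_div, div_lt_iff₀ hp0] at hp
    exact hp.le
  · intro t ht z hz
    have ht0 : 0 < t := by linarith
    have hr : ((⌊t * z⌋₊ : ℕ) : ℝ) + 1 ≤ R * t := by
      have h1 := Nat.floor_le (mul_nonneg ht0.le hz.1.le)
      have h2 := mul_le_mul_of_nonneg_left hz.2 ht0.le
      nlinarith
    have htβ : 0 < t ^ β := Real.rpow_pos_of_pos ht0 _
    have habs : ∀ X : ℝ, |X| / t ^ β = |X / t ^ β| := fun X => by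
      rw [abs_div, abs_of_pos htβ]
    rw [habs, hrepr t ht _ hr, ← Real.norm_eq_abs]
    refine norm_integral_le_of_norm_le hDi ?_
    filter_upwards [ae_restrict_mem measurableSet_Ioc] with z' hz' using hbd (t, _) ht z' hz'
  · exact integrableOn_const (by simp)

lemma exists_le_mul_rpow {h : ℕ → ℝ} {β C : ℝ}
    (hh : Tendsto (fun n : ℕ => h n / (n : ℝ) ^ β) atTop (𝓝 C)) :
    ∃ C' : ℝ, 0 ≤ C' ∧ ∀ n : ℕ, |h n| ≤ C' * ((n : ℝ) + 1) ^ β := by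
  have h1 : Tendsto (fun n : ℕ => ((n : ℝ) / (n + 1)) ^ β) atTop (𝓝 1) := by
    have := (tendsto_natCast_div_add_atTop (1 : ℝ)).rpow_const (p := β) (Or.inl one_ne_zero)
    simpa using this
  have h2 : Tendsto (fun n : ℕ => |h n / ((n : ℝ) + 1) ^ β|) atTop (𝓝 |C * 1|) := by
    refine ((hh.mul h1).congr' ?_).abs
    filter_upwards [eventually_gt_atTop 0] with n hn
    have hn' : (0 : ℝ) < n := by exact_mod_cast hn
    rw [Real.div_rpow hn'.le (by positivity), div_mul_div_cancel₀ (by positivity)]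
  obtain ⟨C', hC'⟩ := h2.bddAbove_range
  refine ⟨max C' 0, le_max_right _ _, fun n => ?_⟩
  have h3 := hC' (Set.mem_range_self n)
  have hp : (0 : ℝ) < ((n : ℝ) + 1) ^ β := by positivity
  simp only [abs_div, abs_of_pos hp] at h3
  rw [div_le_iff₀ hp] at h3
  exact h3.trans (mul_le_mul_of_nonneg_right (le_max_left _ _) hp.le)

lemma tendsto_div_rpow_nearF {h : ℕ → ℝ} {β C : ℝ}
    (hh : Tendsto (fun n : ℕ => h n / (n : ℝ) ^ β) atTop (𝓝 C)) {x : ℝ} (hx : 0 < x) :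
    Tendsto (fun p : ℝ × ℕ => h p.2 / p.1 ^ β) (nearF x) (𝓝 (C * x ^ β)) := by
  have h1 := (hh.comp (tendsto_snd_nearF hx)).mul
    ((tendsto_div_nearF x).rpow_const (p := β) (Or.inl hx.ne'))
  refine h1.congr' ?_
  filter_upwards [(tendsto_snd_nearF hx).eventually_gt_atTop 0,
    (tendsto_fst_nearF x).eventually_gt_atTop 0] with p hp hp1
  have hp' : (0 : ℝ) < p.2 := by exact_mod_cast hp
  simp only [Function.comp]
  rw [Real.div_rpow hp'.le hp1.le, div_mul_div_cancel₀ (by positivity)]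

lemma scalingLimit_of_tendsto {h : ℕ → ℝ} {β C : ℝ} (hβ : -1 < β)
    (hh : Tendsto (fun n : ℕ => h n / (n : ℝ) ^ β) atTop (𝓝 C)) (R : ℝ) :
    ∃ D, ScalingLimit R β (fun _ => h) (fun x => C * x ^ β) D := by
  obtain ⟨C', hC', hle⟩ := exists_le_mul_rpow hh
  refine ⟨fun z => C' * ((z + 1) ^ β + z ^ β), fun x hx => tendsto_div_rpow_nearF hh hx.1, ?_, ?_⟩
  · intro t ht z hz
    have ht0 : 0 < t := by linarith
    have hz0 := hz.1
    have htβ : 0 < t ^ β := Real.rpow_pos_of_pos ht0 _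
    rw [div_le_iff₀ htβ]
    refine (hle _).trans ?_
    rw [mul_assoc]
    refine mul_le_mul_of_nonneg_left ?_ hC'
    have hf1 := Nat.floor_le (mul_nonneg ht0.le hz0.le)
    have hf2 := Nat.lt_floor_add_one (t * z)
    rw [add_mul, ← Real.mul_rpow (by positivity) ht0.le, ← Real.mul_rpow hz0.le ht0.le]
    rcases le_total 0 β with h0 | h0
    · refine le_add_of_le_of_nonneg (Real.rpow_le_rpow (by positivity) ?_ h0) (by positivity)
      nlinarith
    · refine le_add_of_nonneg_of_le (by positivity)
        (Real.rpow_le_rpow_of_nonpos (by positivity) ?_ h0)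
      linarith
  · refine Integrable.const_mul (Integrable.add ?_ ?_) C'
    · refine (ContinuousOn.integrableOn_Icc ?_).mono_set Set.Ioc_subset_Icc_self
      exact (continuous_id.add continuous_const).continuousOn.rpow_const fun z hz =>
        Or.inl (by have := hz.1; show z + 1 ≠ 0; linarith)
    · rcases le_total 0 R with hR | hR
      · exact (intervalIntegrable_iff_integrableOn_Ioc_of_le hR).1
          (intervalIntegral.intervalIntegrable_rpow' hβ)
      · rw [Set.Ioc_eq_empty (not_lt.2 hR)]
        exact integrableOn_empty

/-- The ratio of weighted partition functions has a limit. -/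
def HasRatioLimit (b : ℕ → ℝ) (v : ℝ → ℝ) (P : ℝ) : Prop :=
  Tendsto (fun p : ℝ × ℕ => cycGen (fun j : ℕ => b j * v (j / p.1)) p.2 / cycGen b p.2)
    (nearF 1) (𝓝 P)

lemma exists_hasRatioLimit {b : ℕ → ℝ} {θ : ℝ} (hθ : 0 < θ) (hb0 : ∀ j, 0 ≤ b j)
    (hb : Tendsto b atTop (𝓝 θ))
    (hs : Summable fun j : ℕ => |b j - θ| / j) (hs1 : θ < 1 → Summable fun j : ℕ => |b j - θ|)
    {v : ℝ → ℝ} {δ : ℝ} (hδ : 0 < δ) (hv0 : ∀ x, 0 ≤ v x) (hv1 : ∀ x, v x ≤ 1)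
    (hvδ : ∀ x < δ, v x = 1) {S : Set ℝ} (hS : S.Finite)
    (hvS : ∀ y, y ∉ S → ∀ᶠ x in 𝓝 y, v x = v y) :
    ∃ P, HasRatioLimit b v P := by
  obtain ⟨C, hC, hh⟩ := exists_tendsto_cycGen hθ hs hs1
  obtain ⟨B, hB⟩ := hb.bddAbove_range
  replace hB : ∀ j, b j ≤ B := fun j => hB (Set.mem_range_self j)
  have hB0 : 0 ≤ B := (hb0 0).trans (hB 0)
  set β := θ - 1 with hβ
  set c : ℝ → ℕ → ℝ := fun t j => b j * (v (j / t) - 1) with hc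
  set Q : ℝ → ℕ → ℝ := fun t j => PowerSeries.coeff j (logSer (c t)) with hQdef
  obtain ⟨K₀, hK₀⟩ := exists_nat_gt (2 / δ)
  have hQlim : ∀ y, 0 < y → y ∉ S → Tendsto (fun p : ℝ × ℕ => p.1 * Q p.1 p.2) (nearF y)
      (𝓝 (θ * (v y - 1) * y⁻¹)) := by
    intro y hy hyS
    have h1 := (((hb.comp (tendsto_snd_nearF hy)).mul_const (v y - 1)).mul
      ((tendsto_div_nearF y).inv₀ hy.ne'))
    refine h1.congr' ?_
    filter_upwards [(tendsto_div_nearF y).eventually (hvS y hyS)] with p hp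
    simp only [Function.comp, hQdef, coeff_logSer, hc, hp, inv_div]
    ring
  have hQM : ∀ t : ℝ, 1 ≤ t → ∀ j, |t * Q t j| ≤ B / δ := by
    intro t ht j
    have ht0 : 0 < t := by linarith
    simp only [hQdef, coeff_logSer, hc]
    by_cases hj : (j : ℝ) / t < δ
    · rw [hvδ _ hj]
      simp only [sub_self, mul_zero, _root_.zero_div, abs_zero]
      positivity
    · push Not at hj
      have hj0 : (0 : ℝ) < j := by
        have := hδ.trans_le hj
        by_contra h
        have : (j : ℝ) = 0 := le_antisymm (not_lt.1 h) (Nat.cast_nonneg j)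
        rw [this, _root_.zero_div] at hj
        linarith
      have e1 : t * (b j * (v (j / t) - 1) / j) = b j * (v (j / t) - 1) / (j / t) := by
        field_simp
      rw [e1, abs_div, abs_mul, abs_of_nonneg (hb0 j), abs_of_pos (div_pos hj0 ht0)]
      have h2 : |v (j / t) - 1| ≤ 1 := by
        rw [abs_le]
        constructor <;> linarith [hv0 (j / t), hv1 (j / t)]
      exact div_le_div₀ hB0 ((mul_le_mul (hB j) h2 (abs_nonneg _) hB0).trans (mul_one B).le) hδ hj
  have hind : ∀ K : ℕ, ∃ a D, ScalingLimit ((K₀ : ℝ) + 1 - K) β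
      (fun t r => PowerSeries.coeff r (logSer (c t) ^ K * cycSer b)) a D := by
    intro K
    induction K with
    | zero =>
      obtain ⟨D, hD⟩ := scalingLimit_of_tendsto (by rw [hβ]; linarith) hh ((K₀ : ℝ) + 1)
      refine ⟨fun x => C * x ^ β, D, ?_⟩
      simpa [coeff_cycSer] using hD
    | succ K ih =>
      obtain ⟨a, D, hD⟩ := ih
      obtain ⟨a', ha'⟩ := hD.conv hS (by positivity) hQlim hQM
      refine ⟨a', fun _ => ∫ z in Set.Ioc 0 ((K₀ : ℝ) + 1 - K), B / δ * D z, ?_⟩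
      have e : (K₀ : ℝ) + 1 - (K + 1 : ℕ) = (K₀ : ℝ) + 1 - K - 1 := by push_cast; ring
      rw [e]
      convert ha' using 3 with t r
      rw [pow_succ', mul_assoc, PowerSeries.coeff_mul]
  choose a D hAD using hind
  have hsum : Tendsto (fun p : ℝ × ℕ => (∑ k ∈ Finset.range K₀,
      PowerSeries.coeff p.2 (logSer (c p.1) ^ k * cycSer b) / p.1 ^ β / k.factorial) /
        (cycGen b p.2 / p.1 ^ β)) (nearF 1)
      (𝓝 ((∑ k ∈ Finset.range K₀, a k 1 / k.factorial) / (C * 1 ^ β))) := by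
    refine Tendsto.div (tendsto_finsetSum _ fun k hk => ?_)
      (tendsto_div_rpow_nearF hh one_pos) (by rw [Real.one_rpow]; positivity)
    refine ((hAD k).tendsto 1 ⟨one_pos, ?_⟩).div_const _
    have : (k : ℝ) + 1 ≤ K₀ := by exact_mod_cast (Finset.mem_range.1 hk)
    linarith
  refine ⟨_, hsum.congr' ?_⟩
  filter_upwards [(tendsto_div_nearF 1).eventually_lt_const _root_.one_lt_two,
    (tendsto_fst_nearF 1).eventually_ge_atTop 1] with p hp hp1
  have hp0 : 0 < p.1 := by linarith
  have hpβ : (p.1 ^ β) ≠ 0 := (Real.rpow_pos_of_pos hp0 _).ne'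
  have hr : p.2 < K₀ * ⌈δ * p.1⌉₊ := by
    have h1 : (p.2 : ℝ) < 2 * p.1 := by rwa [div_lt_iff₀ hp0] at hp
    have h2 : 2 * p.1 ≤ K₀ * (δ * p.1) := by
      rw [div_lt_iff₀ hδ] at hK₀
      nlinarith
    have h3 : (K₀ : ℝ) * (δ * p.1) ≤ K₀ * ⌈δ * p.1⌉₊ :=
      mul_le_mul_of_nonneg_left (Nat.le_ceil _) (Nat.cast_nonneg _)
    exact_mod_cast h1.trans_le (h2.trans h3)
  have hz : ∀ i ≤ p.2, ∀ k, K₀ ≤ k → PowerSeries.coeff i (logSer (c p.1) ^ k) = 0 := by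
    intro i hi k hk
    refine coeff_pow_eq_zero (D := ⌈δ * p.1⌉₊) (fun j hj => ?_)
      (hi.trans_lt (hr.trans_le (Nat.mul_le_mul_right _ hk)))
    have hj' : (j : ℝ) / p.1 < δ := by
      rw [div_lt_iff₀ hp0]; exact Nat.lt_ceil.1 hj
    rw [coeff_logSer, hc]
    simp only [hvδ _ hj', sub_self, mul_zero, _root_.zero_div]
  have hmain : cycGen (fun j : ℕ => b j * v (j / p.1)) p.2 = ∑ k ∈ Finset.range K₀,
      PowerSeries.coeff p.2 (logSer (c p.1) ^ k * cycSer b) / k.factorial := by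
    have e1 : (fun j : ℕ => b j * v (j / p.1)) = c p.1 + b := by
      ext j; simp only [hc, Pi.add_apply]; ring
    rw [e1, cycGen_add]
    simp only [PowerSeries.coeff_mul, coeff_cycSer, Finset.sum_div]
    rw [Finset.sum_comm]
    refine Finset.sum_congr rfl fun q hq => ?_
    have hq' : q.1 ≤ p.2 := by
      have := Finset.HasAntidiagonal.mem_antidiagonal.1 hq; omega
    rw [cycGen_eq_sum (c p.1) (K := K₀) (hz _ hq'), Finset.sum_mul]
    refine Finset.sum_congr rfl fun k _ => ?_
    ring
  rw [hmain]
  have e2 : ∀ X Y : ℝ, X / p.1 ^ β / Y = X / Y / p.1 ^ β := fun X Y => div_right_comm _ _ _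
  simp only [e2]
  rw [← Finset.sum_div, div_div_div_cancel_right₀ hpβ]

lemma stepV_eventually_eq {m : ℕ} (a b : Fin m → ℝ) (σ : Fin m × Bool → ℝ) {y : ℝ}
    (hy : y ∉ Set.range a ∪ Set.range b) : ∀ᶠ x in 𝓝 y, stepV a b σ x = stepV a b σ y := by
  have h1 : ∀ i : Fin m, ∀ᶠ x in 𝓝 y, (a i ≤ x ↔ a i ≤ y) ∧ (b i < x ↔ b i < y) := by
    intro i
    have ha : y ≠ a i := fun h => hy (Or.inl ⟨i, h.symm⟩)
    have hb : y ≠ b i := fun h => hy (Or.inr ⟨i, h.symm⟩)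
    refine Filter.Eventually.and ?_ ?_
    · rcases lt_or_gt_of_ne ha with h | h
      · filter_upwards [eventually_lt_nhds h] with x hx
        exact iff_of_false (not_le.2 hx) (not_le.2 h)
      · filter_upwards [eventually_gt_nhds h] with x hx
        exact iff_of_true hx.le h.le
    · rcases lt_or_gt_of_ne hb with h | h
      · filter_upwards [eventually_lt_nhds h] with x hx
        exact iff_of_false (not_lt.2 hx.le) (not_lt.2 h.le)
      · filter_upwards [eventually_gt_nhds h] with x hx
        exact iff_of_true hx h
  filter_upwards [eventually_all.2 h1] with x hx
  refine Finset.prod_congr rfl fun i _ => if_congr ?_ rfl rfl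
  split_ifs
  · exact (hx i.1).2
  · exact (hx i.1).1

/-- For subpolynomial weights there is no cycle with length in a macroscopic window
bounded away from the total length. -/
lemma hasRatioLimit_window {b : ℕ → ℝ} {γ : ℝ} (hγ : 0 < γ)
    (hb : ∀ j : ℕ, 1 ≤ j → b j = (j : ℝ) ^ (-γ)) {x₀ x₁ : ℝ} (hx₀ : 0 < x₀) (hx₁0 : 0 ≤ x₁)
    (hx₁ : x₁ < 1) :
    HasRatioLimit b (fun x => if x ∈ Set.Icc x₀ x₁ then 0 else 1) 1 := by
  have hb0 : ∀ j, 1 ≤ j → 0 ≤ b j := fun j hj => by rw [hb j hj]; positivity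
  have hs : Summable fun j : ℕ => |b j| / j := by
    have h1 : Summable fun j : ℕ => (j : ℝ) ^ (-(1 + γ)) :=
      Real.summable_nat_rpow.2 (by linarith)
    refine Summable.of_nonneg_of_le (fun j => by positivity) (fun j => ?_) h1
    rcases j with _ | j
    · simp only [Nat.cast_zero, _root_.div_zero]
      positivity
    · have hj : (0 : ℝ) < (j + 1 : ℕ) := by positivity
      rw [abs_of_nonneg (hb0 _ (by omega)), hb _ (by omega), ← Real.rpow_sub_one hj.ne']
      refine le_of_eq ?_
      congr 1
      ring
  have hh := (hasSum_cycGen hs).1.summable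
  have hh0 := cycGen_nonneg hb0
  set T : ℕ → ℝ := fun M => ∑' m, cycGen b (m + M) with hT
  have hT0 : Tendsto T atTop (𝓝 0) := tendsto_sum_nat_add _
  set M : ℝ × ℕ → ℕ := fun p => p.2 - ⌊p.1 * x₁⌋₊ with hMdef
  have hM : Tendsto M (nearF 1) atTop := by
    have h1 : Tendsto (fun p : ℝ × ℕ => ((p.2 : ℝ) / p.1 - x₁) * p.1) (nearF 1) atTop :=
      Tendsto.pos_mul_atTop (by linarith) ((tendsto_div_nearF 1).sub_const x₁)
        (tendsto_fst_nearF 1)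
    refine tendsto_natCast_atTop_iff.1 (tendsto_atTop_mono' _ ?_ h1)
    filter_upwards [(tendsto_fst_nearF 1).eventually_gt_atTop 0] with p hp
    rw [sub_mul, div_mul_cancel₀ _ hp.ne', mul_comm x₁]
    have h2 := Nat.floor_le (mul_nonneg hp.le hx₁0)
    have h3 : (p.2 : ℝ) ≤ (M p : ℝ) + ⌊p.1 * x₁⌋₊ := by
      have : p.2 ≤ M p + ⌊p.1 * x₁⌋₊ := by simp only [hMdef]; omega
      exact_mod_cast this
    linarith
  have hlim : Tendsto (fun p : ℝ × ℕ => 1 - (x₀⁻¹ * ((p.2 : ℝ) / p.1)) ^ (1 + γ) * T (M p))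
      (nearF 1) (𝓝 1) := by
    have h1 := (((tendsto_div_nearF 1).const_mul x₀⁻¹).rpow_const (p := 1 + γ)
      (Or.inr (by linarith))).mul (hT0.comp hM)
    have h2 := h1.const_sub 1
    rw [mul_zero, sub_zero] at h2
    exact h2
  refine tendsto_of_tendsto_of_tendsto_of_le_of_le' hlim tendsto_const_nhds ?_ ?_
  · filter_upwards [(tendsto_fst_nearF 1).eventually_gt_atTop 0,
      (tendsto_snd_nearF one_pos).eventually_gt_atTop 0] with p hp hp2
    obtain ⟨t, r⟩ := p
    simp only at hp hp2 ⊢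
    have hr : (0 : ℝ) < r := by exact_mod_cast hp2
    have hlow : (r : ℝ) ^ (-(1 + γ)) ≤ cycGen b r := by
      refine le_trans (le_of_eq ?_) (one_div_le_cycGen hb0 hp2)
      rw [hb r hp2, ← Real.rpow_sub_one hr.ne']
      congr 1
      ring
    have hpos : 0 < cycGen b r := lt_of_lt_of_le (by positivity) hlow
    have hsub := cycGen_sub_le (c := b)
      (e := fun j : ℕ => b j * if (j : ℝ) / t ∈ Set.Icc x₀ x₁ then 0 else 1)
      (fun j hj => mul_nonneg (hb0 j hj) (by split_ifs <;> simp))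
      (fun j hj => mul_le_of_le_one_right (hb0 j hj) (by split_ifs <;> simp)) r
    have hterm : ∀ q ∈ Finset.HasAntidiagonal.antidiagonal r,
        (b q.1 - b q.1 * if (q.1 : ℝ) / t ∈ Set.Icc x₀ x₁ then 0 else 1) / q.1 * cycGen b q.2 ≤
          (x₀ * t) ^ (-(1 + γ)) * if M (t, r) ≤ q.2 then cycGen b q.2 else 0 := by
      intro q hq
      have hq' := Finset.HasAntidiagonal.mem_antidiagonal.1 hq
      by_cases hw : (q.1 : ℝ) / t ∈ Set.Icc x₀ x₁
      · rw [if_pos hw]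
        have h1 : x₀ * t ≤ q.1 := by have := hw.1; rwa [le_div_iff₀ hp] at this
        have h2 : (q.1 : ℝ) ≤ t * x₁ := by
          have := hw.2; rwa [div_le_iff₀ hp, mul_comm] at this
        have hq1 : (0 : ℝ) < q.1 := lt_of_lt_of_le (by positivity) h1
        have hq1' : 1 ≤ q.1 := by exact_mod_cast hq1
        have h3 : M (t, r) ≤ q.2 := by
          have := Nat.le_floor h2
          simp only [hMdef]
          omega
        rw [if_pos h3, mul_zero, sub_zero]
        refine mul_le_mul_of_nonneg_right ?_ (hh0 _)
        rw [hb _ hq1', ← Real.rpow_sub_one hq1.ne']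
        have e : -γ - 1 = -(1 + γ) := by ring
        rw [e]
        exact Real.rpow_le_rpow_of_nonpos (by positivity) h1 (by linarith)
      · rw [if_neg hw]
        simp only [mul_one, sub_self, _root_.zero_div, zero_mul]
        refine mul_nonneg (by positivity) ?_
        split_ifs
        · exact hh0 _
        · exact le_rfl
    have hsum : ∑ q ∈ Finset.HasAntidiagonal.antidiagonal r,
        (if M (t, r) ≤ q.2 then cycGen b q.2 else 0) ≤ T (M (t, r)) := by
      rw [← Finset.Nat.sum_antidiagonal_swap, Finset.Nat.sum_antidiagonal_eq_sum_range_succ_mk]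
      simp only [Prod.swap]
      rw [← Finset.sum_filter]
      have e : (Finset.range (r + 1)).filter (fun k => M (t, r) ≤ k) =
          Finset.Ico (M (t, r)) (r + 1) := by
        ext k; simp [Finset.mem_Ico, and_comm]
      rw [e, Finset.sum_Ico_eq_sum_range]
      simp only [add_comm (M (t, r)), hT]
      exact ((summable_nat_add_iff _).2 hh).sum_le_tsum _ fun k _ => hh0 _
    have h4 := hsub.trans ((Finset.sum_le_sum hterm).trans (le_of_eq (Finset.mul_sum _ _ _).symm))
    have h5 : (x₀ * t) ^ (-(1 + γ)) * T (M (t, r)) ≤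
        (x₀⁻¹ * (r / t)) ^ (1 + γ) * T (M (t, r)) * cycGen b r := by
      have hT' : 0 ≤ T (M (t, r)) := tsum_nonneg fun _ => hh0 _
      have e1 : (x₀ * t) ^ (-(1 + γ)) = (x₀⁻¹ * (r / t)) ^ (1 + γ) * (r : ℝ) ^ (-(1 + γ)) := by
        rw [Real.rpow_neg (by positivity), Real.rpow_neg hr.le, ← Real.inv_rpow (by positivity),
          ← Real.inv_rpow hr.le, ← Real.mul_rpow (by positivity) (by positivity)]
        congr 1
        field_simp
      rw [e1]
      have := mul_le_mul_of_nonneg_left hlow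
        (mul_nonneg (Real.rpow_nonneg (show 0 ≤ x₀⁻¹ * ((r : ℝ) / t) by positivity) (1 + γ)) hT')
      linarith
    rw [le_div_iff₀ hpos]
    have h6 := h4.trans ((mul_le_mul_of_nonneg_left hsum (by positivity)).trans h5)
    linarith
  · filter_upwards with p
    refine div_le_one_of_le₀ ?_ (hh0 _)
    exact cycGen_mono (fun j hj => mul_nonneg (hb0 j hj) (by split_ifs <;> simp))
      (fun j hj => mul_le_of_le_one_right (hb0 j hj) (by split_ifs <;> simp)) _

/-! ### Fourier analysis on the cube -/

/-- The projection of `ℝ^d` onto the torus `ℝ^d / Lℤ^d`, rescaled to the unit torus. -/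
def torusProj (d : ℕ) (L : ℝ) (x : Eu d) : UnitAddTorus (Fin d) :=
  fun i => ((x i / L : ℝ) : UnitAddCircle)

/-- The character `x ↦ e^{2πi n·x/L}`. -/
def chr (d : ℕ) (L : ℝ) (n : Fin d → ℤ) (x : Eu d) : ℂ :=
  UnitAddTorus.mFourier n (torusProj d L x)

lemma measure_torus_ext {d : ℕ} {μ ν : Measure (UnitAddTorus (Fin d))} [IsFiniteMeasure μ]
    [IsFiniteMeasure ν]
    (h : ∀ n : Fin d → ℤ, ∫ t, UnitAddTorus.mFourier n t ∂μ = ∫ t, UnitAddTorus.mFourier n t ∂ν) :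
    μ = ν := by
  let A : StarSubalgebra ℂ (BoundedContinuousFunction (UnitAddTorus (Fin d)) ℂ) :=
    (UnitAddTorus.mFourierSubalgebra (Fin d)).comap
      (BoundedContinuousFunction.toContinuousMapStarₐ ℂ)
  have key : ∀ g ∈ UnitAddTorus.mFourierSubalgebra (Fin d), ∫ t, g t ∂μ = ∫ t, g t ∂ν := by
    intro g hg
    have hg' : g ∈ Submodule.span ℂ (Set.range (UnitAddTorus.mFourier (d := Fin d))) := by
      rw [← UnitAddTorus.mFourierSubalgebra_coe]; exact hg
    have hintg : ∀ (m : Measure (UnitAddTorus (Fin d))) [IsFiniteMeasure m]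
        (g : C(UnitAddTorus (Fin d), ℂ)), Integrable g m := fun m _ g =>
      (BoundedContinuousFunction.mkOfCompact g).integrable m
    refine Submodule.span_induction ?_ ?_ ?_ ?_ hg'
    · rintro _ ⟨n, rfl⟩; exact h n
    · simp
    · intro x y _ _ hx hy
      simp only [ContinuousMap.add_apply]
      rw [integral_add (hintg μ x) (hintg μ y), integral_add (hintg ν x) (hintg ν y), hx, hy]
    · intro a x _ hx
      simp only [ContinuousMap.smul_apply]
      rw [integral_smul, integral_smul, hx]
  refine ext_of_forall_mem_subalgebra_integral_eq_of_polish (𝕜 := ℂ) (A := A) ?_ ?_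
  · intro x y hxy
    obtain ⟨_, ⟨g, hg, rfl⟩, hne⟩ := UnitAddTorus.mFourierSubalgebra_separatesPoints hxy
    refine ⟨_, ⟨g, ⟨BoundedContinuousFunction.mkOfCompact g, ?_, ?_⟩, rfl⟩, hne⟩
    · change g ∈ UnitAddTorus.mFourierSubalgebra (Fin d); exact hg
    · ext; rfl
  · intro g hg
    exact key (BoundedContinuousFunction.toContinuousMapStarₐ ℂ g) hg

lemma continuous_torusProj (d : ℕ) (L : ℝ) : Continuous (torusProj d L) := by
  unfold torusProj
  refine continuous_pi fun i => ?_
  exact (AddCircle.continuous_mk' 1).comp (by fun_prop)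

lemma measurable_torusProj (d : ℕ) (L : ℝ) : Measurable (torusProj d L) :=
  (continuous_torusProj d L).measurable

lemma continuous_chr (d : ℕ) (L : ℝ) (n : Fin d → ℤ) : Continuous (chr d L n) :=
  (UnitAddTorus.mFourier n).continuous.comp (continuous_torusProj d L)

lemma chr_eq_prod (d : ℕ) (L : ℝ) (n : Fin d → ℤ) (x : Eu d) :
    chr d L n x = ∏ i, Complex.exp (2 * Real.pi * Complex.I * n i * (x i / L : ℝ)) := by
  simp [chr, UnitAddTorus.mFourier, torusProj]

lemma chr_eq_exp (d : ℕ) (L : ℝ) (n : Fin d → ℤ) (x : Eu d) :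
    chr d L n x = Complex.exp ((2 * Real.pi * ∑ i, n i * x i / L : ℝ) * Complex.I) := by
  rw [chr_eq_prod, ← Complex.exp_sum]
  congr 1
  push_cast
  rw [Finset.mul_sum, Finset.sum_mul]
  refine Finset.sum_congr rfl fun i _ => by ring

lemma norm_chr (d : ℕ) (L : ℝ) (n : Fin d → ℤ) (x : Eu d) : ‖chr d L n x‖ = 1 := by
  rw [chr_eq_exp, Complex.norm_exp_ofReal_mul_I]

lemma chr_sub (d : ℕ) (L : ℝ) (n : Fin d → ℤ) (x y : Eu d) :
    chr d L n (x - y) = chr d L n x * chr d L (-n) y := by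
  simp only [chr_eq_exp, ← Complex.exp_add]
  congr 1
  push_cast
  rw [← add_mul, ← mul_add, ← Finset.sum_add_distrib]
  congr 2
  refine Finset.sum_congr rfl fun i _ => by simp; ring

lemma chr_add_index (d : ℕ) (L : ℝ) (m n : Fin d → ℤ) (x : Eu d) :
    chr d L (m + n) x = chr d L m x * chr d L n x := UnitAddTorus.mFourier_add

lemma chr_neg_index (d : ℕ) (L : ℝ) (n : Fin d → ℤ) (x : Eu d) :
    chr d L (-n) x = starRingEnd ℂ (chr d L n x) := UnitAddTorus.mFourier_neg

lemma torusProj_sub_latPt {d : ℕ} {L : ℝ} (hL : 0 < L) (x : Eu d) (z : Fin d → ℤ) :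
    torusProj d L (x - latPt d L z) = torusProj d L x := by
  funext i
  simp only [torusProj, latPt, PiLp.sub_apply, WithLp.equiv_symm_apply]
  rw [sub_div, mul_div_cancel_left₀ _ hL.ne', AddCircle.coe_sub]
  have : (((z i : ℤ) : ℝ) : UnitAddCircle) = 0 := by
    have := AddCircle.coe_period (1:ℝ)
    rw [AddCircle.coe_eq_zero_iff]
    exact ⟨z i, by simp⟩
  rw [this, sub_zero]

lemma chr_sub_latPt {d : ℕ} {L : ℝ} (hL : 0 < L) (n : Fin d → ℤ) (x : Eu d) (z : Fin d → ℤ) :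
    chr d L n (x - latPt d L z) = chr d L n x := by
  rw [chr, torusProj_sub_latPt hL, chr]

lemma measurableSet_cube (d : ℕ) (L : ℝ) : MeasurableSet (cube d L) := by
  have : cube d L = ⋂ i, (fun x : Eu d => x i) ⁻¹' Set.Ico (0:ℝ) L := by
    ext; simp [cube]
  rw [this]
  exact MeasurableSet.iInter fun i => measurableSet_Ico.preimage (by fun_prop)

lemma integral_exp_period {L : ℝ} (hL : 0 < L) (n : ℤ) :
    ∫ x in Set.Ico (0:ℝ) L, Complex.exp (2 * Real.pi * Complex.I * n * (x / L : ℝ)) =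
      if n = 0 then (L : ℂ) else 0 := by
  rw [integral_Ico_eq_integral_Ioc, ← intervalIntegral.integral_of_le hL.le]
  split_ifs with h
  · simp [h]
  · have hc : (2 * Real.pi * Complex.I * n / L : ℂ) ≠ 0 := by
      have : (n : ℂ) ≠ 0 := by exact_mod_cast h
      have h2 : (L : ℂ) ≠ 0 := by exact_mod_cast hL.ne'
      have h3 : (Real.pi : ℂ) ≠ 0 := by exact_mod_cast Real.pi_ne_zero
      simp [this, h2, h3]
    have h2 : (L : ℂ) ≠ 0 := by exact_mod_cast hL.ne'
    have e : ∀ x : ℝ, Complex.exp (2 * Real.pi * Complex.I * n * (x / L : ℝ)) =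
        Complex.exp ((2 * Real.pi * Complex.I * n / L : ℂ) * x) := by
      intro x; congr 1; push_cast; ring
    simp only [e]
    rw [integral_exp_mul_complex hc]
    have : Complex.exp (2 * Real.pi * Complex.I * n / L * L) = 1 := by
      rw [div_mul_cancel₀ _ h2, mul_comm, Complex.exp_int_mul_two_pi_mul_I]
    simp [this]

lemma restrict_cube_map (d : ℕ) (L : ℝ) :
    MeasurePreserving (WithLp.ofLp : Eu d → Fin d → ℝ) (volume.restrict (cube d L))
      (Measure.pi fun _ => volume.restrict (Set.Ico (0:ℝ) L)) := by
  rw [← Measure.restrict_pi_pi]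
  have := (EuclideanSpace.volume_preserving_symm_measurableEquiv_toLp (Fin d)).restrict_preimage
    (s := Set.univ.pi fun _ => Set.Ico (0:ℝ) L)
    (MeasurableSet.univ_pi fun _ => measurableSet_Ico)
  have hs : cube d L = (MeasurableEquiv.toLp 2 (Fin d → ℝ)).symm ⁻¹'
      Set.univ.pi fun _ => Set.Ico (0:ℝ) L := by
    ext x
    simp only [Set.mem_preimage, Set.mem_univ_pi, MeasurableEquiv.coe_toLp_symm]
    rfl
  rw [hs]
  exact this

lemma volume_cube (d : ℕ) {L : ℝ} (hL : 0 < L) : volume (cube d L) = ENNReal.ofReal (L ^ d) := by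
  have := (restrict_cube_map d L).measure_preimage (s := Set.univ) nullMeasurableSet_univ
  rw [Set.preimage_univ, Measure.restrict_apply_univ, Measure.pi_univ] at this
  simp [this, ENNReal.ofReal_pow hL.le]

lemma integral_cube_chr (d : ℕ) {L : ℝ} (hL : 0 < L) (n : Fin d → ℤ) :
    ∫ x in cube d L, chr d L n x = if n = 0 then ((L ^ d : ℝ) : ℂ) else 0 := by
  have h1 : ∫ x in cube d L, chr d L n x =
      ∫ y, ∏ i, Complex.exp (2 * Real.pi * Complex.I * n i * (y i / L : ℝ))
        ∂(Measure.pi fun _ : Fin d => volume.restrict (Set.Ico (0:ℝ) L)) := by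
    rw [← (restrict_cube_map d L).integral_comp (MeasurableEquiv.toLp 2 (Fin d → ℝ)).symm.measurableEmbedding]
    simp only [chr_eq_prod]
  rw [h1, integral_fintype_prod_eq_prod (fun i (y : ℝ) => Complex.exp (2 * Real.pi * Complex.I * n i * (y / L : ℝ)))]
  simp only [integral_exp_period hL]
  split_ifs with h
  · simp [h]
  · obtain ⟨i, hi⟩ := Function.ne_iff.1 h
    exact Finset.prod_eq_zero (Finset.mem_univ i) (if_neg hi)

lemma mem_cube_add_latPt {d : ℕ} {L : ℝ} (hL : 0 < L) (x : Eu d) (z : Fin d → ℤ) :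
    x + latPt d L z ∈ cube d L ↔ z = fun i => -⌊x i / L⌋ := by
  simp only [cube, Set.mem_ofPred_eq, latPt, PiLp.add_apply, WithLp.equiv_symm_apply, funext_iff]
  refine forall_congr' fun i => ?_
  rw [← neg_eq_iff_eq_neg, eq_comm (a := -z i), Int.floor_eq_iff, le_div_iff₀ hL,
    div_lt_iff₀ hL, Set.mem_Ico]
  push_cast
  constructor <;> rintro ⟨h1, h2⟩ <;> constructor <;> nlinarith

/-- Unfolding the integral of a periodization over the fundamental cube. -/
lemma lintegral_cube_tsum {d : ℕ} {L : ℝ} (hL : 0 < L) {h : Eu d → ℝ≥0∞} (hh : Measurable h) :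
    ∫⁻ x in cube d L, ∑' z : Fin d → ℤ, h (x - latPt d L z) = ∫⁻ x, h x := by
  have hm : ∀ z : Fin d → ℤ, Measurable fun x => h (x - latPt d L z) := fun z =>
    hh.comp (by fun_prop)
  rw [lintegral_tsum fun z => (hm z).aemeasurable]
  have h1 : ∀ z : Fin d → ℤ, ∫⁻ x in cube d L, h (x - latPt d L z) =
      ∫⁻ x, (cube d L).indicator 1 (x + latPt d L z) * h x := by
    intro z
    rw [← lintegral_indicator (measurableSet_cube d L),
      ← lintegral_add_right_eq_self _ (latPt d L z)]
    refine lintegral_congr fun x => ?_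
    by_cases hx : x + latPt d L z ∈ cube d L <;> simp [hx]
  simp only [h1]
  rw [← lintegral_tsum fun z => ?_]
  · refine lintegral_congr fun x => ?_
    rw [ENNReal.tsum_mul_right, tsum_eq_single (fun i => -⌊x i / L⌋)]
    · rw [Set.indicator_of_mem ((mem_cube_add_latPt hL x _).2 rfl)]; simp
    · intro z hz
      exact Set.indicator_of_notMem (fun hm => hz ((mem_cube_add_latPt hL x z).1 hm)) _
  · refine ((Measurable.comp (measurable_one.indicator (measurableSet_cube d L)) (by fun_prop)).mul hh).aemeasurable

lemma fper_sub_latPt {d : ℕ} (f : Eu d → ℝ) (L : ℝ) (x : Eu d) (w : Fin d → ℤ) :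
    fper d f L (x - latPt d L w) = fper d f L x := by
  unfold fper
  rw [← (Equiv.addLeft w).tsum_eq fun z => ENNReal.ofReal (f (x - latPt d L z))]
  refine tsum_congr fun z => ?_
  congr 2
  ext i
  simp [latPt, sub_sub]
  ring

lemma map_torusProj_fper {d : ℕ} {f : Eu d → ℝ} (hf : Continuous f) {L : ℝ} (hL : 0 < L) :
    (((volume : Measure (Eu d)).restrict (cube d L)).withDensity (fper d f L)).map (torusProj d L) =
      ((volume : Measure (Eu d)).withDensity fun x => ENNReal.ofReal (f x)).map
        (torusProj d L) := by
  ext B hB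
  have hB' := measurable_torusProj d L hB
  rw [Measure.map_apply (measurable_torusProj d L) hB, Measure.map_apply (measurable_torusProj d L) hB,
    withDensity_apply _ hB', withDensity_apply _ hB', ← lintegral_indicator hB',
    ← lintegral_indicator hB', ← lintegral_cube_tsum hL]
  · refine lintegral_congr fun x => ?_
    by_cases hx : x ∈ torusProj d L ⁻¹' B
    · rw [Set.indicator_of_mem hx, fper]
      refine tsum_congr fun z => ?_
      rw [Set.indicator_of_mem]
      rw [Set.mem_preimage, torusProj_sub_latPt hL]; exact hx
    · rw [Set.indicator_of_notMem hx]
      symm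
      refine ENNReal.tsum_eq_zero.2 fun z => ?_
      rw [Set.indicator_of_notMem]
      rw [Set.mem_preimage, torusProj_sub_latPt hL]; exact hx
  · exact (ENNReal.measurable_ofReal.comp hf.measurable).indicator hB'

lemma lintegral_fper {d : ℕ} {f : Eu d → ℝ} (hf : Continuous f) {L : ℝ} (hL : 0 < L) :
    ∫⁻ x in cube d L, fper d f L x = ∫⁻ x, ENNReal.ofReal (f x) :=
  lintegral_cube_tsum hL (ENNReal.measurable_ofReal.comp hf.measurable)

lemma integral_chr_fper {d : ℕ} {f ε : Eu d → ℝ} (hf : Continuous f) (hf0 : ∀ x, 0 ≤ f x)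
    (hFT : ∀ k : Eu d, 𝓕 (fun x => (f x : ℂ)) k = (Real.exp (-ε k) : ℂ)) {L : ℝ} (hL : 0 < L)
    (n : Fin d → ℤ) :
    ∫ x, chr d L (-n) x ∂(((volume : Measure (Eu d)).restrict (cube d L)).withDensity (fper d f L)) =
      (Real.exp (-ε (dualPt d L n)) : ℂ) := by
  have e1 : ∀ μ : Measure (Eu d), ∫ x, chr d L (-n) x ∂μ =
      ∫ t, UnitAddTorus.mFourier (-n) t ∂(μ.map (torusProj d L)) := by
    intro μ
    rw [integral_map (measurable_torusProj d L).aemeasurable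
      (UnitAddTorus.mFourier (-n)).continuous.aestronglyMeasurable]
    rfl
  rw [e1, map_torusProj_fper hf hL, ← e1, ← hFT, Real.fourier_eq,
    integral_withDensity_eq_integral_toReal_smul hf.measurable.ennreal_ofReal (by simp)]
  refine integral_congr_ae (Eventually.of_forall fun x => ?_)
  simp only [ENNReal.toReal_ofReal (hf0 x), chr_eq_exp, Real.fourierChar_apply, Circle.smul_def, dualPt]
  rw [Complex.real_smul, smul_eq_mul, mul_comm]
  congr 2
  simp only [WithLp.equiv_symm_apply, PiLp.inner_apply]
  push_cast
  congr 1
  rw [← Finset.sum_neg_distrib]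
  congr 1
  refine Finset.sum_congr rfl fun i _ => ?_
  simp
  ring

lemma exp_neg_dispersion_neg {d : ℕ} {f ε : Eu d → ℝ}
    (hFT : ∀ k : Eu d, 𝓕 (fun x => (f x : ℂ)) k = (Real.exp (-ε k) : ℂ)) (k : Eu d) :
    Real.exp (-ε (-k)) = Real.exp (-ε k) := by
  have h : (Real.exp (-ε (-k)) : ℂ) = starRingEnd ℂ (Real.exp (-ε k) : ℂ) := by
    rw [← hFT, ← hFT, Real.fourier_eq, Real.fourier_eq, ← integral_conj]
    refine integral_congr_ae (Eventually.of_forall fun x => ?_)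
    simp [Circle.smul_def, Real.fourierChar_apply, ← Complex.exp_conj, Complex.conj_ofNat]
  rw [Complex.conj_ofReal] at h
  exact_mod_cast h

/-- The Fourier series `L^{-d} ∑_z u_z e^{2πi z·x/L}`. -/
def fourSer (d : ℕ) (L : ℝ) (u : (Fin d → ℤ) → ℝ) (x : Eu d) : ℂ :=
  ((L ^ d : ℝ) : ℂ)⁻¹ * ∑' z : Fin d → ℤ, (u z : ℂ) * chr d L z x

section fourSer

variable {d : ℕ} {L : ℝ} {u : (Fin d → ℤ) → ℝ}

lemma summable_norm_mul_chr (hu0 : ∀ z, 0 ≤ u z) (hu : Summable u) (x : Eu d) :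
    Summable fun z => ‖(u z : ℂ) * chr d L z x‖ := by
  simpa [norm_chr, abs_of_nonneg, hu0] using hu

lemma continuous_fourSer (hu0 : ∀ z, 0 ≤ u z) (hu : Summable u) :
    Continuous (fourSer d L u) := by
  refine continuous_const.mul (continuous_tsum (u := u)
    (fun z => continuous_const.mul (continuous_chr d L z)) hu fun z x => ?_)
  simp [norm_chr, abs_of_nonneg, hu0]

lemma norm_fourSer_le (hL : 0 < L) (hu0 : ∀ z, 0 ≤ u z) (hu : Summable u) (x : Eu d) :
    ‖fourSer d L u x‖ ≤ (L ^ d)⁻¹ * ∑' z, u z := by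
  rw [fourSer, norm_mul, norm_inv, Complex.norm_real, Real.norm_of_nonneg (by positivity)]
  gcongr
  refine (norm_tsum_le_tsum_norm (summable_norm_mul_chr hu0 hu x)).trans_eq ?_
  refine tsum_congr fun z => ?_
  simp [norm_chr, abs_of_nonneg, hu0]

lemma fourSer_im (hue : ∀ z, u (-z) = u z) (x : Eu d) : (fourSer d L u x).im = 0 := by
  rw [← Complex.conj_eq_iff_im, fourSer, map_mul, map_inv₀, Complex.conj_ofReal, Complex.conj_tsum,
    ← (Equiv.neg (Fin d → ℤ)).tsum_eq]
  congr 1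
  refine tsum_congr fun z => ?_
  simp [chr_neg_index, hue]

lemma integral_chr_fourSer (hL : 0 < L) (hu0 : ∀ z, 0 ≤ u z) (hu : Summable u) (n : Fin d → ℤ) :
    ∫ x in cube d L, chr d L (-n) x * fourSer d L u x = (u n : ℂ) := by
  have hV : ((L ^ d : ℝ) : ℂ) ≠ 0 := by exact_mod_cast (pow_pos hL d).ne'
  have : IsFiniteMeasure ((volume : Measure (Eu d)).restrict (cube d L)) :=
    ⟨by simp [volume_cube d hL]⟩
  have h0 : ∀ x, chr d L (-n) x * fourSer d L u x =
      ((L ^ d : ℝ) : ℂ)⁻¹ * ∑' z, (u z : ℂ) * chr d L (z - n) x := by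
    intro x
    rw [fourSer, mul_left_comm, ← tsum_mul_left]
    congr 1
    refine tsum_congr fun z => ?_
    rw [sub_eq_add_neg, chr_add_index]; ring
  simp only [h0]
  rw [integral_const_mul, ← integral_tsum_of_summable_integral_norm]
  · have : ∀ z, ∫ x in cube d L, (u z : ℂ) * chr d L (z - n) x =
        if z = n then (u n : ℂ) * ((L ^ d : ℝ) : ℂ) else 0 := by
      intro z
      rw [integral_const_mul, integral_cube_chr d hL]
      by_cases h : z = n
      · simp [h]
      · simp [h, sub_eq_zero]
    simp only [this, tsum_ite_eq]
    field_simp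
  · intro z
    refine Integrable.of_bound ((continuous_const.mul (continuous_chr d L _)).aestronglyMeasurable)
      (u z) (Eventually.of_forall fun x => ?_)
    simp [norm_chr, abs_of_nonneg, hu0]
  · simp only [norm_mul, norm_chr, Complex.norm_real, mul_one, Real.norm_of_nonneg (hu0 _)]
    simpa using hu.mul_left _

end fourSer

lemma cube_measure_ext {d : ℕ} {L : ℝ} (hL : 0 < L) {μ ν : Measure (Eu d)} [IsFiniteMeasure μ]
    [IsFiniteMeasure ν] (hμ : ∀ᵐ x ∂μ, x ∈ cube d L) (hν : ∀ᵐ x ∂ν, x ∈ cube d L)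
    (h : ∀ n, ∫ x, chr d L n x ∂μ = ∫ x, chr d L n x ∂ν) : μ = ν := by
  have e1 : ∀ (m : Measure (Eu d)) (n : Fin d → ℤ), ∫ x, chr d L n x ∂m =
      ∫ t, UnitAddTorus.mFourier n t ∂(m.map (torusProj d L)) := by
    intro m n
    rw [integral_map (measurable_torusProj d L).aemeasurable
      (UnitAddTorus.mFourier n).continuous.aestronglyMeasurable]
    rfl
  have hmap : μ.map (torusProj d L) = ν.map (torusProj d L) := by
    refine measure_torus_ext fun n => ?_
    rw [← e1, ← e1, h n]
  let r : UnitAddTorus (Fin d) → Eu d := fun t =>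
    WithLp.toLp 2 fun i => L * ((AddCircle.equivIco 1 0 (t i) : Set.Ico (0:ℝ) (0 + 1)) : ℝ)
  have hr : Measurable r := by
    refine (WithLp.measurable_toLp 2 _).comp (measurable_pi_lambda _ fun i => ?_)
    exact (measurable_subtype_coe.comp
      ((AddCircle.measurableEquivIco 1 0).measurable.comp (measurable_pi_apply i))).const_mul L
  have hrq : ∀ x ∈ cube d L, r (torusProj d L x) = x := by
    intro x hx
    ext i
    have hxi := hx i
    have hm : x i / L ∈ Set.Ico (0:ℝ) (0 + 1) := by
      refine ⟨div_nonneg hxi.1 hL.le, ?_⟩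
      rw [div_lt_iff₀ hL]; linarith [hxi.2]
    simp only [r, torusProj]
    rw [AddCircle.equivIco_coe_of_mem hm]
    exact mul_div_cancel₀ _ hL.ne'
  have key : ∀ m : Measure (Eu d), (∀ᵐ x ∂m, x ∈ cube d L) →
      (m.map (torusProj d L)).map r = m := by
    intro m hm
    rw [Measure.map_map hr (measurable_torusProj d L)]
    conv_rhs => rw [← Measure.map_id (μ := m)]
    refine Measure.map_congr ?_
    filter_upwards [hm] with x hx using hrq x hx
  rw [← key μ hμ, ← key ν hν, hmap]

/-- The Poisson summation formula for the periodization. -/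
theorem fper_eq_ofReal_fourSer {d : ℕ} {f ε : Eu d → ℝ} (hf : Continuous f) (hf0 : ∀ x, 0 ≤ f x)
    (hfi : Integrable f)
    (hFT : ∀ k : Eu d, 𝓕 (fun x => (f x : ℂ)) k = (Real.exp (-ε k) : ℂ)) {L : ℝ} (hL : 0 < L)
    (hper : Continuous (fper d f L))
    (hs : Summable fun z : Fin d → ℤ => Real.exp (-ε (dualPt d L z))) (x : Eu d) :
    fper d f L x = ENNReal.ofReal (fourSer d L (fun z => Real.exp (-ε (dualPt d L z))) x).re ∧
      0 ≤ (fourSer d L (fun z => Real.exp (-ε (dualPt d L z))) x).re := by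
  set u : (Fin d → ℤ) → ℝ := fun z => Real.exp (-ε (dualPt d L z)) with hu
  have hu0 : ∀ z, 0 ≤ u z := fun z => (Real.exp_pos _).le
  have hue : ∀ z, u (-z) = u z := by
    intro z
    simp only [hu]
    rw [← exp_neg_dispersion_neg hFT]
    congr 3
    ext i
    simp [dualPt, neg_div]
  set F : Eu d → ℝ := fun x => (fourSer d L u x).re with hF
  have hFc : Continuous F := Complex.continuous_re.comp (continuous_fourSer hu0 hs)
  have hFb : ∀ x, |F x| ≤ (L ^ d)⁻¹ * ∑' z, u z := fun x =>
    (Complex.abs_re_le_norm _).trans (norm_fourSer_le hL hu0 hs x)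
  set M := (L ^ d)⁻¹ * ∑' z, u z with hM
  have hFeq : ∀ x, fourSer d L u x = (F x : ℂ) := fun x =>
    Complex.ext (by simp [hF]) (by simpa using fourSer_im hue x)
  set μ := (volume : Measure (Eu d)).restrict (cube d L) with hμ
  have : IsFiniteMeasure μ := ⟨by simp [hμ, volume_cube d hL]⟩
  have hfinF : ∀ G : Eu d → ℝ, (∀ x, |G x| ≤ M) → ∫⁻ x, ENNReal.ofReal (G x) ∂μ ≠ ⊤ := by
    intro G hG
    refine ((lintegral_mono fun x =>
      ENNReal.ofReal_le_ofReal ((le_abs_self _).trans (hG x))).trans_lt ?_).ne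
    rw [lintegral_const]
    exact ENNReal.mul_lt_top ENNReal.ofReal_lt_top (measure_lt_top _ _)
  have hfin1 := hfinF F hFb
  have hfin2 := hfinF (fun x => -F x) (fun x => by rw [abs_neg]; exact hFb x)
  have hfin0 : ∫⁻ x, fper d f L x ∂μ ≠ ⊤ := by
    rw [hμ, lintegral_fper hf hL]
    exact (hfi.lintegral_lt_top).ne
  have hmF : Measurable fun x => ENNReal.ofReal (F x) := hFc.measurable.ennreal_ofReal
  have hmF' : Measurable fun x => ENNReal.ofReal (-F x) := hFc.neg.measurable.ennreal_ofReal
  have i0 : IsFiniteMeasure (μ.withDensity (fper d f L)) := isFiniteMeasure_withDensity hfin0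
  have i1 : IsFiniteMeasure (μ.withDensity fun x => ENNReal.ofReal (F x)) :=
    isFiniteMeasure_withDensity hfin1
  have i2 : IsFiniteMeasure (μ.withDensity fun x => ENNReal.ofReal (-F x)) :=
    isFiniteMeasure_withDensity hfin2
  have hcube : ∀ G : Eu d → ℝ≥0∞, ∀ᵐ x ∂(μ.withDensity G), x ∈ cube d L := fun G =>
    (withDensity_absolutelyContinuous μ G).ae_le (ae_restrict_mem (measurableSet_cube d L))
  have hchr : ∀ (m : Measure (Eu d)) [IsFiniteMeasure m] (n : Fin d → ℤ),
      Integrable (chr d L n) m := fun m _ n =>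
    Integrable.of_bound (continuous_chr d L n).aestronglyMeasurable 1
      (Eventually.of_forall fun x => (norm_chr d L n x).le)
  have hFi : ∀ G : Eu d → ℝ, Continuous G → (∀ x, |G x| ≤ M) → ∀ n : Fin d → ℤ,
      Integrable (fun x => (G x : ℂ) * chr d L n x) μ := by
    intro G hG hGM n
    refine Integrable.of_bound ((Complex.continuous_ofReal.comp hG).mul
      (continuous_chr d L n)).aestronglyMeasurable M (Eventually.of_forall fun x => ?_)
    simpa [norm_chr] using hGM x
  have hmeas : μ.withDensity (fper d f L) + μ.withDensity (fun x => ENNReal.ofReal (-F x)) =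
      μ.withDensity fun x => ENNReal.ofReal (F x) := by
    refine cube_measure_ext hL ?_ (hcube _) fun n => ?_
    · rw [ae_add_measure_iff]; exact ⟨hcube _, hcube _⟩
    rw [integral_add_measure (hchr _ n) (hchr _ n)]
    have h1 := integral_chr_fper hf hf0 hFT hL (-n)
    rw [neg_neg] at h1
    rw [h1, integral_withDensity_eq_integral_toReal_smul hmF' (by simp),
      integral_withDensity_eq_integral_toReal_smul hmF (by simp)]
    have h2 := integral_chr_fourSer hL hu0 hs (-n)
    rw [neg_neg] at h2
    change ((u (-n) : ℝ) : ℂ) + _ = _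
    rw [← h2, ← eq_sub_iff_add_eq]
    simp only [Complex.real_smul, ENNReal.toReal_ofReal']
    rw [← integral_sub]
    · refine integral_congr_ae (Eventually.of_forall fun x => ?_)
      simp only []
      rw [hFeq, ← sub_mul, mul_comm, ← Complex.ofReal_sub]
      congr 2
      rcases le_total 0 (F x) with h | h
      · rw [max_eq_left h, max_eq_right (by linarith)]; ring
      · rw [max_eq_right h, max_eq_left (by linarith)]; ring
    · refine hFi (fun x => max (F x) 0) (by fun_prop) (fun x => ?_) n
      exact (abs_max_le_max_abs_abs).trans (max_le (hFb x) (by simpa using (abs_nonneg _).trans (hFb x)))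
    · refine hFi (fun x => max (-F x) 0) (by fun_prop) (fun x => ?_) n
      exact (abs_max_le_max_abs_abs).trans
        (max_le (by simpa using hFb x) (by simpa using (abs_nonneg _).trans (hFb x)))
  rw [← withDensity_add_right _ hmF', withDensity_eq_iff (hper.measurable.add hmF').aemeasurable
    hmF.aemeasurable] at hmeas
  swap
  · simp only [Pi.add_apply]
    rw [lintegral_add_right _ hmF']
    exact ENNReal.add_ne_top.2 ⟨hfin0, hfin2⟩
  have hcl : cube d L ⊆ closure (interior (cube d L)) := by
    have ho : {x : Eu d | ∀ i, x i ∈ Set.Ioo (0:ℝ) L} ⊆ interior (cube d L) := by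
      refine interior_maximal (fun x hx i => Set.Ioo_subset_Ico_self (hx i)) ?_
      have : {x : Eu d | ∀ i, x i ∈ Set.Ioo (0:ℝ) L} =
          ⋂ i, (fun x : Eu d => x i) ⁻¹' Set.Ioo (0:ℝ) L := by ext; simp
      rw [this]
      exact isOpen_iInter_of_finite fun i => isOpen_Ioo.preimage (by fun_prop)
    intro x hx
    refine mem_closure_of_tendsto (b := 𝓝[>] (0:ℝ)) (f := fun s : ℝ =>
      (WithLp.toLp 2 fun i => (1 - s) * x i + s * (L / 2) : Eu d)) ?_ ?_
    · have : Continuous fun s : ℝ =>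
          (WithLp.toLp 2 fun i => (1 - s) * x i + s * (L / 2) : Eu d) := by fun_prop
      have h := (this.tendsto 0).mono_left (nhdsWithin_le_nhds (s := Set.Ioi 0))
      simpa using h
    · filter_upwards [Ioo_mem_nhdsGT (zero_lt_one' ℝ)] with s hs
      refine ho fun i => ?_
      have := hx i
      simp only [Set.mem_Ioo]
      constructor <;> nlinarith [this.1, this.2, hs.1, hs.2]
  have hEq := Measure.eqOn_of_ae_eq hmeas
    (by
      refine Continuous.continuousOn ?_
      exact hper.add (ENNReal.continuous_ofReal.comp hFc.neg))
    (ENNReal.continuous_ofReal.comp hFc).continuousOn hcl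
  obtain ⟨w, hw⟩ : ∃ w : Fin d → ℤ, x - latPt d L w ∈ cube d L := by
    refine ⟨fun i => ⌊x i / L⌋, ?_⟩
    have := (mem_cube_add_latPt hL x fun i => -⌊x i / L⌋).2 rfl
    convert this using 1
    ext i
    simp [latPt, sub_eq_add_neg]
  have hx := hEq hw
  have hFx : F (x - latPt d L w) = F x := by
    simp only [hF, fourSer, chr_sub_latPt hL]
  simp only [Pi.add_apply, fper_sub_latPt, hFx] at hx
  have hnn : 0 ≤ F x := by
    by_contra hneg
    push Not at hneg
    rw [ENNReal.ofReal_of_nonpos hneg.le] at hx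
    have : ENNReal.ofReal (-F x) = 0 := (add_eq_zero.1 hx).2
    rw [ENNReal.ofReal_eq_zero] at this
    linarith
  refine ⟨?_, hnn⟩
  rw [ENNReal.ofReal_of_nonpos (by linarith : -F x ≤ 0), add_zero] at hx
  exact hx

/-! ### Cycles and invariant colorings -/

/-- The product over the cycles of `π` (the classes of `SameCycle`) of a function of the length. -/
lemma prod_quotient_sameCycle {M : Type*} [CommMonoid M] {N : ℕ} (π : Equiv.Perm (Fin N))
    (Φ : ℕ → M) :
    ∏ q : Quotient (Equiv.Perm.SameCycle.setoid π),
      Φ (Finset.univ.filter fun i => (Quotient.mk _ i : Quotient (Equiv.Perm.SameCycle.setoid π)) = q).card =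
      ((cycleLens π).map Φ).prod := by
  set Q := Quotient (Equiv.Perm.SameCycle.setoid π) with hQ
  have hmk : ∀ (q : Q) (i : Fin N), (Quotient.mk _ i : Q) = q ↔ π.SameCycle i q.out := by
    intro q i
    exact Quotient.mk_eq_iff_out
  have hout : ∀ i : Fin N, π.SameCycle (Quotient.mk _ i : Q).out i := fun i =>
    ((hmk _ i).1 rfl).symm
  rw [← Finset.prod_filter_mul_prod_filter_not Finset.univ (fun q : Q => q.out ∈ π.support),
    cycleLens, Multiset.map_add, Multiset.prod_add]
  congr 1
  · rw [Equiv.Perm.cycleType_def, Multiset.map_map]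
    refine Finset.prod_nbij (fun q : Q => π.cycleOf q.out) ?_ ?_ ?_ ?_
    · intro q hq
      rw [Finset.mem_filter] at hq
      exact Equiv.Perm.cycleOf_mem_cycleFactorsFinset_iff.2 hq.2
    · intro q hq q' hq' h
      simp only [Finset.coe_filter, Finset.mem_univ, true_and, Set.mem_ofPred_eq] at hq hq'
      simp only at h
      have h1 : q.out ∈ (π.cycleOf q'.out).support := by
        rw [← h, Equiv.Perm.mem_support_cycleOf_iff' (Equiv.Perm.mem_support.1 hq)]
      rw [Equiv.Perm.mem_support_cycleOf_iff' (Equiv.Perm.mem_support.1 hq')] at h1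
      rw [← (hmk q' q.out).2 h1.symm, Quotient.out_eq]
    · intro c hc
      rw [Finset.mem_coe] at hc
      obtain ⟨a, ha⟩ : ∃ a, a ∈ c.support := by
        have := (Equiv.Perm.mem_cycleFactorsFinset_iff.1 hc).1
        exact Finset.card_pos.1 (by have := this.two_le_card_support; omega)
      have hc' := Equiv.Perm.cycle_is_cycleOf ha hc
      have hs := Equiv.Perm.mem_cycleFactorsFinset_support_le hc ha
      have hcyc : π.cycleOf (Quotient.mk _ a : Q).out = c := by
        rw [hc']; exact (hout a).cycleOf_eq
      refine ⟨Quotient.mk _ a, ?_, hcyc⟩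
      simp only [Finset.coe_filter, Finset.mem_univ, true_and, Set.mem_ofPred_eq]
      rw [← Equiv.Perm.cycleOf_mem_cycleFactorsFinset_iff, hcyc]
      exact hc
    · intro q hq
      rw [Finset.mem_filter] at hq
      simp only [Function.comp]
      congr 2
      ext i
      rw [Finset.mem_filter, Equiv.Perm.mem_support_cycleOf_iff' (Equiv.Perm.mem_support.1 hq.2), hmk,
        Equiv.Perm.sameCycle_comm]
      simp
  · rw [Multiset.map_replicate, Multiset.prod_replicate, Equiv.Perm.sum_cycleType]
    have hfix : ∀ a b, π a = a → π.SameCycle a b → a = b := by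
      intro a b ha hab
      exact (hab.eq_of_left ha)
    have hcard : N - π.support.card = (Finset.univ.filter fun i => i ∉ π.support).card := by
      have := Finset.card_compl π.support
      rw [Fintype.card_fin] at this
      rw [← this]
      congr 1
      ext; simp
    rw [hcard, ← Finset.prod_const]
    refine Finset.prod_nbij (fun q : Q => q.out) ?_ ?_ ?_ ?_
    · intro q hq
      simpa using hq
    · intro q _ q' _ h
      exact Quotient.out_injective h
    · intro i hi
      simp only [Finset.coe_filter, Finset.mem_univ, true_and, Set.mem_ofPred_eq] at hi
      have : (Quotient.mk _ i : Q).out = i :=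
        (hfix i _ (by simpa using hi) (hout i).symm).symm
      refine ⟨Quotient.mk _ i, ?_, this⟩
      simp only [Finset.coe_filter, Finset.mem_univ, true_and, Set.mem_ofPred_eq, this]
      exact hi
    · intro q hq
      rw [Finset.mem_filter] at hq
      congr 1
      rw [Finset.card_eq_one]
      refine ⟨q.out, ?_⟩
      ext i
      rw [Finset.mem_filter, hmk, Finset.mem_singleton]
      constructor
      · rintro ⟨_, h⟩
        exact (hfix _ _ (by simpa using hq.2) h.symm).symm
      · rintro rfl; exact ⟨Finset.mem_univ _, Equiv.Perm.SameCycle.refl _ _⟩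

lemma sum_invariant_prod {ι : Type*} {N : ℕ} (π : Equiv.Perm (Fin N)) (K : Finset ι) (u : ι → ℂ) :
    ∑ κ ∈ Fintype.piFinset (fun _ : Fin N => K), (if ∀ i, κ (π i) = κ i then ∏ i, u (κ i) else 0) =
      ((cycleLens π).map fun ℓ => ∑ k ∈ K, u k ^ ℓ).prod := by
  set Q := Quotient (Equiv.Perm.SameCycle.setoid π) with hQ
  rw [← prod_quotient_sameCycle, Finset.prod_univ_sum, ← Finset.sum_filter]
  have hinv : ∀ κ : Fin N → ι, (∀ i, κ (π i) = κ i) → ∀ i j, π.SameCycle i j → κ i = κ j := by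
    intro κ hκ i j hij
    obtain ⟨n, rfl⟩ := hij.exists_nat_pow_eq
    induction n with
    | zero => rfl
    | succ n ih => rw [pow_succ', Equiv.Perm.mul_apply, hκ]; exact ih ⟨n, by simp⟩
  symm
  refine Finset.sum_bij' (fun κ' _ => fun i => κ' (Quotient.mk _ i : Q))
    (fun κ _ => fun q : Q => κ q.out) ?_ ?_ ?_ ?_ ?_
  · intro κ' h
    rw [Fintype.mem_piFinset] at h
    rw [Finset.mem_filter, Fintype.mem_piFinset]
    refine ⟨fun i => h _, fun i => ?_⟩
    refine congrArg κ' (Quotient.sound ?_)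
    exact Equiv.Perm.sameCycle_apply_left.2 (Equiv.Perm.SameCycle.refl π i)
  · intro κ h
    rw [Finset.mem_filter, Fintype.mem_piFinset] at h
    rw [Fintype.mem_piFinset]
    exact fun q => h.1 _
  · intro κ' _
    funext q
    simp only [Quotient.out_eq]
  · intro κ h
    rw [Finset.mem_filter] at h
    funext i
    exact hinv κ h.2 _ _ (Quotient.exact (Quotient.out_eq (Quotient.mk _ i : Q)))
  · intro κ' _
    rw [← Finset.prod_fiberwise Finset.univ (fun i => (Quotient.mk _ i : Q))]
    refine Finset.prod_congr rfl fun q _ => ?_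
    rw [← Finset.prod_const]
    refine Finset.prod_congr rfl fun i hi => ?_
    exact congrArg (fun q => u (κ' q)) (Finset.mem_filter.1 hi).2.symm

lemma integral_prod_partialSum {d : ℕ} {L : ℝ} (hL : 0 < L) {N : ℕ} (π : Equiv.Perm (Fin N))
    (u : (Fin d → ℤ) → ℝ) (K : Finset (Fin d → ℤ)) :
    ∫ x, ∏ i, (((L ^ d : ℝ) : ℂ)⁻¹ * ∑ k ∈ K, (u k : ℂ) * chr d L k (x i - x (π i)))
      ∂(Measure.pi fun _ : Fin N => (volume : Measure (Eu d)).restrict (cube d L)) =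
      ((cycleLens π).map fun ℓ => ∑ k ∈ K, (u k : ℂ) ^ ℓ).prod := by
  have hV : ((L ^ d : ℝ) : ℂ) ≠ 0 := by exact_mod_cast (pow_pos hL d).ne'
  have : IsFiniteMeasure ((volume : Measure (Eu d)).restrict (cube d L)) :=
    ⟨by simp [volume_cube d hL]⟩
  have hexp : ∀ x : Fin N → Eu d,
      ∏ i, (((L ^ d : ℝ) : ℂ)⁻¹ * ∑ k ∈ K, (u k : ℂ) * chr d L k (x i - x (π i))) =
      ∑ κ ∈ Fintype.piFinset (fun _ : Fin N => K), ((((L ^ d : ℝ) : ℂ)⁻¹) ^ N * ∏ i, (u (κ i) : ℂ)) *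
        ∏ i, chr d L (κ i + -κ (π⁻¹ i)) (x i) := by
    intro x
    rw [Finset.prod_mul_distrib, Finset.prod_univ_sum, Finset.prod_const, Finset.card_univ,
      Fintype.card_fin, Finset.mul_sum]
    refine Finset.sum_congr rfl fun κ _ => ?_
    rw [Finset.prod_mul_distrib, mul_assoc]
    congr 2
    simp only [chr_sub, chr_add_index, Finset.prod_mul_distrib]
    congr 1
    rw [← Equiv.prod_comp π (fun i => chr d L (-κ (π⁻¹ i)) (x i))]
    simp
  simp only [hexp]
  have hintg : ∀ n : Fin N → Fin d → ℤ, ∫ x, ∏ i, chr d L (n i) (x i)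
      ∂(Measure.pi fun _ : Fin N => (volume : Measure (Eu d)).restrict (cube d L)) =
      ∏ i, if n i = 0 then ((L ^ d : ℝ) : ℂ) else 0 := by
    intro n
    rw [integral_fintype_prod_eq_prod (fun i (y : Eu d) => chr d L (n i) y)]
    simp only [integral_cube_chr d hL]
  rw [integral_finsetSum, ← sum_invariant_prod]
  · refine Finset.sum_congr rfl fun κ _ => ?_
    rw [integral_const_mul, hintg fun i => κ i + -κ (π⁻¹ i)]
    split_ifs with h
    · have : ∀ i, κ i + -κ (π⁻¹ i) = 0 := by
        intro i
        have := h (π⁻¹ i)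
        rw [show π (π⁻¹ i) = i from π.apply_symm_apply i] at this
        rw [this, add_neg_cancel]
      simp only [this, if_true, Finset.prod_const, Finset.card_univ, Fintype.card_fin]
      rw [mul_right_comm, ← mul_pow, inv_mul_cancel₀ hV, one_pow, one_mul]
    · push Not at h
      obtain ⟨i, hi⟩ := h
      refine mul_eq_zero_of_right _ (Finset.prod_eq_zero (Finset.mem_univ (π i)) (if_neg ?_))
      rw [show π⁻¹ (π i) = i from π.symm_apply_apply i, ← sub_eq_add_neg, sub_eq_zero]
      exact hi
  · intro κ _
    refine Integrable.const_mul ?_ _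
    refine Integrable.of_bound (C := 1) (Continuous.aestronglyMeasurable ?_) (Eventually.of_forall fun x => ?_)
    · exact continuous_finsetProd _ fun i _ => (continuous_chr d L _).comp (continuous_apply i)
    · simp [norm_chr]

lemma integral_prod_fourSer {d : ℕ} {L : ℝ} (hL : 0 < L) {N : ℕ} (π : Equiv.Perm (Fin N))
    {u : (Fin d → ℤ) → ℝ} (hu0 : ∀ z, 0 ≤ u z) (hu1 : ∀ z, u z ≤ 1) (hu : Summable u) :
    ∫ x, ∏ i, fourSer d L u (x i - x (π i))
      ∂(Measure.pi fun _ : Fin N => (volume : Measure (Eu d)).restrict (cube d L)) =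
      (((cycleLens π).map fun ℓ => ∑' z, u z ^ ℓ).prod : ℝ) := by
  have : IsFiniteMeasure ((volume : Measure (Eu d)).restrict (cube d L)) :=
    ⟨by simp [volume_cube d hL]⟩
  set M := (L ^ d)⁻¹ * ∑' z, u z with hM
  have hM0 : 0 ≤ M := mul_nonneg (by positivity) (tsum_nonneg hu0)
  have h1 : Tendsto (fun K : Finset (Fin d → ℤ) =>
      ∫ x, ∏ i, (((L ^ d : ℝ) : ℂ)⁻¹ * ∑ k ∈ K, (u k : ℂ) * chr d L k (x i - x (π i)))
      ∂(Measure.pi fun _ : Fin N => (volume : Measure (Eu d)).restrict (cube d L))) atTop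
      (𝓝 (∫ x, ∏ i, fourSer d L u (x i - x (π i))
      ∂(Measure.pi fun _ : Fin N => (volume : Measure (Eu d)).restrict (cube d L)))) := by
    refine tendsto_integral_filter_of_dominated_convergence (fun _ => M ^ N) ?_ ?_ ?_ ?_
    · refine Eventually.of_forall fun K => Continuous.aestronglyMeasurable ?_
      refine continuous_finsetProd _ fun i _ => continuous_const.mul
        (continuous_finsetSum _ fun k _ => continuous_const.mul ((continuous_chr d L k).comp ?_))
      fun_prop
    · refine Eventually.of_forall fun K => Eventually.of_forall fun x => ?_
      rw [norm_prod]
      have : ∀ i ∈ (Finset.univ : Finset (Fin N)),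
          ‖((L ^ d : ℝ) : ℂ)⁻¹ * ∑ k ∈ K, (u k : ℂ) * chr d L k (x i - x (π i))‖ ≤ M := by
        intro i _
        rw [norm_mul, norm_inv, Complex.norm_real, Real.norm_of_nonneg (by positivity)]
        refine mul_le_mul_of_nonneg_left ?_ (by positivity)
        refine (norm_sum_le _ _).trans ?_
        simp only [norm_mul, norm_chr, Complex.norm_real, mul_one, Real.norm_of_nonneg (hu0 _)]
        exact hu.sum_le_tsum K fun z _ => hu0 z
      refine (Finset.prod_le_prod (fun _ _ => norm_nonneg _) this).trans_eq ?_
      simp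
    · exact integrable_const _
    · refine Eventually.of_forall fun x => ?_
      refine tendsto_finsetProd _ fun i _ => ?_
      exact ((summable_norm_mul_chr hu0 hu _).of_norm.hasSum).const_mul _ 
  simp only [integral_prod_partialSum hL] at h1
  refine tendsto_nhds_unique h1 ?_
  have h2 : Tendsto (fun K : Finset (Fin d → ℤ) => ((cycleLens π).map fun ℓ => ∑ k ∈ K, u k ^ ℓ).prod)
      atTop (𝓝 ((cycleLens π).map fun ℓ => ∑' z, u z ^ ℓ).prod) := by
    refine tendsto_multiset_prod _ fun ℓ hℓ => ?_
    have hℓ := cycleLens_pos π ℓ hℓ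
    refine Summable.hasSum (Summable.of_nonneg_of_le (fun z => pow_nonneg (hu0 z) _) (fun z => ?_) hu)
    exact pow_le_of_le_one (hu0 z) (hu1 z) hℓ.ne'
  have h3 := (Complex.continuous_ofReal.tendsto _).comp h2
  refine h3.congr fun K => ?_
  simp only [Function.comp]
  rw [← Complex.ofRealHom_eq_coe, map_multiset_prod, Multiset.map_map]
  simp [Function.comp]

/-- The Gibbs weight of a permutation factorizes over its cycles. -/
theorem gibbsW_toReal {d : ℕ} {f ε : Eu d → ℝ} (hf : Continuous f) (hf0 : ∀ x, 0 ≤ f x)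
    (hfi : Integrable f) (hε0 : ∀ k, 0 ≤ ε k)
    (hFT : ∀ k : Eu d, 𝓕 (fun x => (f x : ℂ)) k = (Real.exp (-ε k) : ℂ)) {L : ℝ} (hL : 0 < L)
    (hper : Continuous (fper d f L))
    (hs : Summable fun z : Fin d → ℤ => Real.exp (-ε (dualPt d L z))) (α : ℕ → ℝ) {N : ℕ}
    (π : Equiv.Perm (Fin N)) :
    (gibbsW d f α L N π).toReal =
      ((cycleLens π).map fun j : ℕ => Real.exp (-α j) *
        ∑' z : Fin d → ℤ, Real.exp (-ε (dualPt d L z)) ^ j).prod := by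
  set u : (Fin d → ℤ) → ℝ := fun z => Real.exp (-ε (dualPt d L z)) with hu
  have hu0 : ∀ z, 0 ≤ u z := fun z => (Real.exp_pos _).le
  have hu1 : ∀ z, u z ≤ 1 := fun z => Real.exp_le_one_iff.2 (by linarith [hε0 (dualPt d L z)])
  have hP := fper_eq_ofReal_fourSer hf hf0 hfi hFT hL hper hs
  have hT0 : 0 ≤ ((cycleLens π).map fun ℓ => ∑' z, u z ^ ℓ).prod := by
    refine Multiset.prod_nonneg fun x hx => ?_
    obtain ⟨ℓ, _, rfl⟩ := Multiset.mem_map.1 hx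
    exact tsum_nonneg fun z => pow_nonneg (hu0 z) _
  have hkey : ∫⁻ x in Set.univ.pi (fun _ : Fin N => cube d L), ∏ i, fper d f L (x i - x (π i)) =
      ENNReal.ofReal ((cycleLens π).map fun ℓ => ∑' z, u z ^ ℓ).prod := by
    have hc := continuous_fourSer (L := L) hu0 hs
    have : IsFiniteMeasure ((volume : Measure (Eu d)).restrict (cube d L)) :=
      ⟨by simp [volume_cube d hL]⟩
    rw [volume_pi, Measure.restrict_pi_pi]
    have e1 : ∀ x : Fin N → Eu d, ∏ i, fper d f L (x i - x (π i)) =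
        ENNReal.ofReal (∏ i, (fourSer d L u (x i - x (π i))).re) := by
      intro x
      rw [ENNReal.ofReal_prod_of_nonneg fun i _ => (hP _).2]
      exact Finset.prod_congr rfl fun i _ => (hP _).1
    simp only [e1]
    have hue : ∀ x, fourSer d L u x = ((fourSer d L u x).re : ℂ) := by
      intro x
      refine Complex.ext (by simp) ?_
      rw [Complex.ofReal_im]
      refine fourSer_im (fun z => ?_) x
      simp only [hu]
      rw [← exp_neg_dispersion_neg hFT]
      congr 3
      ext i
      simp [dualPt, neg_div]
    rw [← ofReal_integral_eq_lintegral_ofReal]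
    · congr 1
      have := integral_prod_fourSer hL π hu0 hu1 hs
      rw [← Complex.ofReal_inj, ← this, ← integral_complex_ofReal]
      refine integral_congr_ae (Eventually.of_forall fun x => ?_)
      simp only [Complex.ofReal_prod, ← hue]
    · refine Integrable.of_bound (C := ((L ^ d)⁻¹ * ∑' z, u z) ^ N) (Continuous.aestronglyMeasurable ?_)
        (Eventually.of_forall fun x => ?_)
      · refine continuous_finsetProd _ fun i _ => Complex.continuous_re.comp (hc.comp ?_)
        fun_prop
      · rw [norm_prod]
        refine (Finset.prod_le_prod (fun _ _ => norm_nonneg _) fun i _ =>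
          (Complex.abs_re_le_norm _).trans (norm_fourSer_le hL hu0 hs _)).trans_eq ?_
        simp
    · exact Eventually.of_forall fun x => Finset.prod_nonneg fun i _ => (hP _).2
  rw [gibbsW, hkey, ENNReal.toReal_mul, ENNReal.toReal_ofReal (by unfold permWeight; positivity),
    ENNReal.toReal_ofReal hT0, permWeight_eq, Multiset.prod_map_mul]

/-- A nonnegative continuous bounded Fourier transform of a continuous integrable function is
integrable. -/
lemma integrable_exp_neg_dispersion {d : ℕ} {f ε : Eu d → ℝ} (hf : Continuous f)
    (hfi : Integrable f)
    (hFT : ∀ k : Eu d, 𝓕 (fun x => (f x : ℂ)) k = (Real.exp (-ε k) : ℂ))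
    (hε0 : ∀ k, 0 ≤ ε k) (hεc : Continuous fun k => Real.exp (-ε k)) :
    Integrable fun k => Real.exp (-ε k) := by
  have hfC : Integrable fun x => (f x : ℂ) := hfi.ofReal
  have h1 := Real.tendsto_integral_gaussian_smul' hfC (v := 0) (by fun_prop)
  have h2 : Tendsto (fun c : ℝ => ((∫ w : Eu d, Real.exp (-c⁻¹ * ‖w‖ ^ 2) * Real.exp (-ε w) : ℝ) : ℂ))
      atTop (𝓝 (f 0 : ℂ)) := by
    refine h1.congr' ?_
    filter_upwards [Ioi_mem_atTop 0] with c (hc : 0 < c)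
    have J : Integrable (fun w : Eu d => Complex.exp (-c⁻¹ * ‖w‖ ^ 2 + 2 * Real.pi * Complex.I * (inner ℝ (0 : Eu d) w : ℝ))) :=
      GaussianFourier.integrable_cexp_neg_mul_sq_norm_add (by simpa) _ _
    have e := VectorFourier.integral_fourierIntegral_smul_eq_flip (L := innerₗ (Eu d))
      Real.continuous_fourierChar continuous_inner J hfC
    have e2 : ∫ w : Eu d, 𝓕 (fun w : Eu d => Complex.exp (-c⁻¹ * ‖w‖ ^ 2 + 2 * Real.pi * Complex.I * (inner ℝ (0 : Eu d) w : ℝ))) w • (f w : ℂ) =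
      ∫ w : Eu d, Complex.exp (-c⁻¹ * ‖w‖ ^ 2 + 2 * Real.pi * Complex.I * (inner ℝ (0 : Eu d) w : ℝ)) • 𝓕 (fun x => (f x : ℂ)) w := by
      simpa using! e
    have e3 : ∫ w : Eu d, (((Real.pi * c : ℂ) ^ (Module.finrank ℝ (Eu d) / 2 : ℂ) * Complex.exp (-Real.pi ^ 2 * c * ‖0 - w‖ ^ 2)) • (f w : ℂ)) =
        ∫ w : Eu d, 𝓕 (fun w : Eu d => Complex.exp (-c⁻¹ * ‖w‖ ^ 2 + 2 * Real.pi * Complex.I * (inner ℝ (0 : Eu d) w : ℝ))) w • (f w : ℂ) := by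
      congr with w
      rw [fourier_gaussian_innerProductSpace' (by simpa)]
      have q1 : (Real.pi / (c⁻¹ : ℝ) : ℂ) = Real.pi * c := by
        rw [Complex.ofReal_inv, div_inv_eq_mul]
      have q2 : (-Real.pi ^ 2 * c * ‖0 - w‖ ^ 2 : ℂ) = -Real.pi ^ 2 * ‖0 - w‖ ^ 2 / (c⁻¹ : ℝ) := by
        rw [Complex.ofReal_inv, div_inv_eq_mul]; ring
      rw [q1, q2]
    rw [e3, e2, ← integral_complex_ofReal]
    refine integral_congr_ae (Eventually.of_forall fun w => ?_)
    simp only [hFT]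
    simp
  have h3 : Tendsto (fun c : ℝ => ∫ w : Eu d, Real.exp (-c⁻¹ * ‖w‖ ^ 2) * Real.exp (-ε w))
      atTop (𝓝 (f 0)) := by
    have := (Complex.continuous_re.tendsto _).comp h2
    simpa [Function.comp_def] using this
  have h4 := h3.comp tendsto_natCast_atTop_atTop
  refine ⟨hεc.aestronglyMeasurable, ?_⟩
  rw [hasFiniteIntegral_iff_ofReal (Eventually.of_forall fun k => (Real.exp_pos _).le)]
  set F : ℕ → Eu d → ℝ≥0∞ := fun n w =>
    ENNReal.ofReal (Real.exp (-(n:ℝ)⁻¹ * ‖w‖ ^ 2) * Real.exp (-ε w)) with hF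
  have hlim : ∀ w, Tendsto (fun n => F n w) atTop (𝓝 (ENNReal.ofReal (Real.exp (-ε w)))) := by
    intro w
    refine ENNReal.tendsto_ofReal ?_
    have : Tendsto (fun n : ℕ => Real.exp (-(n:ℝ)⁻¹ * ‖w‖ ^ 2) * Real.exp (-ε w)) atTop
        (𝓝 (Real.exp (-0 * ‖w‖ ^ 2) * Real.exp (-ε w))) :=
      ((Real.continuous_exp.tendsto _).comp
        ((tendsto_inv_atTop_nhds_zero_nat.neg).mul_const _)).mul_const _
    simpa using this
  have hle : ∫⁻ w, ENNReal.ofReal (Real.exp (-ε w)) ≤ liminf (fun n => ∫⁻ w, F n w) atTop := by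
    calc ∫⁻ w, ENNReal.ofReal (Real.exp (-ε w)) = ∫⁻ w, liminf (fun n => F n w) atTop :=
          lintegral_congr fun w => (hlim w).liminf_eq.symm
      _ ≤ _ := lintegral_liminf_le fun n => by
          refine Measurable.ennreal_ofReal ?_
          exact Measurable.mul (by fun_prop) hεc.measurable
  have heq : ∀ᶠ n : ℕ in atTop, ∫⁻ w, F n w =
      ENNReal.ofReal (∫ w : Eu d, Real.exp (-(n:ℝ)⁻¹ * ‖w‖ ^ 2) * Real.exp (-ε w)) := by
    filter_upwards [eventually_gt_atTop 0] with n hn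
    rw [ofReal_integral_eq_lintegral_ofReal]
    · have J := GaussianFourier.integrable_cexp_neg_mul_sq_norm_add (V := Eu d) (b := ((n:ℝ)⁻¹ : ℂ))
        (by norm_cast; positivity) 0 0
      have J2 : Integrable fun w : Eu d => Real.exp (-(n:ℝ)⁻¹ * ‖w‖ ^ 2) := by
        refine J.norm.congr (Eventually.of_forall fun w => ?_)
        simp only [inner_zero_left, Complex.norm_exp]
        congr 1
        norm_cast
        simp
      refine J2.mono' ((Continuous.aestronglyMeasurable (by fun_prop)).mul hεc.aestronglyMeasurable)
        (Eventually.of_forall fun w => ?_)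
      rw [norm_mul, Real.norm_of_nonneg (Real.exp_pos _).le, Real.norm_of_nonneg (Real.exp_pos _).le]
      exact mul_le_of_le_one_right (Real.exp_pos _).le (Real.exp_le_one_iff.2 (by linarith [hε0 w]))
    · exact Eventually.of_forall fun w => by positivity
  have hl2 : Tendsto (fun n => ∫⁻ w, F n w) atTop (𝓝 (ENNReal.ofReal (f 0))) := by
    refine (ENNReal.tendsto_ofReal h4).congr' ?_
    filter_upwards [heq] with n hn
    rw [hn]; rfl
  rw [hl2.liminf_eq] at hle
  exact hle.trans_lt ENNReal.ofReal_lt_top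

lemma dispersion_zero {d : ℕ} {f ε : Eu d → ℝ} (hf_norm : ∫ x : Eu d, f x = 1)
    (hFT : ∀ k : Eu d, 𝓕 (fun x => (f x : ℂ)) k = (Real.exp (-ε k) : ℂ)) : ε 0 = 0 := by
  have h := hFT 0
  rw [Real.fourier_eq] at h
  simp only [inner_zero_right, neg_zero, AddChar.map_zero_eq_one, one_smul] at h
  rw [integral_complex_ofReal, hf_norm] at h
  have h2 : (1:ℝ) = Real.exp (-ε 0) := by exact_mod_cast h
  have := (Real.exp_eq_one_iff _).1 h2.symm
  linarith

lemma integral_exp_neg_pos {d : ℕ} {ε : Eu d → ℝ}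
    (hi : Integrable fun k => Real.exp (-ε k)) : 0 < ∫ k, Real.exp (-ε k) := by
  rw [integral_pos_iff_support_of_nonneg (fun k => (Real.exp_pos _).le) hi]
  have : (Function.support fun k => Real.exp (-ε k)) = Set.univ := by
    ext k; simp [Real.exp_ne_zero]
  rw [this]
  exact NeZero.pos _

lemma eventually_summable_exp_neg {d : ℕ} {ε : Eu d → ℝ}
    (hi : Integrable fun k => Real.exp (-ε k))
    (hRiemann : Tendsto
      (fun L : ℝ => (L ^ d)⁻¹ * ∑' z : Fin d → ℤ, Real.exp (-ε (dualPt d L z)))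
      atTop (𝓝 (∫ k : Eu d, Real.exp (-ε k)))) :
    ∀ᶠ L in atTop, Summable fun z : Fin d → ℤ => Real.exp (-ε (dualPt d L z)) := by
  filter_upwards [hRiemann.eventually (lt_mem_nhds (integral_exp_neg_pos hi))] with L hL
  by_contra hns
  rw [tsum_eq_zero_of_not_summable hns, mul_zero] at hL
  exact lt_irrefl _ hL

/-- The step function on cells of side `L⁻¹` taking the value of `g` at the lattice point of the
cell. -/
def stepFun (d : ℕ) (g : Eu d → ℝ) (L : ℝ) (x : Eu d) : ℝ :=
  g (dualPt d L fun i => ⌊x i / L⁻¹⌋)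

lemma measurable_stepFun {d : ℕ} (g : Eu d → ℝ) (L : ℝ) : Measurable (stepFun d g L) := by
  have h : Measurable fun z : Fin d → ℤ => g (dualPt d L z) := measurable_of_countable _
  exact h.comp (measurable_pi_lambda _ fun i => by fun_prop)

lemma tendsto_stepFun {d : ℕ} {g : Eu d → ℝ} (hg : Continuous g) (x : Eu d) :
    Tendsto (fun L => stepFun d g L x) atTop (𝓝 (g x)) := by
  refine (hg.tendsto x).comp ?_
  have h : Tendsto (fun L : ℝ => fun i : Fin d => ((⌊x i / L⁻¹⌋ : ℤ) : ℝ) / L) atTop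
      (𝓝 fun i => x i) := by
    refine tendsto_pi_nhds.2 fun i => ?_
    have hs : Tendsto (fun L : ℝ => x i - L⁻¹) atTop (𝓝 (x i)) := by
      simpa using (tendsto_inv_atTop_zero (𝕜 := ℝ)).const_sub (x i)
    refine tendsto_of_tendsto_of_tendsto_of_le_of_le' hs tendsto_const_nhds ?_ ?_
    · filter_upwards [eventually_gt_atTop 0] with L hL
      rw [le_div_iff₀ hL, sub_mul, inv_mul_cancel₀ hL.ne', div_inv_eq_mul]
      exact (Int.sub_one_lt_floor _).le
    · filter_upwards [eventually_gt_atTop 0] with L hL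
      rw [div_le_iff₀ hL, div_inv_eq_mul]
      exact Int.floor_le _
  exact ((PiLp.continuous_toLp 2 _).tendsto _).comp h

lemma lintegral_stepFun {d : ℕ} (g : Eu d → ℝ) {L : ℝ} (hL : 0 < L) :
    ∫⁻ x, ENNReal.ofReal (stepFun d g L x) =
      ENNReal.ofReal (L ^ d)⁻¹ * ∑' z : Fin d → ℤ, ENNReal.ofReal (g (dualPt d L z)) := by
  have hL' : 0 < L⁻¹ := inv_pos.2 hL
  rw [← lintegral_cube_tsum hL' (measurable_stepFun g L).ennreal_ofReal]
  have h : ∀ x : Eu d,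
      ∑' z : Fin d → ℤ, ENNReal.ofReal (stepFun d g L (x - latPt d L⁻¹ z)) =
        ∑' z : Fin d → ℤ, ENNReal.ofReal (g (dualPt d L z)) := by
    intro x
    rw [← (Equiv.subLeft fun i => ⌊x i / L⁻¹⌋).tsum_eq
      fun z : Fin d → ℤ => ENNReal.ofReal (g (dualPt d L z))]
    refine tsum_congr fun z => ?_
    have : (fun i => ⌊(x - latPt d L⁻¹ z) i / L⁻¹⌋) = (Equiv.subLeft fun i => ⌊x i / L⁻¹⌋) z := by
      funext i
      simp only [latPt, PiLp.sub_apply, WithLp.equiv_symm_apply, Equiv.subLeft_apply, Pi.sub_apply,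
        sub_div, mul_div_cancel_left₀ _ hL'.ne', Int.floor_sub_intCast]
    rw [stepFun, this]
  simp only [h, lintegral_const, Measure.restrict_apply_univ, volume_cube d hL', inv_pow]
  rw [mul_comm]

lemma integral_stepFun {d : ℕ} {g : Eu d → ℝ} (hg : ∀ x, 0 ≤ g x) {L : ℝ} (hL : 0 < L)
    (hs : Summable fun z : Fin d → ℤ => g (dualPt d L z)) :
    Integrable (stepFun d g L) ∧
      ∫ x, stepFun d g L x = (L ^ d)⁻¹ * ∑' z : Fin d → ℤ, g (dualPt d L z) := by
  have h := lintegral_stepFun g hL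
  have h0 : ∀ x, 0 ≤ stepFun d g L x := fun x => hg _
  rw [← ENNReal.ofReal_tsum_of_nonneg (fun z => hg _) hs, ← ENNReal.ofReal_mul (by positivity)] at h
  constructor
  · refine ⟨(measurable_stepFun g L).aestronglyMeasurable, ?_⟩
    rw [hasFiniteIntegral_iff_ofReal (Eventually.of_forall h0), h]
    exact ENNReal.ofReal_lt_top
  · rw [integral_eq_lintegral_of_nonneg_ae (Eventually.of_forall h0)
      (measurable_stepFun g L).aestronglyMeasurable, h, ENNReal.toReal_ofReal]
    exact mul_nonneg (by positivity) (tsum_nonneg fun z => hg _)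

/-- Scheffé's lemma for a family indexed by a countably generated filter. -/
lemma tendsto_integral_abs_sub {X ι : Type*} [MeasurableSpace X] {μ : Measure X} {l : Filter ι}
    [l.IsCountablyGenerated] {G : ι → X → ℝ} {g : X → ℝ} (hg : Integrable g μ)
    (hG : ∀ᶠ i in l, Integrable (G i) μ) (hG0 : ∀ i x, 0 ≤ G i x)
    (hlim : ∀ x, Tendsto (fun i => G i x) l (𝓝 (g x)))
    (hintg : Tendsto (fun i => ∫ x, G i x ∂μ) l (𝓝 (∫ x, g x ∂μ))) :
    Tendsto (fun i => ∫ x, |G i x - g x| ∂μ) l (𝓝 0) := by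
  have h1 : Tendsto (fun i => ∫ x, max (g x - G i x) 0 ∂μ) l (𝓝 (∫ _, (0:ℝ) ∂μ)) := by
    refine tendsto_integral_filter_of_dominated_convergence (fun x => |g x|) ?_ ?_ hg.abs ?_
    · filter_upwards [hG] with i hi
      exact (hg.sub hi).pos_part.aestronglyMeasurable
    · refine Eventually.of_forall fun i => Eventually.of_forall fun x => ?_
      rw [Real.norm_of_nonneg (le_max_right _ _)]
      exact max_le (by linarith [hG0 i x, le_abs_self (g x)]) (abs_nonneg _)
    · refine Eventually.of_forall fun x => ?_
      have := ((hlim x).const_sub (g x)).max (tendsto_const_nhds (x := (0:ℝ)))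
      simpa using this
  have h2 : Tendsto (fun i => (∫ x, G i x ∂μ - ∫ x, g x ∂μ) + 2 * ∫ x, max (g x - G i x) 0 ∂μ) l
      (𝓝 0) := by
    have := (hintg.sub_const (∫ x, g x ∂μ)).add (h1.const_mul 2)
    simpa using this
  refine h2.congr' ?_
  filter_upwards [hG] with i hi
  have hsub : Integrable (fun x => G i x - g x) μ := hi.sub hg
  have hpos : Integrable (fun x => max (g x - G i x) 0) μ := (hg.sub hi).pos_part
  rw [← integral_sub hi hg, ← integral_const_mul, ← integral_add hsub (hpos.const_mul 2)]
  refine integral_congr_ae (Eventually.of_forall fun x => ?_)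
  dsimp only
  rcases le_total (G i x) (g x) with h | h
  · rw [max_eq_left (by linarith), abs_of_nonpos (by linarith)]; ring
  · rw [max_eq_right (by linarith), abs_of_nonneg (by linarith)]; ring

/-- Convergence of the Riemann sums of an integrable function with values in `[0, 1]` entails that
of its powers. -/
lemma tendsto_riemannSum_pow {d : ℕ} {g : Eu d → ℝ} (hgc : Continuous g) (hgi : Integrable g)
    (hg0 : ∀ x, 0 ≤ g x) (hg1 : ∀ x, g x ≤ 1)
    (hs : ∀ᶠ L in atTop, Summable fun z : Fin d → ℤ => g (dualPt d L z))
    (hR : Tendsto (fun L : ℝ => (L ^ d)⁻¹ * ∑' z : Fin d → ℤ, g (dualPt d L z)) atTop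
      (𝓝 (∫ k, g k))) {j : ℕ} (hj : 1 ≤ j) :
    Tendsto (fun L : ℝ => (L ^ d)⁻¹ * ∑' z : Fin d → ℤ, g (dualPt d L z) ^ j) atTop
      (𝓝 (∫ k, g k ^ j)) := by
  have hev : ∀ᶠ L in atTop, Integrable (stepFun d g L) ∧
      ∫ x, stepFun d g L x = (L ^ d)⁻¹ * ∑' z : Fin d → ℤ, g (dualPt d L z) := by
    filter_upwards [hs, eventually_gt_atTop 0] with L h hL using integral_stepFun hg0 hL h
  have hple : ∀ x, g x ^ j ≤ g x := fun x => pow_le_of_le_one (hg0 x) (hg1 x) (by omega)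
  have hevj : ∀ᶠ L in atTop, Integrable (stepFun d (fun x => g x ^ j) L) ∧
      ∫ x, stepFun d (fun x => g x ^ j) L x =
        (L ^ d)⁻¹ * ∑' z : Fin d → ℤ, g (dualPt d L z) ^ j := by
    filter_upwards [hs, eventually_gt_atTop 0] with L h hL
    exact integral_stepFun (fun x => pow_nonneg (hg0 x) j) hL
      (Summable.of_nonneg_of_le (fun z => pow_nonneg (hg0 _) j) (fun z => hple _) h)
  have hgij : Integrable fun k => g k ^ j :=
    hgi.mono' (hgc.pow j).aestronglyMeasurable (Eventually.of_forall fun x => by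
      rw [Real.norm_of_nonneg (pow_nonneg (hg0 x) j)]; exact hple x)
  have hS := tendsto_integral_abs_sub hgi (hev.mono fun L h => h.1) (fun L x => hg0 _)
    (tendsto_stepFun hgc) (hR.congr' (hev.mono fun L h => h.2.symm))
  have key : Tendsto (fun L => ∫ x, stepFun d (fun x => g x ^ j) L x) atTop (𝓝 (∫ k, g k ^ j)) := by
    rw [tendsto_iff_norm_sub_tendsto_zero]
    refine squeeze_zero' (Eventually.of_forall fun L => norm_nonneg _) ?_
      (by simpa using hS.const_mul (j : ℝ))
    filter_upwards [hev, hevj] with L h hjL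
    rw [← integral_sub hjL.1 hgij, ← integral_const_mul]
    refine (norm_integral_le_integral_norm _).trans
      (integral_mono (hjL.1.sub hgij).norm ((h.1.sub hgi).abs.const_mul _) fun x => ?_)
    have := abs_pow_sub_pow_le (stepFun d g L x) (g x) j
    refine this.trans ?_
    have ha : ∀ y, |g y| ≤ 1 := fun y => by rw [abs_of_nonneg (hg0 y)]; exact hg1 y
    have hm : max |stepFun d g L x| |g x| ≤ 1 := max_le (ha _) (ha _)
    have h0 : 0 ≤ max |stepFun d g L x| |g x| := le_max_of_le_left (abs_nonneg _)
    calc _ ≤ |stepFun d g L x - g x| * j * 1 :=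
          mul_le_mul_of_nonneg_left (pow_le_one₀ h0 hm) (by positivity)
      _ = _ := by ring
  exact key.congr' (hevj.mono fun L h => h.2)

/-- The contribution of the nonzero dual lattice points to `∑_k e^{-jε(k)}`. -/
def excSum (d : ℕ) (ε : Eu d → ℝ) (L : ℝ) (j : ℕ) : ℝ :=
  ∑' z : Fin d → ℤ, if z = 0 then 0 else Real.exp (-ε (dualPt d L z)) ^ j

lemma excSum_nonneg (d : ℕ) (ε : Eu d → ℝ) (L : ℝ) (j : ℕ) : 0 ≤ excSum d ε L j :=
  tsum_nonneg fun z => by split_ifs <;> positivity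

lemma sum_rpow_neg_le {s : ℝ} (hs0 : 0 ≤ s) (hs1 : s < 1) (n : ℕ) :
    ∑ i ∈ Finset.range n, ((i : ℝ) + 1) ^ (-s) ≤ (n : ℝ) ^ (1 - s) / (1 - s) := by
  induction n with
  | zero => simp [Real.zero_rpow (sub_pos.2 hs1).ne']
  | succ n ih =>
    rw [Finset.sum_range_succ]
    have h1s : 0 < 1 - s := sub_pos.2 hs1
    have hn : (0:ℝ) < n + 1 := by positivity
    have hb := rpow_one_add_le_one_add_mul_self (s := -(1 / ((n:ℝ) + 1))) (p := 1 - s)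
      (by rw [neg_le_neg_iff, div_le_one hn]; linarith [(Nat.cast_nonneg n : (0:ℝ) ≤ n)])
      h1s.le (by linarith)
    have e : 1 + -(1 / ((n:ℝ) + 1)) = n / (n + 1) := by field_simp; ring
    rw [e, Real.div_rpow (Nat.cast_nonneg n) hn.le, div_le_iff₀ (by positivity)] at hb
    have e2 : ((n:ℝ) + 1) ^ (1 - s) = (n + 1) * ((n:ℝ) + 1) ^ (-s) := by
      rw [sub_eq_add_neg, Real.rpow_add hn, Real.rpow_one]
    have hx : 0 < ((n:ℝ) + 1) ^ (-s) := Real.rpow_pos_of_pos hn _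
    push_cast
    rw [le_div_iff₀ h1s] at ih ⊢
    have e3 : (1 + (1 - s) * -(1 / ((n:ℝ) + 1))) * ((n:ℝ) + 1) ^ (1 - s) =
        ((n:ℝ) + 1) ^ (1 - s) - (1 - s) * ((n:ℝ) + 1) ^ (-s) := by
      rw [e2]; field_simp; ring
    rw [e3] at hb
    nlinarith

lemma sum_Icc_natAbs_le {h : ℕ → ℝ} (hh : ∀ i, 0 ≤ h i) (M : ℕ) :
    ∑ n ∈ Finset.Icc (-(M:ℤ)) M, h n.natAbs ≤ 2 * ∑ i ∈ Finset.range (M + 1), h i := by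
  have hsub : Finset.Icc (-(M:ℤ)) M ⊆ (Finset.range (M + 1)).image (fun i : ℕ => (i:ℤ)) ∪
      (Finset.range (M + 1)).image (fun i : ℕ => -(i:ℤ)) := by
    intro n hn
    rw [Finset.mem_Icc] at hn
    simp only [Finset.mem_union, Finset.mem_image, Finset.mem_range]
    rcases le_total 0 n with h | h
    · exact Or.inl ⟨n.natAbs, by omega, by omega⟩
    · exact Or.inr ⟨n.natAbs, by omega, by omega⟩
  have h0 : ∀ n : ℤ, 0 ≤ h n.natAbs := fun n => hh _
  refine (Finset.sum_le_sum_of_subset_of_nonneg hsub fun n _ _ => h0 n).trans ?_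
  have hu := Finset.sum_union_inter (f := fun n : ℤ => h n.natAbs)
    (s₁ := (Finset.range (M + 1)).image (fun i : ℕ => (i:ℤ)))
    (s₂ := (Finset.range (M + 1)).image (fun i : ℕ => -(i:ℤ)))
  have hi := Finset.sum_nonneg (f := fun n : ℤ => h n.natAbs)
    (s := (Finset.range (M + 1)).image (fun i : ℕ => (i:ℤ)) ∩
      (Finset.range (M + 1)).image (fun i : ℕ => -(i:ℤ))) fun n _ => h0 n
  rw [Finset.sum_image (f := fun n : ℤ => h n.natAbs) (fun i _ j _ hij => by simpa using hij),
    Finset.sum_image (f := fun n : ℤ => h n.natAbs) (fun i _ j _ hij => by simpa using hij)] at hu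
  simp only [Int.natAbs_natCast, Int.natAbs_neg] at hu
  linarith

lemma exp_neg_le_rpow {p x : ℝ} (hp : 0 < p) (hx : 0 < x) :
    Real.exp (-x) ≤ (x / p) ^ (-p) := by
  have h : x / p ≤ Real.exp (x / p) := by linarith [Real.add_one_le_exp (x / p)]
  have h2 := Real.rpow_le_rpow (by positivity) h hp.le
  rw [← Real.exp_mul, div_mul_cancel₀ _ hp.ne'] at h2
  rw [Real.exp_neg, Real.rpow_neg (by positivity)]
  exact inv_anti₀ (by positivity) h2

lemma abs_le_norm_dualPt {d : ℕ} {L : ℝ} (hL : 0 < L) (z : Fin d → ℤ) (i : Fin d) :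
    |(z i : ℝ)| / L ≤ ‖dualPt d L z‖ := by
  have h := PiLp.norm_apply_le (dualPt d L z) i
  simp only [dualPt, WithLp.equiv_symm_apply, Real.norm_eq_abs, abs_div, abs_of_pos hL] at h ⊢
  exact h

lemma one_add_abs_le_norm_dualPt {d : ℕ} {L : ℝ} (hL : 0 < L) {z : Fin d → ℤ} (hz : z ≠ 0)
    (i : Fin d) : ((z i).natAbs + 1 : ℝ) / (2 * L) ≤ ‖dualPt d L z‖ ∧ L⁻¹ ≤ ‖dualPt d L z‖ := by
  obtain ⟨i₀, hi₀⟩ : ∃ i, z i ≠ 0 := by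
    by_contra! h; exact hz (funext h)
  have h1 := abs_le_norm_dualPt hL z i
  have h2 := abs_le_norm_dualPt hL z i₀
  have h3 : (1:ℝ) ≤ |(z i₀ : ℝ)| := by exact_mod_cast Int.one_le_abs hi₀
  rw [div_le_iff₀ hL] at h1 h2
  have e : ((z i).natAbs : ℝ) = |(z i : ℝ)| := by
    rw [Nat.cast_natAbs, Int.cast_abs]
  rw [div_le_iff₀ (by positivity), inv_le_iff_one_le_mul₀ hL, e]
  constructor <;> nlinarith

/-- The sum of `∏ᵢ ((|zᵢ| + 1) / (2 * L))^{-s}` over the points `z` of the box of half-side `L`. -/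
lemma sum_box_le {d : ℕ} {s L : ℝ} (hs0 : 0 ≤ s) (hs1 : s < 1) (hL : 1 ≤ L) :
    ∑ z ∈ Fintype.piFinset fun _ : Fin d => Finset.Icc (-(⌊L⌋₊:ℤ)) ⌊L⌋₊,
      ∏ i, (((z i).natAbs + 1 : ℝ) / (2 * L)) ^ (-s) ≤ (4 / (1 - s)) ^ d * L ^ d := by
  rw [← Finset.prod_univ_sum (fun _ : Fin d => Finset.Icc (-(⌊L⌋₊:ℤ)) ⌊L⌋₊)
    (fun _ n => ((n.natAbs + 1 : ℝ) / (2 * L)) ^ (-s)), ← mul_pow]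
  rw [Finset.prod_const, Finset.card_univ, Fintype.card_fin]
  have h1s : 0 < 1 - s := sub_pos.2 hs1
  refine pow_le_pow_left₀ (Finset.sum_nonneg fun n _ => by positivity) ?_ d
  refine (sum_Icc_natAbs_le (h := fun i : ℕ => ((i + 1 : ℝ) / (2 * L)) ^ (-s))
    (fun i => by positivity) ⌊L⌋₊).trans ?_
  have e : ∀ i : ℕ, ((i + 1 : ℝ) / (2 * L)) ^ (-s) = (2 * L) ^ s * ((i:ℝ) + 1) ^ (-s) := by
    intro i
    rw [Real.div_rpow (by positivity) (by positivity), Real.rpow_neg (x := 2 * L) (by positivity),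
      div_inv_eq_mul, mul_comm]
  simp only [e]
  rw [← Finset.mul_sum]
  have hM : ((⌊L⌋₊ + 1 : ℕ) : ℝ) ≤ 2 * L := by
    push_cast
    linarith [Nat.floor_le (by linarith : 0 ≤ L)]
  calc 2 * ((2 * L) ^ s * ∑ i ∈ Finset.range (⌊L⌋₊ + 1), ((i:ℝ) + 1) ^ (-s))
      ≤ 2 * ((2 * L) ^ s * ((2 * L) ^ (1 - s) / (1 - s))) := by
        have h := sum_rpow_neg_le hs0 hs1 (⌊L⌋₊ + 1)
        have h2 := Real.rpow_le_rpow (by positivity) hM h1s.le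
        have h3 : ((⌊L⌋₊ + 1 : ℕ) : ℝ) ^ (1 - s) / (1 - s) ≤ (2 * L) ^ (1 - s) / (1 - s) := by
          gcongr
        have := h.trans h3
        gcongr
    _ = 2 * ((2 * L) ^ (s + (1 - s)) / (1 - s)) := by
        rw [Real.rpow_add (by positivity)]; ring
    _ = 4 / (1 - s) * L := by rw [add_sub_cancel, Real.rpow_one]; ring

/-- Uniform exponential decay in the cycle length of the lattice sums over nonzero momenta. -/
theorem exists_excSum_bound {d : ℕ} {ε : Eu d → ℝ}
    {a η : ℝ} (ha : 0 < a) (hη : 0 < η) (hηd : η < d)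
    (hlow : ∀ k : Eu d, ‖k‖ ≤ 1 → a * ‖k‖ ^ η ≤ ε k)
    {c₁ : ℝ} (hc₁ : 0 < c₁) (hfar : ∀ k : Eu d, 1 ≤ ‖k‖ → c₁ ≤ ε k)
    (hs : ∀ᶠ L in atTop, Summable fun z : Fin d → ℤ => Real.exp (-ε (dualPt d L z)))
    {I : ℝ} (hR : Tendsto
      (fun L : ℝ => (L ^ d)⁻¹ * ∑' z : Fin d → ℤ, Real.exp (-ε (dualPt d L z))) atTop (𝓝 I)) :
    ∃ D : ℕ → ℝ, Summable D ∧ ∀ᶠ L : ℝ in atTop, ∀ j : ℕ, 1 ≤ j →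
      excSum d ε L j * Real.exp (a / 2 * L ^ (-η) * j) ≤ L ^ d * D j := by
  have hd0 : (0:ℝ) < d := hη.trans hηd
  have hdη : 1 < d / η := (one_lt_div hη).2 hηd
  set p : ℝ := (1 + d / η) / 2 with hp
  have hp1 : 1 < p := by rw [hp]; linarith
  have hp0 : 0 < p := by linarith
  set s : ℝ := p * η / d with hsdef
  have hs0 : 0 ≤ s := by positivity
  have hs1 : s < 1 := by
    rw [hsdef, div_lt_one hd0, ← lt_div_iff₀ hη, hp]; linarith
  have hsd : s * d = p * η := by rw [hsdef]; field_simp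
  set C₁ : ℝ := (a / (2 * p)) ^ (-p) with hC₁
  refine ⟨fun j => C₁ * (4 / (1 - s)) ^ d * (j:ℝ) ^ (-p) +
    Real.exp 1 * (I + 1) * Real.exp (-(c₁ / 2)) ^ (j - 1), ?_, ?_⟩
  · refine ((Real.summable_nat_rpow.2 (by linarith)).mul_left _).add (Summable.mul_left _ ?_)
    rw [← summable_nat_add_iff 1]
    simpa using! summable_geometric_of_lt_one (Real.exp_pos _).le
      (Real.exp_lt_one_iff.2 (neg_lt_zero.2 (half_pos hc₁)))
  have hτ0 : Tendsto (fun L : ℝ => a / 2 * L ^ (-η)) atTop (𝓝 0) := by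
    simpa using (tendsto_rpow_neg_atTop hη).const_mul (a / 2)
  filter_upwards [hs, hR.eventually_lt_const (by linarith : I < I + 1), eventually_ge_atTop 1,
    hτ0.eventually_lt_const one_pos, hτ0.eventually_lt_const (half_pos hc₁)] with L hsum hRL hL hτ1 hτc
  intro j hj
  have hL0 : 0 < L := by linarith
  have hj0 : (0:ℝ) < j := by exact_mod_cast hj
  set τ : ℝ := a / 2 * L ^ (-η) with hτ
  set P := Fintype.piFinset fun _ : Fin d => Finset.Icc (-(⌊L⌋₊:ℤ)) ⌊L⌋₊ with hP
  set W : (Fin d → ℤ) → ℝ := fun z =>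
    if z ∈ P then C₁ * (j:ℝ) ^ (-p) * ∏ i, (((z i).natAbs + 1 : ℝ) / (2 * L)) ^ (-s) else 0 with hW
  have hWs : HasSum W (∑ z ∈ P, C₁ * (j:ℝ) ^ (-p) * ∏ i, (((z i).natAbs + 1 : ℝ) / (2 * L)) ^ (-s)) := by
    have h1 : HasSum W (∑ z ∈ P, W z) := hasSum_sum_of_ne_finset_zero fun z hz => if_neg hz
    rwa [Finset.sum_congr rfl fun z hz => if_pos hz] at h1
  have hW0 : ∀ z, 0 ≤ W z := fun z => by simp only [hW]; split_ifs <;> positivity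
  set K : ℝ := Real.exp 1 * Real.exp (-(c₁ / 2)) ^ (j - 1) with hK
  have hpt : ∀ z : Fin d → ℤ, (if z = 0 then 0 else Real.exp (-ε (dualPt d L z)) ^ j) *
      Real.exp (τ * j) ≤ W z + K * Real.exp (-ε (dualPt d L z)) := by
    intro z
    split_ifs with hz
    · rw [zero_mul]
      exact add_nonneg (hW0 z) (by positivity)
    rw [← Real.exp_nat_mul, ← Real.exp_add]
    set k := dualPt d L z with hk
    have hi0 : Nonempty (Fin d) := ⟨⟨0, by exact_mod_cast hd0⟩⟩
    obtain ⟨i₀⟩ := hi0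
    have hkL := (one_add_abs_le_norm_dualPt hL0 hz i₀).2
    have hk0 : 0 < ‖k‖ := (inv_pos.2 hL0).trans_le hkL
    rcases le_or_gt ‖k‖ 1 with h1 | h1
    · have hzP : z ∈ P := by
        rw [hP, Fintype.mem_piFinset]
        intro i
        have hi := (abs_le_norm_dualPt hL0 z i).trans h1
        rw [div_le_one hL0] at hi
        have : (z i).natAbs ≤ ⌊L⌋₊ := Nat.le_floor (by rwa [Nat.cast_natAbs, Int.cast_abs])
        rw [Finset.mem_Icc]; omega
      refine le_trans ?_ (le_add_of_nonneg_right (by positivity))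
      rw [hW]
      simp only [hzP, if_true]
      have hτk : τ ≤ a / 2 * ‖k‖ ^ η := by
        rw [hτ, Real.rpow_neg hL0.le, ← Real.inv_rpow hL0.le]
        gcongr
      have hx : 0 < a / 2 * ‖k‖ ^ η * j := by positivity
      calc Real.exp (j * -ε k + τ * j) ≤ Real.exp (-(a / 2 * ‖k‖ ^ η * j)) := by
            refine Real.exp_le_exp.2 ?_
            nlinarith [hlow k h1]
        _ ≤ (a / 2 * ‖k‖ ^ η * j / p) ^ (-p) := exp_neg_le_rpow hp0 hx
        _ = (a / (2 * p) * j * ‖k‖ ^ η) ^ (-p) := by congr 1; field_simp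
        _ = C₁ * (j:ℝ) ^ (-p) * ∏ i : Fin d, ‖k‖ ^ (-s) := by
            rw [Real.mul_rpow (by positivity) (by positivity), Real.mul_rpow (by positivity)
              (by positivity), ← Real.rpow_mul hk0.le, Finset.prod_const, Finset.card_univ,
              Fintype.card_fin, ← Real.rpow_mul_natCast hk0.le]
            congr 2
            linarith
        _ ≤ _ := by
            refine mul_le_mul_of_nonneg_left (Finset.prod_le_prod (fun i _ => by positivity)
              fun i _ => ?_) (by positivity)
            exact Real.rpow_le_rpow_of_nonpos (by positivity)
              (one_add_abs_le_norm_dualPt hL0 hz i).1 (neg_nonpos.2 hs0)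
    · refine le_trans ?_ (le_add_of_nonneg_left (hW0 z))
      rw [hK, ← Real.exp_nat_mul, ← Real.exp_add, ← Real.exp_add, Real.exp_le_exp,
        Nat.cast_sub hj]
      push_cast
      have := hfar k h1.le
      have hj1 : (0:ℝ) ≤ j - 1 := by rw [sub_nonneg]; exact_mod_cast hj
      nlinarith
  have hT : Summable fun z => W z + K * Real.exp (-ε (dualPt d L z)) :=
    hWs.summable.add (hsum.mul_left _)
  have hle : excSum d ε L j * Real.exp (τ * j) ≤
      ∑' z, (W z + K * Real.exp (-ε (dualPt d L z))) := by
    rw [excSum, ← tsum_mul_right]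
    exact Summable.tsum_le_tsum hpt (Summable.of_nonneg_of_le (fun z => by split_ifs <;> positivity) hpt hT) hT
  refine hle.trans ?_
  rw [hWs.summable.tsum_add (hsum.mul_left _), hWs.tsum_eq, tsum_mul_left, ← Finset.mul_sum]
  have hbox := sum_box_le (d := d) hs0 hs1 hL
  have hRL' : ∑' z : Fin d → ℤ, Real.exp (-ε (dualPt d L z)) ≤ L ^ d * (I + 1) := by
    rw [inv_mul_lt_iff₀ (by positivity)] at hRL
    exact hRL.le
  calc _ ≤ C₁ * (j:ℝ) ^ (-p) * ((4 / (1 - s)) ^ d * L ^ d) + K * (L ^ d * (I + 1)) := by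
        have : 0 < K := by positivity
        gcongr
    _ = _ := by rw [hK]; ring

lemma abs_exp_sub_one_le (x : ℝ) : |Real.exp x - 1| ≤ |x| * Real.exp |x| := by
  have h1 := Real.add_one_le_exp x
  have h2 := Real.add_one_le_exp (-x)
  rcases le_total 0 x with h | h
  · rw [abs_of_nonneg (by linarith), abs_of_nonneg h]
    have h3 : Real.exp (-x) * Real.exp x = 1 := by rw [← Real.exp_add]; simp
    nlinarith [Real.exp_pos x]
  · rw [abs_of_nonpos (by simpa using h), abs_of_nonpos h]
    nlinarith [Real.one_le_exp (neg_nonneg.2 h)]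

lemma tendsto_exp_sub_one_div {ι : Type*} {l : Filter ι} {u : ι → ℝ} (hu : Tendsto u l (𝓝 0))
    (hu0 : ∀ᶠ i in l, u i ≠ 0) : Tendsto (fun i => (Real.exp (u i) - 1) / u i) l (𝓝 1) := by
  have h := (Real.hasDerivAt_exp 0).tendsto_slope_zero
  simp only [zero_add, Real.exp_zero, smul_eq_mul] at h
  refine (h.comp (tendsto_nhdsWithin_iff.2 ⟨hu, hu0⟩)).congr fun i => ?_
  rw [Function.comp, div_eq_inv_mul]

/-- Cycle weights `s L j` proportional to the volume `L ^ d`, with an exponential cutoff at cycle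
lengths of order `L ^ η`. -/
structure VolumeWeights (d : ℕ) (η κ : ℝ) (s : ℝ → ℕ → ℝ) (I D : ℕ → ℝ) : Prop where
  pos : 0 < η
  lt_dim : η < d
  rate_pos : 0 < κ
  nonneg : ∀ L j, 0 ≤ s L j
  tendsto : ∀ j, 1 ≤ j → Tendsto (fun L => (L ^ d)⁻¹ * s L j) atTop (𝓝 (I j))
  summable : Summable D
  bound_nonneg : ∀ j, 0 ≤ D j
  bound : ∀ᶠ L : ℝ in atTop, ∀ j : ℕ, 1 ≤ j → s L j * Real.exp (κ * L ^ (-η) * j) ≤ L ^ d * D j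

namespace VolumeWeights

variable {d : ℕ} {η κ B : ℝ} {s : ℝ → ℕ → ℝ} {I D b : ℕ → ℝ}

lemma tendsto_rate (h : VolumeWeights d η κ s I D) :
    Tendsto (fun L : ℝ => κ * L ^ (-η)) atTop (𝓝 0) := by
  simpa using (tendsto_rpow_neg_atTop h.pos).const_mul κ

lemma term_mul_exp_le (h : VolumeWeights d η κ s I D) (hb0 : ∀ j, 0 ≤ b j) (hbB : ∀ j, b j ≤ B) :
    ∀ᶠ L : ℝ in atTop, ∀ j : ℕ,
      b j * s L j / j * Real.exp (κ * L ^ (-η) * j) ≤ L ^ d * (B * D j) := by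
  filter_upwards [h.bound, eventually_gt_atTop 0] with L hL hL0 j
  have hB0 : 0 ≤ B := (hb0 0).trans (hbB 0)
  rcases Nat.eq_zero_or_pos j with rfl | hj
  · simp only [Nat.cast_zero, _root_.div_zero, zero_mul]
    have := h.bound_nonneg 0
    positivity
  have hj1 : (1:ℝ) ≤ j := by exact_mod_cast hj
  have hs := h.nonneg L j
  calc b j * s L j / j * Real.exp (κ * L ^ (-η) * j)
      ≤ b j * s L j * Real.exp (κ * L ^ (-η) * j) := by
        gcongr
        exact div_le_self (mul_nonneg (hb0 j) hs) hj1
    _ = b j * (s L j * Real.exp (κ * L ^ (-η) * j)) := by ring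
    _ ≤ B * (L ^ d * D j) := by
        have := hL j hj
        have := hb0 j
        have := hbB j
        gcongr
    _ = _ := by ring

lemma term_nonneg (h : VolumeWeights d η κ s I D) (hb0 : ∀ j, 0 ≤ b j) (L : ℝ) (j : ℕ) :
    0 ≤ b j * s L j / j :=
  div_nonneg (mul_nonneg (hb0 j) (h.nonneg L j)) (Nat.cast_nonneg j)

lemma term_mul_exp_le_of_sign (h : VolumeWeights d η κ s I D) (hb0 : ∀ j, 0 ≤ b j)
    {L : ℝ} (hL : 0 < L) {X : ℕ → ℝ}
    (hX : ∀ j : ℕ, b j * s L j / j * Real.exp (κ * L ^ (-η) * j) ≤ X j) {u : ℝ} (hu : u ≤ 1) (j : ℕ) :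
    b j * s L j / j * Real.exp (u * (κ * L ^ (-η)) * j) ≤ X j := by
  refine le_trans ?_ (hX j)
  have := h.rate_pos
  refine mul_le_mul_of_nonneg_left (Real.exp_le_exp.2 ?_) (h.term_nonneg hb0 L j)
  exact mul_le_mul_of_nonneg_right (mul_le_of_le_one_left (by positivity) hu) (Nat.cast_nonneg j)

lemma summable_term (h : VolumeWeights d η κ s I D) (hb0 : ∀ j, 0 ≤ b j) (hbB : ∀ j, b j ≤ B) :
    ∀ᶠ L : ℝ in atTop, ∀ u : ℝ, u ≤ 1 →
      Summable fun j : ℕ => b j * s L j / j * Real.exp (u * (κ * L ^ (-η)) * j) := by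
  filter_upwards [h.term_mul_exp_le hb0 hbB, eventually_gt_atTop 0] with L hL hL0 u hu
  exact Summable.of_nonneg_of_le
    (fun j => mul_nonneg (h.term_nonneg hb0 L j) (Real.exp_pos _).le)
    (h.term_mul_exp_le_of_sign hb0 hL0 hL hu) ((h.summable.mul_left B).mul_left (L ^ d))

/-- The derivative at zero of the logarithmic moment generating function. -/
lemma tendsto_logMGF (h : VolumeWeights d η κ s I D) (hb0 : ∀ j, 0 ≤ b j) (hbB : ∀ j, b j ≤ B)
    {u : ℝ} (hu : |u| = 1) :
    Tendsto (fun L : ℝ => (κ * L ^ (-η) * L ^ d)⁻¹ *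
        ∑' j : ℕ, b j * s L j / j * (Real.exp (u * (κ * L ^ (-η)) * j) - 1)) atTop
      (𝓝 (u * ∑' j : ℕ, b (j + 1) * I (j + 1))) := by
  have hu0 : u ≠ 0 := by rintro rfl; simp at hu
  set g : ℕ → ℝ := fun j => if j = 0 then 0 else u * (b j * I j) with hg
  have hbd : ∀ᶠ L : ℝ in atTop, ∀ j : ℕ,
      ‖(κ * L ^ (-η) * L ^ d)⁻¹ * (b j * s L j / j * (Real.exp (u * (κ * L ^ (-η)) * j) - 1))‖ ≤
        B * D j := by
    filter_upwards [h.bound, eventually_gt_atTop 0] with L hL hL0 j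
    have hκ := h.rate_pos
    have hB0 : 0 ≤ B := (hb0 0).trans (hbB 0)
    rcases Nat.eq_zero_or_pos j with rfl | hj
    · simpa using mul_nonneg hB0 (h.bound_nonneg 0)
    have hj0 : (0:ℝ) < j := by exact_mod_cast hj
    set τ := κ * L ^ (-η) with hτ
    have hτ0 : 0 < τ := by positivity
    have e1 := abs_exp_sub_one_le (u * τ * j)
    rw [abs_mul, abs_mul, hu, one_mul, abs_of_pos hτ0, abs_of_pos hj0] at e1
    have hs := h.nonneg L j
    rw [norm_mul, norm_mul, Real.norm_of_nonneg (h.term_nonneg hb0 L j), Real.norm_of_nonneg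
      (inv_nonneg.2 (by positivity)), Real.norm_eq_abs]
    calc (τ * L ^ d)⁻¹ * (b j * s L j / j * |Real.exp (u * τ * j) - 1|)
        ≤ (τ * L ^ d)⁻¹ * (b j * s L j / j * (τ * j * Real.exp (τ * j))) :=
          mul_le_mul_of_nonneg_left (mul_le_mul_of_nonneg_left e1 (h.term_nonneg hb0 L j))
            (by positivity)
      _ = b j * ((L ^ d)⁻¹ * (s L j * Real.exp (τ * j))) := by field_simp
      _ ≤ B * ((L ^ d)⁻¹ * (L ^ d * D j)) := by
          have := hL j hj
          have := hb0 j
          have := hbB j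
          gcongr
      _ = B * D j := by field_simp
  have hpt : ∀ j : ℕ, Tendsto (fun L : ℝ => (κ * L ^ (-η) * L ^ d)⁻¹ *
      (b j * s L j / j * (Real.exp (u * (κ * L ^ (-η)) * j) - 1))) atTop (𝓝 (g j)) := by
    intro j
    rcases Nat.eq_zero_or_pos j with rfl | hj
    · simp [hg]
    have hj0 : (0:ℝ) < j := by exact_mod_cast hj
    have hw : Tendsto (fun L : ℝ => u * (κ * L ^ (-η)) * j) atTop (𝓝 0) := by
      simpa using (h.tendsto_rate.const_mul u).mul_const (j:ℝ)
    have hκ := h.rate_pos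
    have h1 := tendsto_exp_sub_one_div hw (by
      filter_upwards [eventually_gt_atTop 0] with L hL0
      have : 0 < κ * L ^ (-η) := by positivity
      positivity)
    have h2 := ((h.tendsto j hj).const_mul (b j)).mul (h1.const_mul u)
    have e : g j = b j * I j * (u * 1) := by simp only [hg, hj.ne', if_false]; ring
    rw [e]
    refine h2.congr' ?_
    filter_upwards [eventually_gt_atTop 0] with L hL0
    have : 0 < κ * L ^ (-η) := by positivity
    field_simp
  have hT := tendsto_tsum_of_dominated_convergence (h.summable.mul_left B) hpt hbd
  have hgs : Summable g := by
    refine Summable.of_norm_bounded (h.summable.mul_left B) fun j => ?_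
    exact le_of_tendsto (hpt j).norm (hbd.mono fun L hL => hL j)
  rw [hgs.tsum_eq_zero_add] at hT
  simp only [hg, if_true, Nat.succ_ne_zero, if_false, zero_add, tsum_mul_left] at hT
  exact hT

end VolumeWeights

namespace VolumeWeights

variable {d : ℕ} {η κ B : ℝ} {s : ℝ → ℕ → ℝ} {I D b : ℕ → ℝ}

lemma hasSum_cycGen_tilt (h : VolumeWeights d η κ s I D) (hb0 : ∀ j, 0 ≤ b j)
    (hbB : ∀ j, b j ≤ B) :
    ∀ᶠ L : ℝ in atTop, ∀ u : ℝ, u ≤ 1 →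
      HasSum (fun x : ℕ => cycGen (fun j => b j * s L j) x * Real.exp (u * (κ * L ^ (-η)) * x))
        (Real.exp (∑' j : ℕ, b j * s L j / j) * Real.exp
          (∑' j : ℕ, b j * s L j / j * (Real.exp (u * (κ * L ^ (-η)) * j) - 1))) := by
  filter_upwards [h.summable_term hb0 hbB] with L hL u hu
  set τ := u * (κ * L ^ (-η)) with hτ
  have hpow : ∀ j : ℕ, Real.exp τ ^ j = Real.exp (τ * j) := fun j => by
    rw [← Real.exp_nat_mul, mul_comm]
  have h0 : Summable fun j : ℕ => b j * s L j / j := by simpa using hL 0 zero_le_one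
  have h1 := (hasSum_cycGen (c := fun j => b j * s L j * Real.exp τ ^ j) ?_).1
  · rw [← Real.exp_add, ← h0.tsum_add (by simpa [mul_sub] using (hL u hu).sub h0)]
    convert h1 using 2
    · rw [cycGen_mul_pow, hpow]
    · refine tsum_congr fun j => ?_
      rw [hpow]; ring
  · refine (hL u hu).congr fun j => ?_
    rw [abs_of_nonneg (mul_nonneg (mul_nonneg (hb0 j) (h.nonneg L j)) (by positivity)), hpow]
    ring

lemma hasSum_cycGen_weights (h : VolumeWeights d η κ s I D) (hb0 : ∀ j, 0 ≤ b j)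
    (hbB : ∀ j, b j ≤ B) :
    ∀ᶠ L : ℝ in atTop,
      HasSum (cycGen fun j => b j * s L j) (Real.exp (∑' j : ℕ, b j * s L j / j)) := by
  filter_upwards [h.hasSum_cycGen_tilt hb0 hbB] with L hL
  simpa using hL 0 zero_le_one

/-- Chernoff bound for the number of particles in nonzero momenta. -/
lemma tsum_deviation_le (h : VolumeWeights d η κ s I D) (hb0 : ∀ j, 0 ≤ b j)
    (hbB : ∀ j, b j ≤ B) {δ : ℝ} (hδ : 0 < δ) :
    ∀ᶠ L : ℝ in atTop,
      ∑' x : ℕ, (if |(x:ℝ) - (∑' j : ℕ, b (j + 1) * I (j + 1)) * L ^ d| ≤ δ * L ^ d then 0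
        else cycGen (fun j => b j * s L j) x) ≤
      2 * Real.exp (-(δ / 2 * (κ * L ^ (-η) * L ^ d))) * Real.exp (∑' j : ℕ, b j * s L j / j) := by
  set R := ∑' j : ℕ, b (j + 1) * I (j + 1) with hR
  have hp := h.tendsto_logMGF hb0 hbB (u := 1) (by simp)
  have hm := h.tendsto_logMGF hb0 hbB (u := -1) (by simp)
  rw [← hR] at hp hm
  filter_upwards [h.hasSum_cycGen_tilt hb0 hbB, eventually_gt_atTop 0,
    hp.eventually_lt_const (by linarith : 1 * R < R + δ / 2),
    hm.eventually_lt_const (by linarith : -1 * R < -R + δ / 2)] with L hL hL0 hpL hmL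
  have hκ := h.rate_pos
  set τ := κ * L ^ (-η) with hτ
  have hτ0 : 0 < τ := by positivity
  have hV : 0 < L ^ d := by positivity
  set V := L ^ d with hVdef
  set G := Real.exp (∑' j : ℕ, b j * s L j / j) with hG
  rw [inv_mul_lt_iff₀ (by positivity)] at hpL hmL
  have hP := (hL 1 le_rfl).mul_right (Real.exp (-(τ * ((R + δ) * V))))
  have hM := (hL (-1) (by norm_num)).mul_right (Real.exp (τ * ((R - δ) * V)))
  have hsum := hP.add hM
  have hpt : ∀ x : ℕ, (if |(x:ℝ) - R * V| ≤ δ * V then 0 else cycGen (fun j => b j * s L j) x) ≤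
      cycGen (fun j => b j * s L j) x * Real.exp (1 * τ * x) * Real.exp (-(τ * ((R + δ) * V))) +
      cycGen (fun j => b j * s L j) x * Real.exp (-1 * τ * x) * Real.exp (τ * ((R - δ) * V)) := by
    intro x
    have hw : 0 ≤ cycGen (fun j => b j * s L j) x :=
      cycGen_nonneg (fun j _ => mul_nonneg (hb0 j) (h.nonneg L j)) x
    split_ifs with hx
    · positivity
    rw [mul_assoc (cycGen _ x), mul_assoc (cycGen _ x), ← Real.exp_add, ← Real.exp_add]
    rw [abs_le, not_and_or] at hx
    rcases hx with hx | hx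
    · refine le_add_of_nonneg_of_le (by positivity) (le_mul_of_one_le_right hw
        (Real.one_le_exp ?_))
      push Not at hx
      nlinarith
    · refine le_add_of_le_of_nonneg (le_mul_of_one_le_right hw (Real.one_le_exp ?_))
        (by positivity)
      push Not at hx
      nlinarith
  have hw : ∀ x, 0 ≤ cycGen (fun j => b j * s L j) x :=
    fun x => cycGen_nonneg (fun j _ => mul_nonneg (hb0 j) (h.nonneg L j)) x
  refine (Summable.tsum_le_tsum hpt (Summable.of_nonneg_of_le (fun x => ?_) hpt hsum.summable)
    hsum.summable).trans ?_
  · split_ifs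
    · exact le_rfl
    · exact hw x
  have hG0 : 0 ≤ G := (Real.exp_pos _).le
  clear_value G
  rw [hsum.tsum_eq, mul_assoc G, mul_assoc G, ← Real.exp_add, ← Real.exp_add, ← mul_add, two_mul,
    mul_comm _ G]
  refine mul_le_mul_of_nonneg_left (add_le_add (Real.exp_le_exp.2 ?_) (Real.exp_le_exp.2 ?_)) hG0
  · nlinarith
  · nlinarith

/-- Truncating cycles longer than `y` changes the weights by an exponentially small amount. -/
lemma cycGen_sub_truncated_le (h : VolumeWeights d η κ s I D) (hb0 : ∀ j, 0 ≤ b j)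
    (hbB : ∀ j, b j ≤ B) :
    ∀ᶠ L : ℝ in atTop, ∀ (y : ℝ) (v : ℕ → ℝ), (∀ j, 0 ≤ v j) → (∀ j, v j ≤ 1) →
      (∀ j : ℕ, (j:ℝ) < y → v j = 1) → ∀ x : ℕ,
      cycGen (fun j => b j * s L j) x - cycGen (fun j => b j * s L j * v j) x ≤
        L ^ d * (B * ∑' j, D j) * Real.exp (-(κ * L ^ (-η) * y)) *
          Real.exp (∑' j : ℕ, b j * s L j / j) := by
  filter_upwards [h.hasSum_cycGen_weights hb0 hbB, h.term_mul_exp_le hb0 hbB,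
    eventually_gt_atTop 0] with L hG hL hL0 y v hv0 hv1 hvy x
  have hκ := h.rate_pos
  set τ := κ * L ^ (-η) with hτ
  have hτ0 : 0 < τ := by positivity
  set G := Real.exp (∑' j : ℕ, b j * s L j / j) with hGdef
  have hc0 : ∀ j, 0 ≤ b j * s L j := fun j => mul_nonneg (hb0 j) (h.nonneg L j)
  have hB0 : 0 ≤ B := (hb0 0).trans (hbB 0)
  have hDs : Summable fun j => L ^ d * (B * D j) * Real.exp (-(τ * y)) :=
    ((h.summable.mul_left B).mul_left (L ^ d)).mul_right _
  have hw : ∀ x, 0 ≤ cycGen (fun j => b j * s L j) x := fun x => cycGen_nonneg (fun j _ => hc0 j) x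
  have hterm : ∀ j : ℕ, (b j * s L j - b j * s L j * v j) / j ≤
      L ^ d * (B * D j) * Real.exp (-(τ * y)) := by
    intro j
    have hD := h.bound_nonneg j
    rcases lt_or_ge (j:ℝ) y with hj | hj
    · rw [hvy j hj, mul_one, sub_self, _root_.zero_div]; positivity
    · rw [← mul_one_sub, mul_div_right_comm]
      have h0 := h.term_nonneg hb0 L j
      refine (mul_le_of_le_one_right h0 (by linarith [hv0 j])).trans ?_
      rw [Real.exp_neg, ← div_eq_mul_inv, le_div_iff₀ (Real.exp_pos _)]
      refine le_trans ?_ (hL j)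
      gcongr
  refine (cycGen_sub_le (fun j _ => mul_nonneg (hc0 j) (hv0 j))
    (fun j _ => mul_le_of_le_one_right (hc0 j) (hv1 j)) x).trans ?_
  calc _ ≤ ∑ p ∈ Finset.HasAntidiagonal.antidiagonal x,
        L ^ d * (B * D p.1) * Real.exp (-(τ * y)) * G := by
        refine Finset.sum_le_sum fun p _ => ?_
        refine mul_le_mul (hterm _) (le_hasSum hG p.2 fun j _ => hw j) (hw _) ?_
        have := h.bound_nonneg p.1
        positivity
    _ = (∑ j ∈ Finset.range (x + 1), L ^ d * (B * D j) * Real.exp (-(τ * y))) * G := by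
        rw [Finset.Nat.sum_antidiagonal_eq_sum_range_succ
          (fun i _ => L ^ d * (B * D i) * Real.exp (-(τ * y)) * G), Finset.sum_mul]
    _ ≤ (∑' j, L ^ d * (B * D j) * Real.exp (-(τ * y))) * G := by
        refine mul_le_mul_of_nonneg_right (hDs.sum_le_tsum _ fun j _ => ?_) (Real.exp_pos _).le
        have := h.bound_nonneg j
        positivity
    _ = _ := by rw [tsum_mul_right, tsum_mul_left, tsum_mul_left]

end VolumeWeights

/-- Deterministic comparison of two convolutions, when one factor concentrates on `good`. -/
lemma abs_convolution_ratio_sub_le {N : ℕ} {A C w w' : ℕ → ℝ} {P e M m G e₁ e₂ : ℝ}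
    (good : ℕ → Prop) (hw' : ∀ x, 0 ≤ w' x) (hw'w : ∀ x, w' x ≤ w x)
    (hwe : ∀ x, w x - w' x ≤ e₂ * G) (hA : ∀ n, 0 ≤ A n) (hAC : ∀ n, A n ≤ C n)
    (hCM : ∀ n ≤ N, C n ≤ M)
    (hgood : ∀ x, good x → x ≤ N ∧ m ≤ C (N - x) ∧
      |A (N - x) - P * C (N - x)| ≤ e * C (N - x))
    (hwG : HasSum w G) (hbad : ∑' x, (if good x then 0 else w x) ≤ e₁ * G) (he₁ : e₁ ≤ 1 / 2)
    (hG : 0 < G) (hm : 0 < m) (he : 0 ≤ e) :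
    |(∑ x ∈ Finset.range (N + 1), w' x * A (N - x)) /
        (∑ x ∈ Finset.range (N + 1), w x * C (N - x)) - P| ≤
      e + 2 / m * ((1 + |P|) * M * e₁ + (N + 1) * M * e₂) := by
  have hw : ∀ x, 0 ≤ w x := fun x => (hw' x).trans (hw'w x)
  have hC : ∀ n, 0 ≤ C n := fun n => (hA n).trans (hAC n)
  have hM : 0 ≤ M := (hC 0).trans (hCM 0 (Nat.zero_le _))
  set bad : ℕ → ℝ := fun x => if good x then 0 else w x with hbd
  have hb0 : ∀ x, 0 ≤ bad x := fun x => by simp only [hbd]; split_ifs <;> simp [hw]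
  have hbs : Summable bad := Summable.of_nonneg_of_le hb0
    (fun x => by simp only [hbd]; split_ifs <;> simp [hw]) hwG.summable
  set Den := ∑ x ∈ Finset.range (N + 1), w x * C (N - x) with hDen
  have hgoodsum : ∑ x ∈ Finset.range (N + 1), (w x - bad x) = G - ∑' x, bad x := by
    refine ((hasSum_sum_of_ne_finset_zero (f := fun x => w x - bad x) fun x hx => ?_).unique
      (hwG.sub hbs.hasSum))
    have : ¬ good x := fun hg => hx (Finset.mem_range.2 (Nat.lt_succ_of_le (hgood x hg).1))
    simp [hbd, this]
  have hDl : m * (G / 2) ≤ Den := by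
    calc m * (G / 2) ≤ m * ∑ x ∈ Finset.range (N + 1), (w x - bad x) := by
          rw [hgoodsum]
          refine mul_le_mul_of_nonneg_left ?_ hm.le
          nlinarith
      _ ≤ Den := by
          rw [Finset.mul_sum]
          refine Finset.sum_le_sum fun x _ => ?_
          by_cases hx : good x
          · simp only [hbd, hx, if_true, sub_zero]
            rw [mul_comm]
            exact mul_le_mul_of_nonneg_left (hgood x hx).2.1 (hw x)
          · simp only [hbd, hx, if_false, sub_self, mul_zero]
            exact mul_nonneg (hw x) (hC _)
  have hD0 : 0 < Den := lt_of_lt_of_le (by positivity) hDl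
  have hnum : |∑ x ∈ Finset.range (N + 1), w' x * A (N - x) - P * Den| ≤
      e * Den + ((1 + |P|) * M * e₁ + (N + 1) * M * e₂) * G := by
    rw [hDen, Finset.mul_sum, ← Finset.sum_sub_distrib]
    refine (Finset.abs_sum_le_sum_abs _ _).trans ?_
    calc _ ≤ ∑ x ∈ Finset.range (N + 1),
          (e * (w x * C (N - x)) + (1 + |P|) * M * bad x + M * (e₂ * G)) := by
          refine Finset.sum_le_sum fun x _ => ?_
          have hn : C (N - x) ≤ M := hCM _ (Nat.sub_le _ _)
          have hAM := (hAC (N - x)).trans hn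
          have e1 : w' x * A (N - x) - P * (w x * C (N - x)) =
              w x * (A (N - x) - P * C (N - x)) - (w x - w' x) * A (N - x) := by ring
          rw [e1]
          refine (abs_sub _ _).trans (add_le_add ?_ ?_)
          · rw [abs_mul, abs_of_nonneg (hw x)]
            by_cases hx : good x
            · simp only [hbd, hx, if_true, mul_zero, add_zero]
              nlinarith [(hgood x hx).2.2, hw x]
            · simp only [hbd, hx, if_false]
              have h1 : |A (N - x) - P * C (N - x)| ≤ (1 + |P|) * M := by
                refine (abs_sub _ _).trans ?_
                rw [abs_mul, abs_of_nonneg (hA _), abs_of_nonneg (hC _)]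
                nlinarith [abs_nonneg P]
              have h2 : 0 ≤ e * (w x * C (N - x)) := mul_nonneg he (mul_nonneg (hw x) (hC _))
              nlinarith [hw x]
          · rw [abs_of_nonneg (mul_nonneg (sub_nonneg.2 (hw'w x)) (hA _)), mul_comm]
            exact mul_le_mul hAM (hwe x) (sub_nonneg.2 (hw'w x)) hM
      _ = e * Den + (1 + |P|) * M * ∑ x ∈ Finset.range (N + 1), bad x + (N + 1) * (M * (e₂ * G)) := by
          rw [Finset.sum_add_distrib, Finset.sum_add_distrib, ← Finset.mul_sum, ← Finset.mul_sum,
            Finset.sum_const, Finset.card_range, nsmul_eq_mul]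
          push_cast
          rfl
      _ ≤ _ := by
          have h1 := (hbs.sum_le_tsum (Finset.range (N + 1)) fun x _ => hb0 x).trans hbad
          have h2 : (1 + |P|) * M * ∑ x ∈ Finset.range (N + 1), bad x ≤ (1 + |P|) * M * (e₁ * G) :=
            mul_le_mul_of_nonneg_left h1 (by positivity)
          linarith
  set X := (1 + |P|) * M * e₁ + (N + 1) * M * e₂ with hX
  have hX0 : 0 ≤ X := by
    have h1 : 0 ≤ e₁ * G := (tsum_nonneg hb0).trans hbad
    have h2 : 0 ≤ e₂ * G := (sub_nonneg.2 (hw'w 0)).trans (hwe 0)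
    have h1' : 0 ≤ e₁ := nonneg_of_mul_nonneg_left h1 hG
    have h2' : 0 ≤ e₂ := nonneg_of_mul_nonneg_left h2 hG
    positivity
  rw [div_sub' hD0.ne', abs_div, abs_of_pos hD0, div_le_iff₀ hD0, mul_comm Den P]
  refine hnum.trans ?_
  have : X * G ≤ 2 / m * X * Den := by
    calc X * G = 2 / m * X * (m * (G / 2)) := by field_simp
      _ ≤ _ := mul_le_mul_of_nonneg_left hDl (by positivity)
  linarith

/-! ### Transfer of scaling limits to the spatial model -/

/-- A stretched exponential beats any power of the volume. -/
lemma tendsto_volume_pow_mul_exp_neg {d : ℕ} {η c ρ : ℝ} (hηd : η < d) (hc : 0 < c)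
    (hρ : 0 < ρ) (k : ℕ) :
    Tendsto (fun L : ℝ => (ρ * L ^ d + 1) ^ k * Real.exp (-(c * (L ^ (-η) * L ^ d)))) atTop
      (𝓝 0) := by
  have hd : (0:ℝ) < d - η := by linarith
  have h1 := (tendsto_rpow_mul_exp_neg_mul_atTop_nhds_zero (d / (d - η) * k) c hc).comp
    (tendsto_rpow_atTop hd)
  have h2 := h1.const_mul ((ρ + 1) ^ k)
  rw [mul_zero] at h2
  refine squeeze_zero' ?_ ?_ h2
  · filter_upwards [eventually_ge_atTop 0] with L hL
    positivity
  · filter_upwards [eventually_ge_atTop 1] with L hL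
    have hL0 : 0 < L := by linarith
    have hV : 1 ≤ L ^ d := one_le_pow₀ hL
    have e1 : L ^ (-η) * L ^ d = L ^ ((d:ℝ) - η) := by
      rw [← Real.rpow_natCast, ← Real.rpow_add hL0]; ring_nf
    have e2 : (L ^ ((d:ℝ) - η)) ^ (d / (d - η) * (k:ℝ)) = (L ^ d) ^ k := by
      rw [← Real.rpow_mul hL0.le, ← mul_assoc, mul_div_cancel₀ _ hd.ne', Real.rpow_mul hL0.le,
        Real.rpow_natCast, Real.rpow_natCast]
    simp only [Function.comp]
    rw [e1, e2, ← mul_assoc, ← mul_pow, neg_mul]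
    gcongr
    nlinarith

lemma HasRatioLimit.exists_forall_lt {b : ℕ → ℝ} {v : ℝ → ℝ} {P e : ℝ} (h : HasRatioLimit b v P)
    (he : 0 < e) : ∃ T δ : ℝ, 0 < δ ∧ ∀ (t : ℝ) (n : ℕ), T ≤ t → |(n:ℝ) / t - 1| < δ →
      |cycGen (fun j : ℕ => b j * v (j / t)) n / cycGen b n - P| < e := by
  have h1 := Metric.tendsto_nhds.1 h e he
  rw [nearF, ((atTop_basis.comap _).inf (Metric.nhds_basis_ball.comap _)).eventually_iff] at h1
  obtain ⟨⟨T, δ⟩, ⟨-, hδ⟩, h2⟩ := h1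
  refine ⟨T, δ, hδ, fun t n ht hn => ?_⟩
  exact h2 (x := (t, n)) ⟨ht, hn⟩

lemma div_pow_le_cycGen {b : ℕ → ℝ} (hb0 : ∀ j, 0 ≤ b j) {c : ℝ} (hc : 0 ≤ c) {q : ℕ}
    (hbl : ∀ n : ℕ, 1 ≤ n → c ≤ b n * (n:ℝ) ^ q) {n N : ℕ} (hn : 1 ≤ n) (hnN : n ≤ N) :
    c / ((N:ℝ) + 1) ^ (q + 1) ≤ cycGen b n := by
  have hn0 : (0:ℝ) < n := by exact_mod_cast hn
  have hnN' : (n:ℝ) ≤ N + 1 := by exact_mod_cast hnN.trans N.le_succ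
  refine le_trans ?_ (one_div_le_cycGen (fun j _ => hb0 j) hn)
  calc c / ((N:ℝ) + 1) ^ (q + 1) ≤ c / (n:ℝ) ^ (q + 1) := by gcongr
    _ ≤ (b n * (n:ℝ) ^ q) / (n:ℝ) ^ (q + 1) := by
      gcongr
      exact hbl n hn
    _ = b n / n := by
      field_simp
      ring

theorem VolumeWeights.tendsto_ratio {d : ℕ} {η κ : ℝ} {s : ℝ → ℕ → ℝ} {I D b : ℕ → ℝ}
    (h : VolumeWeights d η κ s I D) (hb0 : ∀ j, 0 ≤ b j) {B : ℕ} (hB : 1 ≤ B)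
    (hbB : ∀ j, b j ≤ B) {c : ℝ} (hc : 0 < c) {q : ℕ}
    (hbl : ∀ n : ℕ, 1 ≤ n → c ≤ b n * (n:ℝ) ^ q) {ρ : ℝ} (hρ : 0 < ρ)
    (hcrit : ∑' j : ℕ, b (j + 1) * I (j + 1) < ρ) {ι : Type*} {l : Filter ι} {Ls : ι → ℝ}
    {Ns : ι → ℕ} (hLs : Tendsto Ls l atTop) (hfix : ∀ i, (Ns i : ℝ) = ρ * Ls i ^ d)
    {v : ℝ → ℝ} (hv0 : ∀ x, 0 ≤ v x) (hv1 : ∀ x, v x ≤ 1) {δ : ℝ} (hδ : 0 < δ)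
    (hvδ : ∀ x < δ, v x = 1) {P : ℝ} (hP : HasRatioLimit b v P) :
    Tendsto (fun i => cycGen (fun j : ℕ => (b j + b j * s (Ls i) j) *
        v (j / ((ρ - ∑' j : ℕ, b (j + 1) * I (j + 1)) * Ls i ^ d))) (Ns i) /
      cycGen (fun j => b j + b j * s (Ls i) j) (Ns i)) l (𝓝 P) := by
  set R := ∑' j : ℕ, b (j + 1) * I (j + 1) with hR
  have hr : 0 < ρ - R := by linarith
  set r := ρ - R with hrdef
  have hκ := h.rate_pos
  rw [Metric.tendsto_nhds]
  intro e he
  obtain ⟨T, δ₁, hδ₁, hT⟩ := hP.exists_forall_lt (half_pos he)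
  obtain ⟨δ₂, hδ₂, hδ₂₁, hδ₂h⟩ : ∃ δ₂ : ℝ, 0 < δ₂ ∧ δ₂ < δ₁ ∧ δ₂ ≤ 1 / 2 :=
    ⟨min (δ₁ / 2) (1 / 2), by positivity, (min_le_left _ _).trans_lt (by linarith),
      min_le_right _ _⟩
  have hdev := h.tsum_deviation_le hb0 hbB (mul_pos hδ₂ hr)
  have htr := h.cycGen_sub_truncated_le hb0 hbB
  have hsum := h.hasSum_cycGen_weights hb0 hbB
  have hc₁ : 0 < δ₂ * r / 2 * κ := by positivity
  have hc₂ : 0 < κ * (δ * r) := by positivity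
  have ht₀ := tendsto_volume_pow_mul_exp_neg h.lt_dim hc₁ hρ 0
  have ht₁ := (tendsto_volume_pow_mul_exp_neg h.lt_dim hc₁ hρ (q + 1 + B)).const_mul
    (2 / c * ((1 + |P|) * 2))
  have ht₂ := (tendsto_volume_pow_mul_exp_neg h.lt_dim hc₂ hρ (q + 1 + 1 + B + 1)).const_mul
    (2 / c * (ρ⁻¹ * (B * ∑' j, D j)))
  have ht := ht₁.add ht₂
  rw [mul_zero, mul_zero, add_zero] at ht
  have hV : Tendsto (fun L : ℝ => L ^ d) atTop atTop :=
    tendsto_pow_atTop (by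
      have : (0:ℝ) < d := h.pos.trans h.lt_dim
      exact_mod_cast this.ne')
  have hDs : 0 ≤ ∑' j, D j := tsum_nonneg h.bound_nonneg
  have key : ∀ᶠ L : ℝ in atTop, ∀ N : ℕ, (N:ℝ) = ρ * L ^ d →
      dist (cycGen (fun j : ℕ => (b j + b j * s L j) * v (j / (r * L ^ d))) N /
        cycGen (fun j => b j + b j * s L j) N) P < e := by
    filter_upwards [hdev, htr, hsum, ht₀.eventually_lt_const (by norm_num : (0:ℝ) < 1 / 4),
      ht.eventually_lt_const (half_pos he), eventually_gt_atTop 0,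
      (hV.const_mul_atTop hr).eventually_ge_atTop T]
      with L hdevL htrL hsumL ht₀L htL hL0 hTL N hN
    have hV0 : 0 < L ^ d := by positivity
    set V := L ^ d with hVdef
    set y := L ^ (-η) * V with hy
    set G := Real.exp (∑' j : ℕ, b j * s L j / j) with hG
    have hG0 : 0 < G := Real.exp_pos _
    have hs0 : ∀ j, 0 ≤ b j * s L j := fun j => mul_nonneg (hb0 j) (h.nonneg L j)
    have hsplit : ∀ u : ℕ → ℝ, cycGen (fun j => (b j + b j * s L j) * u j) N =
        ∑ x ∈ Finset.range (N + 1), cycGen (fun j => b j * s L j * u j) x *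
          cycGen (fun j => b j * u j) (N - x) := by
      intro u
      rw [← Finset.Nat.sum_antidiagonal_eq_sum_range_succ
        (fun x n => cycGen (fun j => b j * s L j * u j) x * cycGen (fun j => b j * u j) n),
        ← cycGen_add]
      congr 1
      funext j
      simp only [Pi.add_apply]
      ring
    have hden := hsplit fun _ => 1
    simp only [mul_one] at hden
    rw [hsplit fun j => v (j / (r * V)), hden, Real.dist_eq]
    have hmain := abs_convolution_ratio_sub_le (N := N)
      (A := cycGen fun j : ℕ => b j * v (j / (r * V))) (C := cycGen b)
      (w := cycGen fun j => b j * s L j) (w' := cycGen fun j : ℕ => b j * s L j * v (j / (r * V)))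
      (P := P) (e := e / 2) (M := ((N:ℝ) + 1) ^ B) (m := c / ((N:ℝ) + 1) ^ (q + 1)) (G := G)
      (e₁ := 2 * Real.exp (-(δ₂ * r / 2 * κ * y)))
      (e₂ := ρ⁻¹ * ((N:ℝ) + 1) * (B * ∑' j, D j) * Real.exp (-(κ * (δ * r) * y)))
      (fun x => |(x:ℝ) - R * V| ≤ δ₂ * r * V)
      (cycGen_nonneg fun j _ => mul_nonneg (hs0 j) (hv0 _))
      (cycGen_mono (fun j _ => mul_nonneg (hs0 j) (hv0 _))
        fun j _ => mul_le_of_le_one_right (hs0 j) (hv1 _))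
      ?_
      (cycGen_nonneg fun j _ => mul_nonneg (hb0 j) (hv0 _))
      (cycGen_mono (fun j _ => mul_nonneg (hb0 j) (hv0 _))
        fun j _ => mul_le_of_le_one_right (hb0 j) (hv1 _))
      ?_ ?_ hsumL ?_ ?_ hG0 (by positivity) (half_pos he).le
    · refine hmain.trans_lt ?_
      rw [← hN] at htL
      refine (add_lt_add_right (lt_of_eq_of_lt ?_ htL) _).trans_eq (add_halves e)
      field_simp
      ring
    · intro x
      refine (htrL (δ * (r * V)) (fun j => v (j / (r * V))) (fun j => hv0 _) (fun j => hv1 _)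
        (fun j hj => hvδ _ ?_) x).trans ?_
      · rwa [div_lt_iff₀ (by positivity)]
      · refine mul_le_mul_of_nonneg_right ?_ hG0.le
        have e1 : κ * L ^ (-η) * (δ * (r * V)) = κ * (δ * r) * y := by rw [hy]; ring
        rw [e1]
        refine mul_le_mul_of_nonneg_right ?_ (Real.exp_pos _).le
        refine mul_le_mul_of_nonneg_right ?_ (by positivity)
        rw [inv_mul_eq_div, le_div_iff₀ hρ]
        linarith
    · intro n hn
      refine (cycGen_le_pow hB (fun j _ => hb0 j) (fun j _ => hbB j) n).trans ?_
      gcongr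
    · intro x hx
      rw [abs_le] at hx
      have hN1 : (N:ℝ) = r * V + R * V := by rw [hN, hrdef]; ring
      have hrV : 0 < r * V := by positivity
      have hx1 : δ₂ * r * V ≤ 1 / 2 * (r * V) := by
        rw [mul_assoc]; exact mul_le_mul_of_nonneg_right hδ₂h hrV.le
      have hxN' : (x:ℝ) < N := by linarith [hx.2]
      have hxN : x < N := by exact_mod_cast hxN'
      have hm := div_pow_le_cycGen hb0 hc.le hbl (n := N - x) (N := N) (by omega) (by omega)
      refine ⟨hxN.le, hm, ?_⟩
      have hC0 : 0 < cycGen b (N - x) := lt_of_lt_of_le (by positivity) hm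
      have hr1 : |((N - x : ℕ) : ℝ) / (r * V) - 1| < δ₁ := by
        rw [Nat.cast_sub hxN.le, div_sub_one hrV.ne', abs_div, abs_of_pos hrV, div_lt_iff₀ hrV]
        have : δ₂ * (r * V) < δ₁ * (r * V) := mul_lt_mul_of_pos_right hδ₂₁ hrV
        rw [abs_lt]
        constructor <;> linarith [hx.1, hx.2]
      have h3 := (hT (r * V) (N - x) hTL hr1).le
      rwa [div_sub' hC0.ne', abs_div, abs_of_pos hC0, div_le_iff₀ hC0, mul_comm _ P] at h3
    · refine hdevL.trans_eq ?_
      rw [hy]; ring_nf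
    · rw [pow_zero, one_mul] at ht₀L
      linarith
  filter_upwards [hLs.eventually key] with i hi
  exact hi _ (hfix i)

/-! ### Laws of the longest cycles -/

/-- The probability, under the multiplicative measure on `S_N` with cycle weights `c`, that the
largest cycle lengths divided by `t` belong to the given intervals. -/
def cycProb {m : ℕ} (a b : Fin m → ℝ) (c : ℕ → ℝ) (N : ℕ) (t : ℝ) : ℝ :=
  (∑ π : Equiv.Perm (Fin N), if ∀ i : Fin m, (ellD π i : ℝ) / t ∈ Set.Icc (a i) (b i) then
    ((cycleLens π).map c).prod else 0) / (N.factorial * cycGen c N)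

lemma cycProb_congr {m : ℕ} (a b : Fin m → ℝ) {c e : ℕ → ℝ} (h : ∀ j, 1 ≤ j → c j = e j) (N : ℕ)
    (t : ℝ) : cycProb a b c N t = cycProb a b e N t := by
  have : ∀ π : Equiv.Perm (Fin N), (cycleLens π).map c = (cycleLens π).map e := fun π =>
    Multiset.map_congr rfl fun j hj => h j (cycleLens_pos π j hj)
  simp only [cycProb, this, cycGen_congr h]

/-- The families of weights `c i` on `S_{N i}`, at scale `t i`, have the same ratio limits as
`b`. -/
def SharesRatioLimits (b : ℕ → ℝ) (c : ℕ → ℕ → ℝ) (N : ℕ → ℕ) (t : ℕ → ℝ) : Prop :=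
  ∀ ⦃v : ℝ → ℝ⦄ ⦃δ P : ℝ⦄, (∀ x, 0 ≤ v x) → (∀ x, v x ≤ 1) → 0 < δ → (∀ x < δ, v x = 1) →
    HasRatioLimit b v P →
    Tendsto (fun i => cycGen (fun j : ℕ => c i j * v (j / t i)) (N i) / cycGen (c i) (N i)) atTop
      (𝓝 P)

lemma sharesRatioLimits_self (b : ℕ → ℝ) :
    SharesRatioLimits b (fun _ => b) (fun n => n) (fun n => (n : ℝ)) := by
  intro v δ P _ _ _ _ hP
  have hu : Tendsto (fun n : ℕ => ((n:ℝ), n)) atTop (nearF 1) := by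
    refine tendsto_nearF.2 ⟨tendsto_natCast_atTop_atTop, tendsto_const_nhds.congr' ?_⟩
    filter_upwards [eventually_gt_atTop 0] with n hn
    have : (n:ℝ) ≠ 0 := by exact_mod_cast hn.ne'
    exact (div_self this).symm
  have h := Tendsto.comp (f := fun n : ℕ => ((n:ℝ), n)) hP hu
  simpa only [Function.comp_def] using h

section

variable {m : ℕ} {lo up : Fin m → ℝ}

lemma exists_limit_cycProb_of_tendsto {b : ℕ → ℝ} {θ : ℝ} (hθ : 0 < θ) (hb0 : ∀ j, 0 ≤ b j)
    (hb : Tendsto b atTop (𝓝 θ)) (hs : Summable fun j : ℕ => |b j - θ| / j)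
    (hs1 : θ < 1 → Summable fun j : ℕ => |b j - θ|) {δ : ℝ} (hδ : 0 < δ) (hlo : ∀ i, δ ≤ lo i)
    (hlohi : ∀ i, lo i ≤ up i) (κ : ℝ) :
    ∃ p, ∀ (c : ℕ → ℕ → ℝ) (N : ℕ → ℕ) (t : ℕ → ℝ), SharesRatioLimits b c N t →
      (∀ᶠ i in atTop, 0 < t i ∧ (N i : ℝ) ≤ κ * t i) →
      Tendsto (fun i => cycProb lo up (c i) (N i) (t i)) atTop (𝓝 p) := by
  obtain ⟨coef, hcoef⟩ := exists_event_expansion lo up hδ hlo hlohi ⌈κ / δ⌉₊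
  have hlim : ∀ σ : Fin m × Bool → Fin (⌈κ / δ⌉₊ + 1),
      ∃ P, HasRatioLimit b (stepV lo up (node σ)) P := fun σ =>
    exists_hasRatioLimit hθ hb0 hb hs hs1 hδ (stepV_nonneg fun i => (node_mem σ i).1)
      (stepV_le_one (fun i => (node_mem σ i).1) fun i => (node_mem σ i).2)
      (fun x hx => stepV_eq_one hlo hlohi hx)
      ((Set.finite_range lo).union (Set.finite_range up))
      (fun y hy => stepV_eventually_eq lo up _ hy)
  choose P hP using hlim
  refine ⟨∑ σ, coef σ * P σ, fun c N t hc ht => ?_⟩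
  have h1 : Tendsto (fun i => ∑ σ, coef σ *
      (cycGen (fun j : ℕ => c i j * stepV lo up (node σ) (j / t i)) (N i) / cycGen (c i) (N i)))
      atTop (𝓝 (∑ σ, coef σ * P σ)) :=
    tendsto_finsetSum _ fun σ _ => (hc (stepV_nonneg fun i => (node_mem σ i).1)
      (stepV_le_one (fun i => (node_mem σ i).1) fun i => (node_mem σ i).2) hδ
      (fun x hx => stepV_eq_one hlo hlohi hx) (hP σ)).const_mul _
  refine h1.congr' ?_
  filter_upwards [ht] with i hi
  have hN : (N i : ℝ) ≤ (⌈κ / δ⌉₊ : ℝ) * (δ * t i) := by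
    refine hi.2.trans ?_
    rw [← mul_assoc]
    refine mul_le_mul_of_nonneg_right ?_ hi.1.le
    exact (div_le_iff₀ hδ).1 (Nat.le_ceil _)
  have hf : ((N i).factorial : ℝ) ≠ 0 := by exact_mod_cast (Nat.factorial_pos _).ne'
  rw [cycProb, sum_event_eq (hcoef (N i) (t i) hi.1 hN), mul_div_mul_left _ _ hf, Finset.sum_div]
  exact Finset.sum_congr rfl fun σ _ => (mul_div_assoc _ _ _).symm

lemma tendsto_cycProb_zero {b : ℕ → ℝ} {γ : ℝ} (hγ : 0 < γ)
    (hb : ∀ j : ℕ, 1 ≤ j → b j = (j:ℝ) ^ (-γ)) (i₀ : Fin m) (hi₀ : (i₀ : ℕ) = 0)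
    (hlo : 0 < lo i₀) (hlohi : lo i₀ ≤ up i₀) (hhi : up i₀ < 1) {c : ℕ → ℕ → ℝ} {N : ℕ → ℕ}
    {t : ℕ → ℝ} (hc : SharesRatioLimits b c N t) (hc0 : ∀ i j, 0 ≤ c i j) :
    Tendsto (fun i => cycProb lo up (c i) (N i) (t i)) atTop (𝓝 0) := by
  have h := hc (v := fun x => if x ∈ Set.Icc (lo i₀) (up i₀) then 0 else 1)
    (fun x => by split_ifs <;> norm_num)
    (fun x => by split_ifs <;> norm_num) hlo
    (fun x hx => if_neg fun hx' => absurd hx'.1 (not_le.2 hx))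
    (hasRatioLimit_window hγ hb hlo (hlo.le.trans hlohi) hhi)
  have h1 := h.const_sub 1
  rw [sub_self] at h1
  refine squeeze_zero' (Eventually.of_forall fun i => ?_) ?_ h1
  · refine div_nonneg (Finset.sum_nonneg fun π _ => ?_)
      (mul_nonneg (Nat.cast_nonneg _) (cycGen_nonneg (fun j _ => hc0 i j) _))
    split_ifs
    · refine Multiset.prod_nonneg fun x hx => ?_
      obtain ⟨j, -, rfl⟩ := Multiset.mem_map.1 hx
      exact hc0 i j
    · exact le_rfl
  · filter_upwards [h.eventually_ne one_ne_zero] with i hi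
    have hG : cycGen (c i) (N i) ≠ 0 := (div_ne_zero_iff.1 hi).2
    have hG0 : 0 < cycGen (c i) (N i) :=
      lt_of_le_of_ne (cycGen_nonneg (fun j _ => hc0 i j) _) hG.symm
    have hf : (0:ℝ) < (N i).factorial := by exact_mod_cast Nat.factorial_pos _
    rw [cycProb, one_sub_div hG, ← mul_div_mul_left _ (cycGen (c i) (N i)) hf.ne']
    refine div_le_div_of_nonneg_right ?_ (by positivity)
    exact sum_event_le i₀ hi₀ hlo (hc0 i)

end

/-! ### The spatial model -/

lemma tsum_exp_pow_eq {d : ℕ} {ε : Eu d → ℝ} {L : ℝ} (hε0 : ∀ k, 0 ≤ ε k) (hzero : ε 0 = 0)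
    (hs : Summable fun z : Fin d → ℤ => Real.exp (-ε (dualPt d L z))) {j : ℕ} (hj : 1 ≤ j) :
    ∑' z : Fin d → ℤ, Real.exp (-ε (dualPt d L z)) ^ j = 1 + excSum d ε L j := by
  have hsj : Summable fun z : Fin d → ℤ => Real.exp (-ε (dualPt d L z)) ^ j :=
    Summable.of_nonneg_of_le (fun z => by positivity)
      (fun z => pow_le_of_le_one (Real.exp_pos _).le
        (Real.exp_le_one_iff.2 (neg_nonpos.2 (hε0 _))) (by omega)) hs
  have hd0 : dualPt d L 0 = 0 := by
    ext i
    simp [dualPt]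
  rw [hsj.tsum_eq_add_tsum_ite 0, hd0, hzero, neg_zero, Real.exp_zero, one_pow]
  rfl

lemma exists_volumeWeights {d : ℕ} (hd : 1 ≤ d) {ε : Eu d → ℝ} (hε0 : ∀ k, 0 ≤ ε k)
    (hzero : ε 0 = 0) (hεc : Continuous fun k => Real.exp (-ε k))
    (hεi : Integrable fun k => Real.exp (-ε k)) {a η : ℝ} (ha : 0 < a) (hη : 0 < η) (hηd : η < d)
    (hlow : ∀ k : Eu d, ‖k‖ ≤ 1 → a * ‖k‖ ^ η ≤ ε k) {c₁ : ℝ} (hc₁ : 0 < c₁)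
    (hfar : ∀ k : Eu d, 1 ≤ ‖k‖ → c₁ ≤ ε k)
    (hR : Tendsto (fun L : ℝ => (L ^ d)⁻¹ * ∑' z : Fin d → ℤ, Real.exp (-ε (dualPt d L z)))
      atTop (𝓝 (∫ k : Eu d, Real.exp (-ε k)))) :
    ∃ D, VolumeWeights d η (a / 2) (excSum d ε) (fun j => ∫ k : Eu d, Real.exp (-ε k) ^ j) D := by
  have hs := eventually_summable_exp_neg hεi hR
  obtain ⟨D, hD, hbd⟩ := exists_excSum_bound ha hη hηd hlow hc₁ hfar hs hR
  refine ⟨fun j => |D j|, hη, hηd, half_pos ha, fun L j => excSum_nonneg d ε L j, fun j hj => ?_,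
    hD.abs, fun j => abs_nonneg _, ?_⟩
  · have h1 := tendsto_riemannSum_pow hεc hεi (fun k => (Real.exp_pos _).le)
      (fun k => Real.exp_le_one_iff.2 (neg_nonpos.2 (hε0 k))) hs hR hj
    have h2 := h1.sub (tendsto_inv_atTop_zero.comp
      (tendsto_pow_atTop (α := ℝ) (n := d) (by omega)))
    rw [sub_zero] at h2
    refine h2.congr' ?_
    filter_upwards [hs] with L hL
    rw [tsum_exp_pow_eq hε0 hzero hL hj, Function.comp]
    ring
  · filter_upwards [hbd, eventually_ge_atTop 0] with L hL hL0 j hj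
    exact (hL j hj).trans (mul_le_mul_of_nonneg_left (le_abs_self _) (by positivity))

lemma rhoC_eq (d : ℕ) (ε : Eu d → ℝ) (α : ℕ → ℝ) :
    rhoC d ε α = ∑' j : ℕ, Real.exp (-α (j + 1)) * ∫ k : Eu d, Real.exp (-ε k) ^ (j + 1) := by
  refine tsum_congr fun j => ?_
  congr 2
  funext k
  rw [← Real.exp_nat_mul]
  congr 1
  push_cast
  ring

lemma rhoC_nonneg (d : ℕ) (ε : Eu d → ℝ) (α : ℕ → ℝ) : 0 ≤ rhoC d ε α :=
  tsum_nonneg fun _ => mul_nonneg (Real.exp_pos _).le (integral_nonneg fun _ => (Real.exp_pos _).le)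

lemma VolumeWeights.sharesRatioLimits {d : ℕ} {η κ : ℝ} {s : ℝ → ℕ → ℝ} {I D b : ℕ → ℝ}
    (h : VolumeWeights d η κ s I D) (hb0 : ∀ j, 0 ≤ b j) (hbB : BddAbove (Set.range b))
    {c γ : ℝ} (hc : 0 < c) (hbl : ∀ n : ℕ, 1 ≤ n → c * (n:ℝ) ^ (-γ) ≤ b n) {ρ : ℝ} (hρ : 0 < ρ)
    (hcrit : ∑' j : ℕ, b (j + 1) * I (j + 1) < ρ) {Ls : ℕ → ℝ} {Ns : ℕ → ℕ}
    (hLs : Tendsto Ls atTop atTop) (hfix : ∀ i, (Ns i : ℝ) = ρ * Ls i ^ d) :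
    SharesRatioLimits b (fun i j => b j + b j * s (Ls i) j) Ns
      (fun i => (1 - (∑' j : ℕ, b (j + 1) * I (j + 1)) / ρ) * Ns i) := by
  intro v δ P hv0 hv1 hδ hvδ hP
  obtain ⟨B, hB⟩ := hbB
  have hBn : ∀ j, b j ≤ (max 1 ⌈B⌉₊ : ℕ) := fun j => by
    refine (hB (Set.mem_range_self j)).trans ((Nat.le_ceil B).trans ?_)
    exact_mod_cast le_max_right _ _
  have hq : ∀ n : ℕ, 1 ≤ n → c ≤ b n * (n:ℝ) ^ ⌈γ⌉₊ := by
    intro n hn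
    have hn1 : (1:ℝ) ≤ n := by exact_mod_cast hn
    calc c = c * (n:ℝ) ^ (-γ) * (n:ℝ) ^ γ := by
          rw [mul_assoc, ← Real.rpow_add (by linarith), neg_add_cancel, Real.rpow_zero, mul_one]
      _ ≤ b n * (n:ℝ) ^ γ := mul_le_mul_of_nonneg_right (hbl n hn) (by positivity)
      _ ≤ b n * (n:ℝ) ^ ⌈γ⌉₊ := by
          rw [← Real.rpow_natCast (n:ℝ)]
          exact mul_le_mul_of_nonneg_left
            (Real.rpow_le_rpow_of_exponent_le hn1 (Nat.le_ceil γ)) (hb0 n)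
  have h1 := h.tendsto_ratio hb0 (le_max_left _ _) hBn hc hq hρ hcrit hLs hfix hv0 hv1 hδ hvδ hP
  have ht : ∀ i, (ρ - ∑' j : ℕ, b (j + 1) * I (j + 1)) * Ls i ^ d =
      (1 - (∑' j : ℕ, b (j + 1) * I (j + 1)) / ρ) * Ns i := fun i => by
    rw [hfix]; field_simp
  simpa only [ht] using h1

lemma gibbsP_eq_cycProb {d : ℕ} {f ε : Eu d → ℝ} (hf : Continuous f) (hf0 : ∀ x, 0 ≤ f x)
    (hfi : Integrable f) (hε0 : ∀ k, 0 ≤ ε k)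
    (hFT : ∀ k : Eu d, 𝓕 (fun x => (f x : ℂ)) k = (Real.exp (-ε k) : ℂ)) (hzero : ε 0 = 0)
    {L : ℝ} (hL : 0 < L) (hper : Continuous (fper d f L))
    (hs : Summable fun z : Fin d → ℤ => Real.exp (-ε (dualPt d L z))) (α : ℕ → ℝ) (N : ℕ)
    {m : ℕ} (lo up : Fin m → ℝ) (t : ℝ) :
    gibbsP d f α L N {π | ∀ i : Fin m, (ellD π (i : ℕ) : ℝ) / t ∈ Set.Icc (lo i) (up i)} =
      cycProb lo up (fun j => Real.exp (-α j) + Real.exp (-α j) * excSum d ε L j) N t := by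
  rw [← cycProb_congr lo up (c := fun j => Real.exp (-α j) *
    ∑' z : Fin d → ℤ, Real.exp (-ε (dualPt d L z)) ^ j)
    fun j hj => by rw [tsum_exp_pow_eq hε0 hzero hs hj]; ring]
  simp only [gibbsP, gibbsW_toReal hf hf0 hfi hε0 hFT hL hper hs]
  rw [sum_perm_cycleLens, cycProb]
  congr 1

lemma sum_permWeight_eq_cycProb (α : ℕ → ℝ) (n : ℕ) {m : ℕ} (lo up : Fin m → ℝ) :
    (∑ π : Equiv.Perm (Fin n),
      if ∀ i : Fin m, (ellD π (i : ℕ) : ℝ) / n ∈ Set.Icc (lo i) (up i) then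
        permWeight α π / (hcoef α n * (n.factorial : ℝ)) else 0) =
      cycProb lo up (fun j => Real.exp (-α j)) n n := by
  rw [cycProb, Finset.sum_div]
  refine Finset.sum_congr rfl fun π _ => ?_
  rw [permWeight_eq, hcoef_eq, mul_comm (cycGen _ _)]
  split_ifs <;> simp

lemma abs_exp_neg_sub_exp_neg_le {x y A : ℝ} (h : |x - y| ≤ A) :
    |Real.exp (-x) - Real.exp (-y)| ≤ Real.exp (-y) * Real.exp A * |x - y| := by
  have e : Real.exp (-x) - Real.exp (-y) = Real.exp (-y) * (Real.exp (y - x) - 1) := by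
    rw [mul_sub, ← Real.exp_add]; ring_nf
  rw [e, abs_mul, Real.abs_exp, mul_assoc]
  refine mul_le_mul_of_nonneg_left ((abs_exp_sub_one_le _).trans ?_) (Real.exp_pos _).le
  rw [abs_sub_comm y x, mul_comm]
  gcongr

/-- Proposition 5.3: with cycle weights as in Theorem 2.1 or
`α_j = γ log j` (`γ > 0`), if `ρ > ρ_c` (so `ν = 1 - ρ_c/ρ > 0`), then for every
`m ≥ 1` and every product of intervals `A = [a_1,b_1] × ⋯ × [a_m,b_m] ⊆ (0,1)^m`, the
limit, in the thermodynamic limit at fixed density `ρ = N/|Λ|`, of the Gibbs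
probability that `(ℓ⁽¹⁾/(νN), …, ℓ⁽ᵐ⁾/(νN)) ∈ A` equals the limit as `n → ∞` of the
nonspatial probability `Prob_n((ℓ⁽¹⁾/n, …, ℓ⁽ᵐ⁾/n) ∈ A)` (in particular both limits
exist). -/
theorem statement19
    (d : ℕ) (hd : 1 ≤ d) (f ε : Eu d → ℝ) (α : ℕ → ℝ)
    -- assumptions on the jump function `f = e^{-ξ}`
    (hf_cont : Continuous f) (hf_nonneg : ∀ x, 0 ≤ f x)
    (hf_norm : ∫ x : Eu d, f x = 1)
    -- the Fourier transform of `e^{-ξ}` is the positive function `e^{-ε}`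
    (hFT : ∀ k : Eu d, 𝓕 (fun x => (f x : ℂ)) k = (Real.exp (-ε k) : ℂ))
    -- assumptions on the dispersion relation `ε`
    (hε_nonneg : ∀ k, 0 ≤ ε k)
    (hε_uc : UniformContinuous fun k => Real.exp (-ε k))
    (hε_low : ∃ a > (0:ℝ), ∃ η : ℝ, 0 < η ∧ η < d ∧
      ∀ k : Eu d, ‖k‖ ≤ 1 → a * ‖k‖ ^ η ≤ ε k)
    (hε_pos : ∀ δ : ℝ, 0 < δ → ∃ c > (0:ℝ), ∀ k : Eu d, δ ≤ ‖k‖ → c ≤ ε k)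
    -- the periodization `e^{-ξ_Λ}` is continuous for all large `L`
    (hper_cont : ∃ L₀ : ℝ, ∀ L ≥ L₀, Continuous (fper d f L))
    -- convergence of the Riemann sums `|Λ|⁻¹ ∑_{k∈Λ*} e^{-ε(k)} → ∫ e^{-ε(k)} dk`
    (hRiemann : Tendsto
      (fun L : ℝ => (L ^ d)⁻¹ * ∑' z : Fin d → ℤ, Real.exp (-ε (dualPt d L z)))
      atTop (𝓝 (∫ k : Eu d, Real.exp (-ε k))))
    -- cycle weights as in Theorem 2.1 or Theorem 2.2
    (hα_case :
      (∃ αlim : ℝ, Tendsto (fun j : ℕ => α j) atTop (𝓝 αlim) ∧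
        ((0 < αlim ∧ Summable fun j : ℕ => |α j - αlim|) ∨
         (αlim ≤ 0 ∧ Summable fun j : ℕ => |α j - αlim| / j))) ∨
      (∃ γ : ℝ, 0 < γ ∧ ∀ j : ℕ, 1 ≤ j → α j = γ * Real.log j))
    -- supercritical density: `ρ > ρ_c`, so that `ν = 1 - ρ_c/ρ > 0`
    (ρ : ℝ) (hρ : 0 < ρ) (hcrit : rhoC d ε α < ρ)
    -- thermodynamic limit at fixed density `ρ`
    (Ls : ℕ → ℝ) (Ns : ℕ → ℕ)
    (hLs : Tendsto Ls atTop atTop)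
    (hfix : ∀ mm, (Ns mm : ℝ) = ρ * Ls mm ^ d)
    -- the box `A = [a_1,b_1] × ⋯ × [a_m,b_m] ⊆ (0,1)^m`
    (m : ℕ) (hm : 1 ≤ m) (aa bb : Fin m → ℝ)
    (hab : ∀ i, 0 < aa i ∧ aa i ≤ bb i ∧ bb i < 1) :
    ∃ p : ℝ,
      Tendsto (fun idx => gibbsP d f α (Ls idx) (Ns idx)
          {π | ∀ i : Fin m,
            (ellD π (i : ℕ) : ℝ) / ((1 - rhoC d ε α / ρ) * Ns idx)
              ∈ Set.Icc (aa i) (bb i)})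
        atTop (𝓝 p) ∧
      Tendsto (fun n : ℕ => ∑ π : Equiv.Perm (Fin n),
          if ∀ i : Fin m, (ellD π (i : ℕ) : ℝ) / n ∈ Set.Icc (aa i) (bb i) then
            permWeight α π / (hcoef α n * (n.factorial : ℝ))
          else 0)
        atTop (𝓝 p) := by
  obtain ⟨a, ha, η, hη, hηd, hlow⟩ := hε_low
  obtain ⟨c₁, hc₁, hfar⟩ := hε_pos 1 one_pos
  obtain ⟨L₀, hper⟩ := hper_cont
  have hfi : Integrable f := integrable_of_integral_eq_one hf_norm
  have hεc := hε_uc.continuous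
  have hzero := dispersion_zero hf_norm hFT
  have hεi := integrable_exp_neg_dispersion hf_cont hfi hFT hε_nonneg hεc
  obtain ⟨D, hvol⟩ := exists_volumeWeights hd hε_nonneg hzero hεc hεi ha hη hηd hlow hc₁ hfar
    hRiemann
  have hs := eventually_summable_exp_neg hεi hRiemann
  have hν0 : 0 ≤ rhoC d ε α / ρ := div_nonneg (rhoC_nonneg d ε α) hρ.le
  have hν1 : rhoC d ε α / ρ < 1 := (div_lt_one hρ).2 hcrit
  set b : ℕ → ℝ := fun j => Real.exp (-α j) with hb
  have hb0 : ∀ j, 0 ≤ b j := fun j => (Real.exp_pos _).le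
  have hNs : Tendsto Ns atTop atTop := by
    refine tendsto_natCast_atTop_iff.1 (((tendsto_pow_atTop (by omega)).comp
      hLs).const_mul_atTop hρ |>.congr fun i => (hfix i).symm)
  set t : ℕ → ℝ := fun i => (1 - rhoC d ε α / ρ) * Ns i with ht
  set w : ℕ → ℕ → ℝ := fun i j => b j + b j * excSum d ε (Ls i) j with hw
  have hw0 : ∀ i j, 0 ≤ w i j := fun i j =>
    add_nonneg (hb0 j) (mul_nonneg (hb0 j) (excSum_nonneg d ε _ j))
  have hgibbs : ∀ᶠ i in atTop, cycProb aa bb (w i) (Ns i) (t i) =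
      gibbsP d f α (Ls i) (Ns i) {π | ∀ i' : Fin m, (ellD π (i' : ℕ) : ℝ) /
        ((1 - rhoC d ε α / ρ) * Ns i) ∈ Set.Icc (aa i') (bb i')} := by
    filter_upwards [hLs.eventually hs, hLs.eventually (eventually_gt_atTop 0),
      hLs.eventually (eventually_ge_atTop L₀)] with i hsi hi0 hiL
    exact (gibbsP_eq_cycProb hf_cont hf_nonneg hfi hε_nonneg hFT hzero hi0 (hper _ hiL) hsi α
      (Ns i) aa bb _).symm
  have hshare : ∀ {c γ : ℝ}, BddAbove (Set.range b) → 0 < c →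
      (∀ n : ℕ, 1 ≤ n → c * (n:ℝ) ^ (-γ) ≤ b n) → SharesRatioLimits b w Ns t := by
    intro c γ hbB hc hbl
    have h := hvol.sharesRatioLimits hb0 hbB hc hbl hρ
      (by rw [rhoC_eq] at hcrit; exact hcrit) hLs hfix
    simp only [ht, rhoC_eq]
    exact h
  suffices h : ∃ p, Tendsto (fun i => cycProb aa bb (w i) (Ns i) (t i)) atTop (𝓝 p) ∧
      Tendsto (fun n : ℕ => cycProb aa bb b n n) atTop (𝓝 p) by
    obtain ⟨p, h1, h2⟩ := h
    exact ⟨p, h1.congr' hgibbs, h2.congr fun n => (sum_permWeight_eq_cycProb α n aa bb).symm⟩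
  have i₀ : Fin m := ⟨0, hm⟩
  rcases hα_case with ⟨αlim, hα, hsum⟩ | ⟨γ, hγ, hα⟩
  · obtain ⟨A, hA⟩ := (hα.sub_const αlim).abs.bddAbove_range
    replace hA : ∀ j, |α j - αlim| ≤ A := fun j => hA (Set.mem_range_self j)
    have hdiff := fun j => abs_exp_neg_sub_exp_neg_le (hA j)
    have hbl : Tendsto b atTop (𝓝 (Real.exp (-αlim))) := (Real.continuous_exp.tendsto _).comp hα.neg
    have hs1 : Summable (fun j => |α j - αlim|) → Summable fun j => |b j - Real.exp (-αlim)| :=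
      fun h => Summable.of_nonneg_of_le (fun j => abs_nonneg _) hdiff (h.mul_left _)
    have hs2 : Summable fun j : ℕ => |b j - Real.exp (-αlim)| / j := by
      have hX : Summable fun j : ℕ => |α j - αlim| / j := by
        rcases hsum with ⟨-, h⟩ | ⟨-, h⟩
        · refine Summable.of_nonneg_of_le (fun j => by positivity) (fun j => ?_) h
          rcases Nat.eq_zero_or_pos j with rfl | hj
          · simp
          · exact div_le_self (abs_nonneg _) (by exact_mod_cast hj)
        · exact h
      refine Summable.of_nonneg_of_le (fun j => by positivity) (fun j => ?_)
        (hX.mul_left (Real.exp (-αlim) * Real.exp A))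
      rw [← mul_div_assoc]
      exact div_le_div_of_nonneg_right (hdiff j) (Nat.cast_nonneg j)
    have : Nonempty (Fin m) := ⟨i₀⟩
    obtain ⟨i₁, hi₁⟩ := Finite.exists_min aa
    obtain ⟨p, hp⟩ := exists_limit_cycProb_of_tendsto (Real.exp_pos (-αlim)) hb0 hbl hs2
      (fun hθ => by
        rcases hsum with ⟨-, h⟩ | ⟨h, -⟩
        · exact hs1 h
        · exact absurd hθ (not_lt.2 (Real.one_le_exp (neg_nonneg.2 h))))
      (hab i₁).1 hi₁ (fun i => (hab i).2.1) (1 - rhoC d ε α / ρ)⁻¹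
    refine ⟨p, hp w Ns t (hshare (γ := 0) hbl.bddAbove_range (Real.exp_pos (-(αlim + A)))
      fun n _ => ?_) ?_, hp (fun _ => b) (fun n => n) (fun n => n) (sharesRatioLimits_self b) ?_⟩
    · rw [neg_zero, Real.rpow_zero, mul_one]
      exact Real.exp_le_exp.2 (by linarith [(abs_le.1 (hA n)).2])
    · filter_upwards [hNs.eventually_gt_atTop 0] with i hi
      have h0 : 0 < 1 - rhoC d ε α / ρ := by linarith
      have hi' : (0:ℝ) < Ns i := by exact_mod_cast hi
      exact ⟨_root_.mul_pos h0 hi', by simp only [ht]; rw [inv_mul_cancel_left₀ h0.ne']⟩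
    · filter_upwards [eventually_gt_atTop 0] with n hn
      have hn' : (0:ℝ) < n := by exact_mod_cast hn
      exact ⟨hn', le_mul_of_one_le_left hn'.le (one_le_inv₀ (by linarith) |>.2 (by linarith))⟩
  · have hbγ : ∀ j : ℕ, 1 ≤ j → b j = (j:ℝ) ^ (-γ) := fun j hj => by
      have hj0 : (0:ℝ) < j := by exact_mod_cast hj
      simp only [hb, hα j hj]
      rw [Real.rpow_def_of_pos hj0]; ring_nf
    have hbB : BddAbove (Set.range b) := by
      refine ⟨max (b 0) 1, ?_⟩
      rintro _ ⟨j, rfl⟩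
      rcases Nat.eq_zero_or_pos j with rfl | hj
      · exact le_max_left _ _
      · refine le_max_of_le_right ?_
        rw [hbγ j hj]
        exact Real.rpow_le_one_of_one_le_of_nonpos (by exact_mod_cast hj) (by linarith)
    have hsh := hshare hbB one_pos fun n hn => by rw [one_mul, hbγ n hn]
    obtain ⟨h1, h2, h3⟩ := hab ⟨0, hm⟩
    exact ⟨0, tendsto_cycProb_zero hγ hbγ ⟨0, hm⟩ rfl h1 h2 h3 hsh hw0,
      tendsto_cycProb_zero hγ hbγ ⟨0, hm⟩ rfl h1 h2 h3 (sharesRatioLimits_self b)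
        fun _ => hb0⟩
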